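/- For every a ∈ [1,3] one has φ_τ^(a) > 0. Moreover, for all a, a' ∈ [1,3] with a > a', one has the strict monotonicity φ_τ^(a') > φ_τ^(a). -/

import Mathlib

open MeasureTheory Set Filter ENNReal

noncomputable section

/-- The closed square `[-1,1]²` in `ℝ × ℝ`. -/
def Isq : Set (ℝ × ℝ) := Set.Icc (-1, -1) (1, 1)

/-- The open square `(-1,1)²` in `ℝ × ℝ`. -/
def Osq : Set (ℝ × ℝ) := Set.Ioo (-1, -1) (1, 1)

/-- `τ` is a norm on `ℝ²`. -/
def IsNorm2 (τ : ℝ × ℝ → ℝ) : Prop :=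
  (∀ x, τ x = 0 ↔ x = 0) ∧ (∀ (c : ℝ) (x), τ (c • x) = |c| * τ x) ∧
    ∀ x y, τ (x + y) ≤ τ x + τ y

/-- The Euclidean norm on `ℝ × ℝ`. -/
def eNorm2 (v : ℝ × ℝ) : ℝ := Real.sqrt (v.1 ^ 2 + v.2 ^ 2)

/-- The dual norm `τ*` of a norm `τ` on `ℝ²`. -/
def dualNorm (τ : ℝ × ℝ → ℝ) (w : ℝ × ℝ) : ℝ :=
  sSup {x | ∃ v : ℝ × ℝ, τ v ≤ 1 ∧ x = v.1 * w.1 + v.2 * w.2}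

/-- The divergence of a vector field on `ℝ²`. -/
def div2 (f : ℝ × ℝ → ℝ × ℝ) (x : ℝ × ℝ) : ℝ :=
  (fderiv ℝ f x (1, 0)).1 + (fderiv ℝ f x (0, 1)).2

/-- The perimeter `per(∂E)` of a set `E ⊆ ℝ²`, as the supremum of `∫_E div f`
over smooth compactly supported vector fields with `|f|₂ ≤ 1`. -/
def per (E : Set (ℝ × ℝ)) : ℝ≥0∞ :=
  ⨆ f ∈ {f : ℝ × ℝ → ℝ × ℝ |
      ContDiff ℝ (⊤ : ℕ∞) f ∧ HasCompactSupport f ∧ ∀ x, eNorm2 (f x) ≤ 1},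
    ENNReal.ofReal (∫ x in E, div2 f x)

/-- The restricted surface energy `I_τ(∂E)`: the supremum of `∫_E div f` over smooth
vector fields compactly supported in the open square with `τ*(f) ≤ 1`. -/
def surfE (τ : ℝ × ℝ → ℝ) (E : Set (ℝ × ℝ)) : ℝ≥0∞ :=
  ⨆ f ∈ {f : ℝ × ℝ → ℝ × ℝ |
      ContDiff ℝ (⊤ : ℕ∞) f ∧ HasCompactSupport f ∧ tsupport f ⊆ Osq ∧
        ∀ x, dualNorm τ (f x) ≤ 1},
    ENNReal.ofReal (∫ x in E, div2 f x)

/-- `E ∈ 𝒞`: `E` is a subset of `[-1,1]²` of finite perimeter. -/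
def MemC (E : Set (ℝ × ℝ)) : Prop := E ⊆ Isq ∧ per E ≠ ⊤

open Classical in
/-- The conductance `I_τ(∂E)/Leb(E)` of `E`, with the convention `0/0 = ∞`. -/
def conduct (τ : ℝ × ℝ → ℝ) (E : Set (ℝ × ℝ)) : ℝ≥0∞ :=
  if volume E = 0 then ⊤ else surfE τ E / volume E

/-- The optimal conductance `ψ_τ^(a)` over sets of finite perimeter in the square. -/
def psi (τ : ℝ × ℝ → ℝ) (a : ℝ) : ℝ≥0∞ :=
  ⨅ E ∈ {E : Set (ℝ × ℝ) | MemC E ∧ volume E ≤ ENNReal.ofReal a}, conduct τ E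

/-- The set of optimizers `𝒞_τ^(a)`. -/
def Copt (τ : ℝ × ℝ → ℝ) (a : ℝ) : Set (Set (ℝ × ℝ)) :=
  {E | MemC E ∧ volume E ≤ ENNReal.ofReal a ∧ conduct τ E = psi τ a}

/-- A set of finite perimeter is decomposable if it can be split into two parts of positive
measure whose perimeters add up to the perimeter of the whole. -/
def Decomposable (E : Set (ℝ × ℝ)) : Prop :=
  ∃ A B : Set (ℝ × ℝ), E = A ∪ B ∧ Disjoint A B ∧ 0 < volume A ∧ 0 < volume B ∧
    per E = per A + per B

/-- The length of the curve `γ` measured with the gauge `β`: the supremum, over partitions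
`0 = t₀ ≤ t₁ ≤ ⋯ ≤ t_n = 1`, of `∑ β(γ(t_j) - γ(t_{j-1}))`. -/
def varLength (β : ℝ × ℝ → ℝ) (γ : ℝ → ℝ × ℝ) : ℝ≥0∞ :=
  ⨆ (n : ℕ) (t : Fin (n + 1) → ℝ)
    (_ : Monotone t ∧ t 0 = 0 ∧ t (Fin.last n) = 1),
    ENNReal.ofReal (∑ i : Fin n, β (γ (t i.succ) - γ (t i.castSucc)))

/-- `C` is a rectifiable Jordan curve: the image of a continuous injective map of the unit
circle (equivalently, a continuous `1`-periodic map injective on `[0,1)`) of finite length. -/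
def IsRectJordanCurve (C : Set (ℝ × ℝ)) : Prop :=
  ∃ γ : ℝ → ℝ × ℝ, Continuous γ ∧ (∀ t, γ (t + 1) = γ t) ∧
    Set.InjOn γ (Set.Ico 0 1) ∧ C = γ '' Set.Icc 0 1 ∧ varLength eNorm2 γ ≠ ⊤

/-- The hull of a curve `C`: the union of `C` with all bounded connected components of its
complement. -/
def hullSet (C : Set (ℝ × ℝ)) : Set (ℝ × ℝ) :=
  C ∪ {x | x ∉ C ∧ Bornology.IsBounded (connectedComponentIn Cᶜ x)}

/-- `R ∈ ℛ`: `R` is a compact subset of the square with nonempty interior whose boundary is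
a finite union of rectifiable Jordan curves, any two of which have `ℋ¹`-null intersection. -/
def MemR (R : Set (ℝ × ℝ)) : Prop :=
  IsCompact R ∧ R ⊆ Isq ∧ (interior R).Nonempty ∧
    ∃ F : Finset (Set (ℝ × ℝ)),
      (∀ C ∈ F, IsRectJordanCurve C) ∧ frontier R = ⋃ C ∈ F, C ∧
        ∀ C ∈ F, ∀ C' ∈ F, C ≠ C' →
          (MeasureTheory.Measure.hausdorffMeasure 1 : Measure (ℝ × ℝ)) (C ∩ C') = 0

/-- The optimal conductance `φ_τ^(a)` over the class `ℛ`. -/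
def phiR (τ : ℝ × ℝ → ℝ) (a : ℝ) : ℝ≥0∞ :=
  ⨅ R ∈ {R : Set (ℝ × ℝ) | MemR R ∧ volume R ≤ ENNReal.ofReal a}, conduct τ R

/-- The set of optimizers `ℛ_τ^(a)`. -/
def Ropt (τ : ℝ × ℝ → ℝ) (a : ℝ) : Set (Set (ℝ × ℝ)) :=
  {R | MemR R ∧ volume R ≤ ENNReal.ofReal a ∧ conduct τ R = phiR τ a}

/-- `L¹` convergence of sets: `Leb(E_k Δ E₀) → 0`. -/
def TendstoL1 (E : ℕ → Set (ℝ × ℝ)) (E₀ : Set (ℝ × ℝ)) : Prop :=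
  Tendsto (fun k => volume (symmDiff (E k) E₀)) atTop (nhds 0)

/-- `ρ` is a (piecewise-linear) polygonal curve on `[0,1]`. -/
def IsPolygonal (ρ : ℝ → ℝ × ℝ) : Prop :=
  ∃ (n : ℕ) (s : Fin (n + 1) → ℝ), Monotone s ∧ s 0 = 0 ∧ s (Fin.last n) = 1 ∧
    ∀ i : Fin n, ∀ t ∈ Set.Icc (s i.castSucc) (s i.succ),
      ρ t = ρ (s i.castSucc) +
        ((t - s i.castSucc) / (s i.succ - s i.castSucc)) • (ρ (s i.succ) - ρ (s i.castSucc))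

end

open MeasureTheory Set Filter ENNReal

/-- Euclidean pairing. -/
def dot2 (v w : ℝ × ℝ) : ℝ := v.1 * w.1 + v.2 * w.2

/-- Admissible covectors: the unit ball of the dual norm. -/
def Adm (τ : ℝ × ℝ → ℝ) (w : ℝ × ℝ) : Prop := ∀ v, dot2 v w ≤ τ v

namespace IsNorm2
variable {τ : ℝ × ℝ → ℝ}

lemma zero (h : IsNorm2 τ) : τ 0 = 0 := (h.1 0).2 rfl
lemma neg (h : IsNorm2 τ) (x) : τ (-x) = τ x := by
  have := h.2.1 (-1) x
  simpa using this
lemma nonneg (h : IsNorm2 τ) (x) : 0 ≤ τ x := by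
  have h1 := h.2.2 x (-x)
  rw [h.neg, add_neg_cancel, h.zero] at h1
  linarith
lemma smul (h : IsNorm2 τ) (c : ℝ) (x) : τ (c • x) = |c| * τ x := h.2.1 c x
lemma add_le (h : IsNorm2 τ) (x y) : τ (x + y) ≤ τ x + τ y := h.2.2 x y
lemma pos (h : IsNorm2 τ) {x} (hx : x ≠ 0) : 0 < τ x :=
  lt_of_le_of_ne (h.nonneg x) (fun h0 => hx ((h.1 x).1 h0.symm))
lemma sub_le (h : IsNorm2 τ) (x y) : τ x - τ y ≤ τ (x - y) := by
  have := h.add_le (x - y) y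
  rw [sub_add_cancel] at this
  linarith
lemma upper (h : IsNorm2 τ) : ∃ K : ℝ, 0 < K ∧ ∀ x, τ x ≤ K * ‖x‖ := by
  refine ⟨τ (1,0) + τ (0,1), ?_, fun x => ?_⟩
  · have := h.pos (x := (1,0)) (by simp)
    have := h.nonneg (0,1)
    linarith
  · have e : x = x.1 • ((1:ℝ),(0:ℝ)) + x.2 • ((0:ℝ),(1:ℝ)) := by ext <;> simp
    have h1 : |x.1| ≤ ‖x‖ := norm_fst_le x
    have h2 : |x.2| ≤ ‖x‖ := norm_snd_le x
    calc τ x = τ (x.1 • ((1:ℝ),(0:ℝ)) + x.2 • ((0:ℝ),(1:ℝ))) := by rw [← e]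
      _ ≤ |x.1| * τ (1,0) + |x.2| * τ (0,1) := by
        refine (h.add_le _ _).trans ?_
        rw [h.smul, h.smul]
      _ ≤ ‖x‖ * τ (1,0) + ‖x‖ * τ (0,1) := by
        gcongr
        · exact h.nonneg _
        · exact h.nonneg _
      _ = _ := by ring
lemma abs_sub_le (h : IsNorm2 τ) (x y) : |τ x - τ y| ≤ τ (x - y) := by
  rw [abs_le]
  have h1 := h.sub_le x y
  have h2 := h.sub_le y x
  rw [← neg_sub x y, h.neg] at h2
  constructor <;> linarith
lemma continuous (h : IsNorm2 τ) : Continuous τ := by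
  obtain ⟨K, hK, hb⟩ := h.upper
  have : LipschitzWith ⟨K, hK.le⟩ τ := by
    apply LipschitzWith.of_dist_le_mul
    intro x y
    rw [Real.dist_eq, dist_eq_norm]
    exact (h.abs_sub_le x y).trans (hb _)
  exact this.continuous
lemma lower (h : IsNorm2 τ) : ∃ k : ℝ, 0 < k ∧ ∀ x, k * ‖x‖ ≤ τ x := by
  have hc : IsCompact (Metric.sphere (0 : ℝ × ℝ) 1) := isCompact_sphere 0 1
  have hne : (Metric.sphere (0 : ℝ × ℝ) 1).Nonempty := ⟨(1, 0), by simp⟩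
  obtain ⟨z, hz, hmin⟩ := hc.exists_isMinOn hne h.continuous.continuousOn
  have hz0 : z ≠ 0 := by
    rintro rfl
    simp at hz
  refine ⟨τ z, h.pos hz0, fun x => ?_⟩
  by_cases hx : x = 0
  · simp [hx, h.zero]
  · have hn : 0 < ‖x‖ := norm_pos_iff.2 hx
    have hm : τ z ≤ τ (‖x‖⁻¹ • x) := by
      apply hmin
      simp [norm_smul, hn.ne']
    rw [h.smul, abs_of_pos (inv_pos.2 hn)] at hm
    calc τ z * ‖x‖ ≤ (‖x‖⁻¹ * τ x) * ‖x‖ := by gcongr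
      _ = τ x := by field_simp
/-- swapped norm -/
lemma swap (h : IsNorm2 τ) : IsNorm2 (fun x => τ x.swap) := by
  refine ⟨fun x => ?_, fun c x => ?_, fun x y => ?_⟩
  · rw [h.1]
    constructor
    · intro hx
      rw [← Prod.swap_swap x, hx]; rfl
    · rintro rfl; rfl
  · show τ (c • x.swap) = _
    rw [h.smul]
  · exact h.add_le x.swap y.swap
end IsNorm2

lemma abs_dot2_le (v w : ℝ × ℝ) : |dot2 v w| ≤ 2 * ‖v‖ * ‖w‖ := by
  unfold dot2
  have h1 : |v.1| ≤ ‖v‖ := norm_fst_le v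
  have h2 : |v.2| ≤ ‖v‖ := norm_snd_le v
  have h3 : |w.1| ≤ ‖w‖ := norm_fst_le w
  have h4 : |w.2| ≤ ‖w‖ := norm_snd_le w
  calc |v.1 * w.1 + v.2 * w.2| ≤ |v.1 * w.1| + |v.2 * w.2| := abs_add_le _ _
    _ = |v.1| * |w.1| + |v.2| * |w.2| := by rw [abs_mul, abs_mul]
    _ ≤ ‖v‖ * ‖w‖ + ‖v‖ * ‖w‖ := by gcongr
    _ = _ := by ring

lemma dualNorm_le_one_iff {τ : ℝ × ℝ → ℝ} (h : IsNorm2 τ) (w : ℝ × ℝ) :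
    dualNorm τ w ≤ 1 ↔ Adm τ w := by
  obtain ⟨k, hk, hlow⟩ := h.lower
  have hbdd : BddAbove {x | ∃ v : ℝ × ℝ, τ v ≤ 1 ∧ x = v.1 * w.1 + v.2 * w.2} := by
    refine ⟨2 * k⁻¹ * ‖w‖, ?_⟩
    rintro x ⟨v, hv, rfl⟩
    have h1 := (le_abs_self _).trans (abs_dot2_le v w)
    unfold dot2 at h1
    refine h1.trans ?_
    have h2 : ‖v‖ ≤ k⁻¹ := by
      rw [← mul_one k⁻¹, ← div_eq_inv_mul, le_div_iff₀ hk, mul_comm]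
      exact (hlow v).trans hv
    gcongr
  constructor
  · intro hd v
    by_cases hv : v = 0
    · subst hv; simp [dot2, h.zero]
    · have hp := h.pos hv
      have : dot2 ((τ v)⁻¹ • v) w ≤ 1 := by
        refine le_trans (le_csSup hbdd ⟨(τ v)⁻¹ • v, ?_, rfl⟩) hd
        rw [h.smul, abs_of_pos (inv_pos.2 hp), inv_mul_cancel₀ hp.ne']
      have e : dot2 ((τ v)⁻¹ • v) w = (τ v)⁻¹ * dot2 v w := by
        simp [dot2]; ring
      rw [e, inv_mul_le_iff₀ hp, mul_one] at this
      exact this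
  · intro ha
    apply csSup_le
    · exact ⟨0, 0, by simp [h.zero], by simp⟩
    · rintro x ⟨v, hv, rfl⟩
      exact (ha v).trans hv

lemma Adm.neg {τ : ℝ × ℝ → ℝ} (h : IsNorm2 τ) {w} (ha : Adm τ w) : Adm τ (-w) := by
  intro v
  have := ha (-v)
  rw [h.neg] at this
  simp [dot2] at this ⊢
  linarith

lemma Adm.zero {τ : ℝ × ℝ → ℝ} (h : IsNorm2 τ) : Adm τ 0 := by
  intro v
  simpa [dot2] using h.nonneg v

lemma Adm.smul {τ : ℝ × ℝ → ℝ} (h : IsNorm2 τ) {w} (ha : Adm τ w) {c : ℝ} (h0 : 0 ≤ c) (h1 : c ≤ 1) :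
    Adm τ (c • w) := by
  intro v
  have e : dot2 v (c • w) = c * dot2 v w := by simp [dot2]; ring
  rw [e]
  have := ha v
  have := h.nonneg v
  nlinarith

lemma Adm.smul_abs {τ : ℝ × ℝ → ℝ} (h : IsNorm2 τ) {w} (ha : Adm τ w) {c : ℝ} (h1 : |c| ≤ 1) :
    Adm τ (c • w) := by
  rcases le_total 0 c with h0 | h0
  · exact ha.smul h h0 (by rwa [abs_of_nonneg h0] at h1)
  · have := (ha.neg h).smul h (c := -c) (by linarith) (by rwa [abs_of_nonpos h0] at h1)
    simpa using this

lemma adm_convex {τ : ℝ × ℝ → ℝ} {w w'} (ha : Adm τ w) (hb : Adm τ w') {s t : ℝ} (hs : 0 ≤ s)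
    (ht : 0 ≤ t) (hst : s + t = 1) : Adm τ (s • w + t • w') := by
  intro v
  have e : dot2 v (s • w + t • w') = s * dot2 v w + t * dot2 v w' := by simp [dot2]; ring
  rw [e]
  have h1 := ha v
  have h2 := hb v
  calc s * dot2 v w + t * dot2 v w' ≤ s * τ v + t * τ v := by gcongr
    _ = τ v := by rw [← add_mul, hst, one_mul]

lemma adm_bound {τ : ℝ × ℝ → ℝ} (h : IsNorm2 τ) : ∃ K : ℝ, 0 < K ∧ ∀ w, Adm τ w → ‖w‖ ≤ K := by
  obtain ⟨K, hK, hb⟩ := h.upper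
  refine ⟨K, hK, fun w hw => ?_⟩
  rw [Prod.norm_def]
  have a1 := hw (1,0)
  have a2 := hw (-1,0)
  have a3 := hw (0,1)
  have a4 := hw (0,-1)
  have b1 := hb (1,0)
  have b2 := hb (-1,0)
  have b3 := hb (0,1)
  have b4 := hb (0,-1)
  simp [dot2, Prod.norm_def] at a1 a2 a3 a4 b1 b2 b3 b4
  apply max_le
  · rw [Real.norm_eq_abs, abs_le]; constructor <;> linarith
  · rw [Real.norm_eq_abs, abs_le]; constructor <;> linarith

/-- The true open square. -/
def Usq : Set (ℝ × ℝ) := {x | |x.1| < 1 ∧ |x.2| < 1}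

lemma mem_Isq {x : ℝ × ℝ} : x ∈ Isq ↔ |x.1| ≤ 1 ∧ |x.2| ≤ 1 := by
  unfold Isq
  rw [mem_Icc, Prod.le_def, Prod.le_def, abs_le, abs_le]
  tauto

lemma Usq_subset_Osq : Usq ⊆ Osq := by
  rintro ⟨x, y⟩ ⟨h1, h2⟩
  simp only [abs_lt] at h1 h2
  constructor
  · rw [Prod.mk_lt_mk]; left; exact ⟨h1.1, h2.1.le⟩
  · rw [Prod.mk_lt_mk]; left; exact ⟨h1.2, h2.2.le⟩

lemma Osq_subset_Isq : Osq ⊆ Isq := Ioo_subset_Icc_self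
lemma Usq_subset_Isq : Usq ⊆ Isq := Usq_subset_Osq.trans Osq_subset_Isq
lemma isCompact_Isq : IsCompact Isq := isCompact_Icc
lemma measurableSet_Isq : MeasurableSet Isq := measurableSet_Icc
lemma isOpen_Usq : IsOpen Usq := by
  unfold Usq
  exact (isOpen_lt (by fun_prop : Continuous fun x : ℝ × ℝ => |x.1|) continuous_const).inter
    (isOpen_lt (by fun_prop : Continuous fun x : ℝ × ℝ => |x.2|) continuous_const)

lemma Isq_eq_prod : Isq = Icc (-1:ℝ) 1 ×ˢ Icc (-1:ℝ) 1 := by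
  unfold Isq; rw [Icc_prod_eq]

lemma volume_Isq : volume Isq = 4 := by
  rw [Isq_eq_prod, Measure.volume_eq_prod, Measure.prod_prod]
  norm_num

/-- Test fields. -/
structure TF (τ : ℝ × ℝ → ℝ) (f : ℝ × ℝ → ℝ × ℝ) : Prop where
  smooth : ContDiff ℝ (⊤ : ℕ∞) f
  cs : HasCompactSupport f
  supp : tsupport f ⊆ Usq
  adm : ∀ x, Adm τ (f x)

/-- Surface energy at most `c`. -/
def Per (τ : ℝ × ℝ → ℝ) (E : Set (ℝ × ℝ)) (c : ℝ) : Prop :=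
  ∀ f, TF τ f → ∫ x in E, div2 f x ≤ c

open MeasureTheory Set Filter ENNReal

lemma div2_continuous {f : ℝ × ℝ → ℝ × ℝ} (hf : ContDiff ℝ (⊤ : ℕ∞) f) : Continuous (div2 f) := by
  have h1 : Continuous (fderiv ℝ f) := hf.continuous_fderiv (by simp)
  unfold div2
  fun_prop

lemma div2_zero {f : ℝ × ℝ → ℝ × ℝ} {x} (hx : x ∉ tsupport f) : div2 f x = 0 := by
  unfold div2
  rw [fderiv_of_notMem_tsupport ℝ hx]
  simp

lemma div2_cs {f : ℝ × ℝ → ℝ × ℝ} (hc : HasCompactSupport f) : HasCompactSupport (div2 f) := by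
  apply HasCompactSupport.of_support_subset_isCompact hc
  intro x hx
  by_contra h
  exact hx (div2_zero h)

lemma div2_integrable {f : ℝ × ℝ → ℝ × ℝ} (hf : ContDiff ℝ (⊤ : ℕ∞) f) (hc : HasCompactSupport f) :
    Integrable (div2 f) :=
  (div2_continuous hf).integrable_of_hasCompactSupport (div2_cs hc)

lemma div2_bound {f : ℝ × ℝ → ℝ × ℝ} (hf : ContDiff ℝ (⊤ : ℕ∞) f) (hc : HasCompactSupport f) :
    ∃ C, ∀ x, |div2 f x| ≤ C := by
  obtain ⟨C, hC⟩ := (div2_cs hc).exists_bound_of_continuous (div2_continuous hf)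
  exact ⟨C, hC⟩

lemma div2_neg (f : ℝ × ℝ → ℝ × ℝ) (x) : div2 (-f) x = - div2 f x := by
  unfold div2
  rw [fderiv_neg]
  simp; ring

lemma div2_neg' (f : ℝ × ℝ → ℝ × ℝ) (x) : div2 (fun x => -f x) x = - div2 f x := div2_neg f x

lemma div2_add {f g : ℝ × ℝ → ℝ × ℝ} {x} (hf : DifferentiableAt ℝ f x) (hg : DifferentiableAt ℝ g x) :
    div2 (fun x => f x + g x) x = div2 f x + div2 g x := by
  unfold div2
  rw [fderiv_fun_add hf hg]
  simp; ring

lemma div2_smul {f : ℝ × ℝ → ℝ × ℝ} {χ : ℝ × ℝ → ℝ} {x} (hf : DifferentiableAt ℝ f x)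
    (hg : DifferentiableAt ℝ χ x) :
    div2 (fun x => χ x • f x) x = χ x * div2 f x + (fderiv ℝ χ x (1,0) * (f x).1 +
      fderiv ℝ χ x (0,1) * (f x).2) := by
  unfold div2
  rw [fderiv_fun_smul hg hf]
  simp; ring

lemma div2_comp_affine {f : ℝ × ℝ → ℝ × ℝ} (ρ : ℝ) (b : ℝ × ℝ) {x}
    (hf : DifferentiableAt ℝ f (ρ • x + b)) :
    div2 (fun x => f (ρ • x + b)) x = ρ * div2 f (ρ • x + b) := by
  unfold div2
  have h1 : HasFDerivAt (fun x : ℝ × ℝ => ρ • x + b) (ρ • ContinuousLinearMap.id ℝ (ℝ × ℝ)) x := by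
    exact ((hasFDerivAt_id x).const_smul ρ).add_const b
  have h2 := (hf.hasFDerivAt.comp x h1).fderiv
  have h3 : fderiv ℝ (fun x => f (ρ • x + b)) x = (fderiv ℝ f (ρ • x + b)).comp
      (ρ • ContinuousLinearMap.id ℝ (ℝ × ℝ)) := h2
  rw [h3]
  simp only [ContinuousLinearMap.comp_apply, _root_.smul_apply,
    ContinuousLinearMap.id_apply, map_smul, Prod.smul_fst, Prod.smul_snd, smul_eq_mul]
  ring

lemma integral_fderiv_zero {g : ℝ × ℝ → ℝ} (hg : ContDiff ℝ (⊤ : ℕ∞) g) (hc : HasCompactSupport g) (v) :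
    ∫ x, fderiv ℝ g x v = 0 := by
  have h1 : Continuous (fderiv ℝ g) := hg.continuous_fderiv (by simp)
  have := integral_mul_fderiv_eq_neg_fderiv_mul_of_integrable (𝕜 := ℝ) (μ := volume) (f := fun _ : ℝ × ℝ => (1:ℝ))
    (g := g) (v := v) (by simp) (by
      simp only [one_mul]
      apply Continuous.integrable_of_hasCompactSupport (by fun_prop)
      exact (hc.fderiv (𝕜 := ℝ)).comp_left (g := fun L : (ℝ × ℝ) →L[ℝ] ℝ => L v) (by simp))
      (by simpa using hg.continuous.integrable_of_hasCompactSupport hc) (by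
      intro x _; fun_prop) (by intro x _; exact (hg.differentiable (by simp)).differentiableAt)
  simpa using this

lemma integral_div2_zero {f : ℝ × ℝ → ℝ × ℝ} (hf : ContDiff ℝ (⊤ : ℕ∞) f) (hc : HasCompactSupport f) :
    ∫ x, div2 f x = 0 := by
  have hd : Differentiable ℝ f := hf.differentiable (by simp)
  have e : ∀ x, div2 f x = fderiv ℝ (fun x => (f x).1) x (1,0) + fderiv ℝ (fun x => (f x).2) x (0,1) := by
    intro x
    unfold div2
    rw [(hd x).hasFDerivAt.fst.fderiv, (hd x).hasFDerivAt.snd.fderiv]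
    simp
  have c1 : ContDiff ℝ (⊤ : ℕ∞) (fun x => (f x).1) := hf.fst
  have c2 : ContDiff ℝ (⊤ : ℕ∞) (fun x => (f x).2) := hf.snd
  have s1 : HasCompactSupport (fun x => (f x).1) := hc.comp_left (g := Prod.fst) rfl
  have s2 : HasCompactSupport (fun x => (f x).2) := hc.comp_left (g := Prod.snd) rfl
  have i : ∀ {g : ℝ × ℝ → ℝ} (_ : ContDiff ℝ (⊤ : ℕ∞) g) (_ : HasCompactSupport g) (v),
      Integrable (fun x => fderiv ℝ g x v) := by
    intro g hg hc v
    have h1 : Continuous (fderiv ℝ g) := hg.continuous_fderiv (by simp)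
    apply Continuous.integrable_of_hasCompactSupport (by fun_prop)
    exact (hc.fderiv (𝕜 := ℝ)).comp_left (g := fun L : (ℝ × ℝ) →L[ℝ] ℝ => L v) (by simp)
  simp_rw [e]
  rw [integral_add (i c1 s1 _) (i c2 s2 _), integral_fderiv_zero c1 s1, integral_fderiv_zero c2 s2,
    add_zero]

lemma TF.neg {τ f} (h : IsNorm2 τ) (hf : TF τ f) : TF τ (-f) := by
  refine ⟨hf.smooth.neg, hf.cs.neg, ?_, fun x => (hf.adm x).neg h⟩
  rw [tsupport_neg]; exact hf.supp

lemma TF.zero {τ} (h : IsNorm2 τ) : TF τ (fun _ => 0) := by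
  refine ⟨contDiff_const, HasCompactSupport.zero, ?_, fun x => Adm.zero h⟩
  have : tsupport (fun _ : ℝ × ℝ => (0 : ℝ × ℝ)) = ∅ := by
    rw [tsupport_eq_empty_iff]; rfl
  rw [this]; simp

lemma Per.nonneg {τ E c} (h : IsNorm2 τ) (hp : Per τ E c) : 0 ≤ c := by
  have := hp _ (TF.zero h)
  simpa [div2] using this

lemma Per.mono {τ E c c'} (hp : Per τ E c) (h : c ≤ c') : Per τ E c' :=
  fun f hf => (hp f hf).trans h

lemma TF.div2_zero {τ f} (hf : TF τ f) {x} (hx : x ∉ Usq) : div2 f x = 0 :=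
  _root_.div2_zero (fun h => hx (hf.supp h))

lemma Per.compl {τ E c} (h : IsNorm2 τ) (hE : MeasurableSet E) (hp : Per τ E c) : Per τ (Isq \ E) c := by
  intro f hf
  have h1 := hp _ (hf.neg h)
  simp_rw [div2_neg] at h1
  rw [integral_neg] at h1
  have hi := div2_integrable hf.smooth hf.cs
  have h2 : ∫ x in Isq, div2 f x = 0 := by
    rw [setIntegral_eq_integral_of_forall_compl_eq_zero]
    · exact integral_div2_zero hf.smooth hf.cs
    · intro x hx
      exact hf.div2_zero (fun h => hx (Usq_subset_Isq h))
  have h3 : ∫ x in Isq ∩ E, div2 f x = ∫ x in E, div2 f x := by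
    rw [← integral_indicator (measurableSet_Isq.inter hE), ← integral_indicator hE]
    congr 1
    ext x
    by_cases hx : x ∈ Isq
    · by_cases hxE : x ∈ E <;> simp [hx, hxE]
    · have := hf.div2_zero (fun h => hx (Usq_subset_Isq h))
      simp [indicator, hx, this]
  have h4 := integral_inter_add_sdiff hE hi.integrableOn (s := Isq)
  linarith

lemma per_of_surfE {τ E} {c : ℝ} (h : IsNorm2 τ) (hc : 0 ≤ c) (hs : surfE τ E ≤ ENNReal.ofReal c) :
    Per τ E c := by
  intro f hf
  have h1 : ENNReal.ofReal (∫ x in E, div2 f x) ≤ surfE τ E := by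
    unfold surfE
    apply le_iSup₂ (f := fun f _ => ENNReal.ofReal (∫ x in E, div2 f x)) f
    exact ⟨hf.smooth, hf.cs, hf.supp.trans Usq_subset_Osq, fun x => (dualNorm_le_one_iff h _).2 (hf.adm x)⟩
  exact (ENNReal.ofReal_le_ofReal_iff hc).1 (h1.trans hs)

lemma surfE_le_of_per {τ E} {c : ℝ} (h : IsNorm2 τ) (hp : Per τ E c) :
    surfE τ E ≤ ENNReal.ofReal c := by
  unfold surfE
  apply iSup₂_le
  rintro f ⟨hf, hc, hs, ha⟩
  apply ENNReal.ofReal_le_ofReal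
  have hd : Differentiable ℝ f := hf.differentiable (by simp)
  have hfI : tsupport f ⊆ Isq := hs.trans Osq_subset_Isq
  -- dilations
  let r : ℕ → ℝ := fun n => 1 + 1 / ((n:ℝ) + 1)
  have hr : ∀ n, 1 < r n := fun n => by
    have : (0:ℝ) < 1 / ((n:ℝ) + 1) := by positivity
    simp only [r]; linarith
  have hr2 : ∀ n, r n ≤ 2 := fun n => by
    have : 1 / ((n:ℝ) + 1) ≤ 1 := by
      rw [div_le_one (by positivity)]
      have : (0:ℝ) ≤ n := by positivity
      linarith
    simp only [r]; linarith
  have hrlim : Tendsto r atTop (nhds 1) := by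
    have := tendsto_one_div_add_atTop_nhds_zero_nat (𝕜 := ℝ)
    simpa [r] using this.const_add 1
  have key : ∀ n, ∀ x, f (r n • x + 0) ≠ 0 → ‖x‖ ≤ (r n)⁻¹ := by
    intro n x hx
    have hm := mem_Isq.1 (hfI (subset_tsupport _ hx))
    have h0 : 0 < r n := by linarith [hr n]
    have : ‖r n • x + 0‖ ≤ 1 := by
      rw [Prod.norm_def]; exact max_le hm.1 hm.2
    rw [add_zero, norm_smul, Real.norm_eq_abs, abs_of_pos h0] at this
    rw [← mul_one (r n)⁻¹, ← div_eq_inv_mul, le_div_iff₀ h0]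
    linarith
  have hT : ∀ n, TF τ (fun x => f (r n • x + 0)) := by
    intro n
    have hsub : tsupport (fun x => f (r n • x + 0)) ⊆ Metric.closedBall 0 (r n)⁻¹ := by
      apply closure_minimal _ Metric.isClosed_closedBall
      intro x hx
      simpa using key n x hx
    refine ⟨hf.comp (by fun_prop), ?_, ?_, fun x => (dualNorm_le_one_iff h _).1 (ha _)⟩
    · exact IsCompact.of_isClosed_subset (isCompact_closedBall _ _) (isClosed_tsupport _) hsub
    · refine hsub.trans ?_
      intro x hx
      have h1 : ‖x‖ < 1 := lt_of_le_of_lt (by simpa using hx) (inv_lt_one_of_one_lt₀ (hr n))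
      exact ⟨lt_of_le_of_lt (norm_fst_le x) h1, lt_of_le_of_lt (norm_snd_le x) h1⟩
  obtain ⟨C, hC⟩ := div2_bound hf hc
  have hlim : Tendsto (fun n => ∫ x in E, div2 (fun x => f (r n • x + 0)) x) atTop
      (nhds (∫ x in E, div2 f x)) := by
    apply tendsto_integral_of_dominated_convergence (fun x => Isq.indicator (fun _ => 2 * C) x)
    · intro n
      exact (div2_continuous (hT n).smooth).aestronglyMeasurable
    · apply Integrable.integrableOn
      rw [integrable_indicator_iff measurableSet_Isq]
      exact integrableOn_const (by rw [volume_Isq]; simp) 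
    · intro n
      refine Eventually.of_forall fun x => ?_
      by_cases hx : x ∈ Isq
      · rw [indicator_of_mem hx, div2_comp_affine _ _ (hd _), norm_mul]
        have := hr n
        rw [Real.norm_eq_abs, abs_of_pos (by linarith)]
        exact mul_le_mul (hr2 n) (hC _) (norm_nonneg _) (by norm_num)
      · rw [(hT n).div2_zero (fun h => hx (Usq_subset_Isq h)), indicator_of_notMem hx]; simp
    · refine Eventually.of_forall fun x => ?_
      have e : ∀ n, div2 (fun x => f (r n • x + 0)) x = r n * div2 f (r n • x + 0) :=
        fun n => div2_comp_affine _ _ (hd _)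
      simp_rw [e]
      have hcont := div2_continuous hf
      have h2 : Tendsto (fun n => r n • x + 0) atTop (nhds ((1:ℝ) • x + 0)) :=
        (hrlim.smul_const x).add_const 0
      have h3 := hrlim.mul ((hcont.tendsto _).comp h2)
      simpa using h3
  exact le_of_tendsto hlim (Eventually.of_forall fun n => hp _ (hT n))

open MeasureTheory Set Filter ENNReal

/-- convolution of scalar functions on the plane -/
noncomputable def conv (K g : ℝ × ℝ → ℝ) (x : ℝ × ℝ) : ℝ := ∫ y, K (x - y) * g y

lemma conv_eq (K g : ℝ × ℝ → ℝ) :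
    convolution K g (ContinuousLinearMap.mul ℝ ℝ) volume = conv K g := by
  ext x
  rw [convolution_mul_swap]; rfl

lemma conv_integrand {K g : ℝ × ℝ → ℝ} (hK : Continuous K) (hc : HasCompactSupport K)
    (hg : Integrable g) (x) : Integrable (fun y => K (x - y) * g y) := by
  obtain ⟨C, hC⟩ := hc.exists_bound_of_continuous hK
  apply hg.bdd_mul (c := C)
  · exact (hK.comp (by fun_prop)).aestronglyMeasurable
  · exact Eventually.of_forall fun y => hC _

lemma conv_contDiff {K g : ℝ × ℝ → ℝ} (hK : ContDiff ℝ (⊤ : ℕ∞) K) (hc : HasCompactSupport K)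
    (hg : Integrable g) : ContDiff ℝ (⊤ : ℕ∞) (conv K g) := by
  rw [← conv_eq]
  exact hc.contDiff_convolution_left _ hK hg.locallyIntegrable

lemma conv_fderiv {K g : ℝ × ℝ → ℝ} (hK : ContDiff ℝ (⊤ : ℕ∞) K) (hc : HasCompactSupport K)
    (hg : Integrable g) (x v) :
    fderiv ℝ (conv K g) x v = conv (fun z => fderiv ℝ K z v) g x := by
  have h1 := (hc.hasFDerivAt_convolution_left (ContinuousLinearMap.mul ℝ ℝ) (hK.of_le (by simp))
    hg.locallyIntegrable x).fderiv
  rw [conv_eq] at h1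
  rw [h1, convolution_eq_swap, ContinuousLinearMap.integral_apply]
  · simp [conv]
  · have := (HasCompactSupport.convolutionExists_left (μ := volume)
      ((ContinuousLinearMap.mul ℝ ℝ).precompL (ℝ × ℝ)) (hc.fderiv (𝕜 := ℝ))
      (hK.continuous_fderiv (by simp)) hg.locallyIntegrable x)
    rw [convolutionExistsAt_iff_integrable_swap] at this
    exact this

lemma conv_adjoint {J A B : ℝ × ℝ → ℝ} (hJ : Continuous J) (hc : HasCompactSupport J)
    (hodd : ∀ x, J (-x) = - J x) (hA : Integrable A) (hB : Integrable B) :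
    ∫ x, conv J A x * B x = - ∫ x, A x * conv J B x := by
  obtain ⟨C, hC⟩ := hc.exists_bound_of_continuous hJ
  have hIntg : Integrable (Function.uncurry fun x y => J (x - y) * A y * B x)
      ((volume : Measure (ℝ × ℝ)).prod (volume : Measure (ℝ × ℝ))) := by
    have h1 := (hB.mul_prod hA).bdd_mul (c := C) (f := fun p : (ℝ × ℝ) × (ℝ × ℝ) => J (p.1 - p.2))
      (by exact (hJ.comp (by fun_prop)).aestronglyMeasurable)
      (Eventually.of_forall fun y => hC _)
    refine h1.congr (Eventually.of_forall fun p => ?_)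
    simp [Function.uncurry]; ring
  have e1 : ∀ x, conv J A x * B x = ∫ y, J (x - y) * A y * B x := by
    intro x
    rw [conv, ← integral_mul_const]
  have e2 : ∀ y, A y * conv J B y = ∫ x, - (J (x - y) * A y * B x) := by
    intro y
    rw [conv, ← integral_const_mul]
    congr 1
    ext x
    rw [← neg_sub x y, hodd]; ring
  simp_rw [e1, e2]
  rw [integral_integral_swap hIntg]
  simp_rw [integral_neg]
  rw [neg_neg]

/-- A mollifier of radius ε. -/
structure Moll (K : ℝ × ℝ → ℝ) (ε : ℝ) : Prop where
  smooth : ContDiff ℝ (⊤ : ℕ∞) K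
  supp : ∀ x, K x ≠ 0 → ‖x‖ < ε
  nonneg : ∀ x, 0 ≤ K x
  int : ∫ x, K x = 1
  even : ∀ x, K (-x) = K x

lemma Moll.cs {K ε} (h : Moll K ε) : HasCompactSupport K := by
  apply HasCompactSupport.of_support_subset_isCompact (isCompact_closedBall (0 : ℝ × ℝ) ε)
  intro x hx
  simpa using (h.supp x hx).le

lemma Moll.integrable {K ε} (h : Moll K ε) : Integrable K :=
  h.smooth.continuous.integrable_of_hasCompactSupport h.cs

lemma Moll.int_sub {K ε} (h : Moll K ε) (x) : ∫ y, K (x - y) = 1 := by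
  rw [integral_sub_left_eq_self K volume x, h.int]

lemma fderiv_odd {K : ℝ × ℝ → ℝ} (hK : Differentiable ℝ K) (he : ∀ x, K (-x) = K x) (x v) :
    fderiv ℝ K (-x) v = - fderiv ℝ K x v := by
  have h1 : HasFDerivAt (fun x => K (-x)) ((fderiv ℝ K (-x)).comp (-ContinuousLinearMap.id ℝ (ℝ × ℝ))) x :=
    ((hK (-x)).hasFDerivAt).comp x (hasFDerivAt_id x).neg
  have h2 : (fun x => K (-x)) = K := funext he
  rw [h2] at h1
  rw [h1.fderiv]; simp

lemma cs_fderiv_apply {K : ℝ × ℝ → ℝ} (hc : HasCompactSupport K) (v) :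
    HasCompactSupport (fun z => fderiv ℝ K z v) :=
  (hc.fderiv (𝕜 := ℝ)).comp_left (g := fun L : (ℝ × ℝ) →L[ℝ] ℝ => L v) (by simp)

/-- gradient -/
noncomputable def grad (u : ℝ × ℝ → ℝ) (x : ℝ × ℝ) : ℝ × ℝ := (fderiv ℝ u x (1,0), fderiv ℝ u x (0,1))

lemma grad_continuous {u : ℝ × ℝ → ℝ} (hu : ContDiff ℝ (⊤ : ℕ∞) u) : Continuous (grad u) := by
  have h1 : Continuous (fderiv ℝ u) := hu.continuous_fderiv (by simp)
  unfold grad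
  fun_prop

/-- the mollified indicator -/
noncomputable def mind (K : ℝ × ℝ → ℝ) (E : Set (ℝ × ℝ)) : ℝ × ℝ → ℝ := conv K (E.indicator 1)

lemma integrable_ind {E : Set (ℝ × ℝ)} (hE : MeasurableSet E) (hI : E ⊆ Isq) :
    Integrable (E.indicator (1 : ℝ × ℝ → ℝ)) := by
  rw [integrable_indicator_iff hE]
  apply integrableOn_const
  · exact ((measure_mono hI).trans_lt (by rw [volume_Isq]; simp)).ne
  · simp

lemma factM {τ : ℝ × ℝ → ℝ} (h : IsNorm2 τ) {E : Set (ℝ × ℝ)} (hE : MeasurableSet E) (hI : E ⊆ Isq) {c : ℝ}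
    (hp : Per τ E c) {K ε} (hK : Moll K ε) {r : ℝ} (hr : r + ε < 1) {f0 : ℝ × ℝ → ℝ × ℝ}
    (hm : Measurable f0) (ha : ∀ x, Adm τ (f0 x)) (hs : ∀ x, f0 x ≠ 0 → ‖x‖ ≤ r) :
    - ∫ x, dot2 (f0 x) (grad (mind K E) x) ≤ c := by
  obtain ⟨M, hM, hMb⟩ := adm_bound h
  have hfin : volume (Metric.closedBall (0 : ℝ × ℝ) r) < ⊤ := measure_closedBall_lt_top
  have hfi : Integrable f0 := by
    have : Integrable ((Metric.closedBall (0 : ℝ × ℝ) r).indicator (fun _ => M)) := by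
      rw [integrable_indicator_iff measurableSet_closedBall]
      exact integrableOn_const hfin.ne
    refine this.mono' hm.aestronglyMeasurable (Eventually.of_forall fun x => ?_)
    by_cases hx : f0 x = 0
    · rw [hx, norm_zero]
      exact indicator_nonneg (fun _ _ => hM.le) x
    · rw [indicator_of_mem (by simpa using hs x hx)]
      exact hMb _ (ha x)
  have hA1 : Integrable (fun x => (f0 x).1) := hfi.fst
  have hA2 : Integrable (fun x => (f0 x).2) := hfi.snd
  set F : ℝ × ℝ → ℝ × ℝ := fun x => (conv K (fun y => (f0 y).1) x, conv K (fun y => (f0 y).2) x) with hF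
  have c1 := conv_contDiff hK.smooth hK.cs hA1
  have c2 := conv_contDiff hK.smooth hK.cs hA2
  have hKc := hK.smooth.continuous
  have hsuppF : Function.support F ⊆ Metric.closedBall 0 (r + ε) := by
    intro x hx
    by_contra hx'
    apply hx
    have : ∀ y, K (x - y) = 0 ∨ f0 y = 0 := by
      intro y
      by_contra hcon
      push Not at hcon
      have h1 := hK.supp _ hcon.1
      have h2 := hs _ hcon.2
      apply hx'
      have : ‖x‖ ≤ ‖x - y‖ + ‖y‖ := by simpa using norm_add_le (x - y) y
      rw [mem_closedBall_zero_iff]; linarith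
    simp only [hF, conv, Prod.mk_eq_zero]
    constructor
    · rw [integral_eq_zero_of_ae]
      refine Eventually.of_forall fun y => ?_
      rcases this y with h | h <;> simp [h]
    · rw [integral_eq_zero_of_ae]
      refine Eventually.of_forall fun y => ?_
      rcases this y with h | h <;> simp [h]
  have htF : tsupport F ⊆ Metric.closedBall 0 (r + ε) := closure_minimal hsuppF Metric.isClosed_closedBall
  have hTF : TF τ F := by
    refine ⟨c1.prodMk c2, HasCompactSupport.of_support_subset_isCompact (isCompact_closedBall _ _) hsuppF,
      ?_, ?_⟩
    · intro x hx
      have h1 : ‖x‖ < 1 := lt_of_le_of_lt (by simpa using htF hx) hr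
      exact ⟨lt_of_le_of_lt (norm_fst_le x) h1, lt_of_le_of_lt (norm_snd_le x) h1⟩
    · intro x v
      have i1 := conv_integrand hKc hK.cs hA1 x
      have i2 := conv_integrand hKc hK.cs hA2 x
      have e : dot2 v (F x) = ∫ y, K (x - y) * dot2 v (f0 y) := by
        simp only [dot2, hF, conv]
        rw [← integral_const_mul, ← integral_const_mul, ← integral_add (i1.const_mul _) (i2.const_mul _)]
        congr 1; ext y; ring
      have i3 : Integrable (fun y => K (x - y) * dot2 v (f0 y)) := by
        have := (i1.const_mul v.1).add (i2.const_mul v.2)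
        refine this.congr (Eventually.of_forall fun y => ?_)
        simp [dot2]; ring
      have i4 : Integrable (fun y => K (x - y)) := hK.integrable.comp_sub_left x
      rw [e]
      calc ∫ y, K (x - y) * dot2 v (f0 y) ≤ ∫ y, K (x - y) * τ v := by
            apply integral_mono i3 (i4.mul_const _)
            intro y
            exact mul_le_mul_of_nonneg_left (ha y v) (hK.nonneg _)
        _ = τ v := by rw [integral_mul_const, hK.int_sub, one_mul]
  have hdiv : ∀ x, div2 F x = conv (fun z => fderiv ℝ K z (1,0)) (fun y => (f0 y).1) x +
      conv (fun z => fderiv ℝ K z (0,1)) (fun y => (f0 y).2) x := by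
    intro x
    have d1 : DifferentiableAt ℝ (conv K (fun y => (f0 y).1)) x := (c1.differentiable (by simp)) x
    have d2 : DifferentiableAt ℝ (conv K (fun y => (f0 y).2)) x := (c2.differentiable (by simp)) x
    unfold div2
    rw [hF, (d1.hasFDerivAt.prodMk d2.hasFDerivAt).fderiv]
    simp only [ContinuousLinearMap.prod_apply]
    rw [conv_fderiv hK.smooth hK.cs hA1, conv_fderiv hK.smooth hK.cs hA2]
  have hBi := integrable_ind hE hI
  have hKd : Continuous (fderiv ℝ K) := hK.smooth.continuous_fderiv (by simp)
  have cont : ∀ v, Continuous (fun z => fderiv ℝ K z v) := fun v => by fun_prop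
  have odd : ∀ v x, fderiv ℝ K (-x) v = - fderiv ℝ K x v := fun v x =>
    fderiv_odd (hK.smooth.differentiable (by simp)) hK.even x v
  have a1 := conv_adjoint (cont (1,0)) (cs_fderiv_apply hK.cs _) (odd (1,0)) hA1 hBi
  have a2 := conv_adjoint (cont (0,1)) (cs_fderiv_apply hK.cs _) (odd (0,1)) hA2 hBi
  have bd : ∀ {A B : ℝ × ℝ → ℝ} (_ : Integrable A) (_ : Integrable B) (v),
      Integrable (fun x => A x * conv (fun z => fderiv ℝ K z v) B x) := by
    intro A B hA hB v
    obtain ⟨C, hC⟩ := (cs_fderiv_apply hK.cs v).exists_bound_of_continuous (cont v)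
    apply hA.mul_bdd (c := C * ∫ y, ‖B y‖)
    · have : conv (fun z => fderiv ℝ K z v) B = fun x => fderiv ℝ (conv K B) x v := by
        ext x; rw [conv_fderiv hK.smooth hK.cs hB]
      rw [this]
      have := (conv_contDiff hK.smooth hK.cs hB).continuous_fderiv (by simp)
      exact (by fun_prop : Continuous (fun x => fderiv ℝ (conv K B) x v)).aestronglyMeasurable
    · refine Eventually.of_forall fun x => ?_
      rw [← integral_const_mul]
      apply norm_integral_le_of_norm_le (hB.norm.const_mul C)
      refine Eventually.of_forall fun y => ?_
      rw [norm_mul]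
      exact mul_le_mul_of_nonneg_right (hC _) (norm_nonneg _)
  have hfinal : ∫ x in E, div2 F x = - ∫ x, dot2 (f0 x) (grad (mind K E) x) := by
    rw [← integral_indicator hE]
    have e1 : ∀ x, E.indicator (fun x => div2 F x) x =
        conv (fun z => fderiv ℝ K z (1,0)) (fun y => (f0 y).1) x * E.indicator 1 x +
        conv (fun z => fderiv ℝ K z (0,1)) (fun y => (f0 y).2) x * E.indicator 1 x := by
      intro x
      by_cases hx : x ∈ E <;> simp [hx, hdiv]
    have e2 : ∀ x, dot2 (f0 x) (grad (mind K E) x) =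
        (f0 x).1 * conv (fun z => fderiv ℝ K z (1,0)) (E.indicator 1) x +
        (f0 x).2 * conv (fun z => fderiv ℝ K z (0,1)) (E.indicator 1) x := by
      intro x
      simp only [dot2, grad, mind]
      rw [conv_fderiv hK.smooth hK.cs hBi, conv_fderiv hK.smooth hK.cs hBi]
    simp_rw [e1, e2]
    rw [integral_add, integral_add (bd hA1 hBi _) (bd hA2 hBi _), a1, a2]
    · ring
    · exact (bd hBi hA1 _).congr (Eventually.of_forall fun x => mul_comm _ _)
    · exact (bd hBi hA2 _).congr (Eventually.of_forall fun x => mul_comm _ _)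
  rw [← hfinal]
  exact hp F hTF

open MeasureTheory Set Filter ENNReal

/-- a standard sequence of bumps -/
noncomputable def bumpSeq (n : ℕ) : ContDiffBump (0 : ℝ × ℝ) where
  rIn := 1 / (2 * ((n:ℝ) + 1))
  rOut := 1 / ((n:ℝ) + 1)
  rIn_pos := by positivity
  rIn_lt_rOut := by
    apply one_div_lt_one_div_of_lt <;> nlinarith [(Nat.cast_nonneg n : (0:ℝ) ≤ n)]

/-- a standard sequence of mollifiers -/
noncomputable def Kseq (n : ℕ) : ℝ × ℝ → ℝ := (bumpSeq n).normed volume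

lemma Kseq_moll (n : ℕ) : Moll (Kseq n) (1 / ((n:ℝ) + 1)) where
  smooth := (bumpSeq n).contDiff_normed
  supp := fun x hx => by
    have h1 : x ∈ Function.support ((bumpSeq n).normed volume) := hx
    rw [(bumpSeq n).support_normed_eq] at h1
    have h2 : ‖x‖ < (bumpSeq n).rOut := by simpa using h1
    exact h2
  nonneg := fun x => (bumpSeq n).nonneg_normed x
  int := (bumpSeq n).integral_normed
  even := fun x => (bumpSeq n).normed_neg x

lemma mind_tendsto {E : Set (ℝ × ℝ)} (hE : MeasurableSet E) (hI : E ⊆ Isq) :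
    ∀ᵐ x, Tendsto (fun n => mind (Kseq n) E x) atTop (nhds (E.indicator 1 x)) := by
  have h1 : Tendsto (fun n => (bumpSeq n).rOut) atTop (nhds 0) :=
    tendsto_one_div_add_atTop_nhds_zero_nat (𝕜 := ℝ)
  have h2 : ∀ᶠ n in atTop, (bumpSeq n).rOut ≤ 2 * (bumpSeq n).rIn := by
    refine Eventually.of_forall fun n => ?_
    show 1 / ((n:ℝ) + 1) ≤ 2 * (1 / (2 * ((n:ℝ) + 1)))
    have : (0:ℝ) < (n:ℝ) + 1 := by positivity
    field_simp; norm_num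
  filter_upwards [ContDiffBump.ae_convolution_tendsto_right_of_locallyIntegrable (μ := volume) h1 h2
    (integrable_ind hE hI).locallyIntegrable] with x hx
  refine hx.congr fun n => ?_
  rw [convolution_lsmul_swap]
  rfl


lemma mind_smooth {K : ℝ × ℝ → ℝ} {ε : ℝ} (hK : Moll K ε) {E : Set (ℝ × ℝ)} (hE : MeasurableSet E) (hI : E ⊆ Isq) : ContDiff ℝ (⊤ : ℕ∞) (mind K E) := conv_contDiff hK.smooth hK.cs (integrable_ind hE hI)

lemma mind_nonneg {K : ℝ × ℝ → ℝ} {ε : ℝ} (hK : Moll K ε) {E : Set (ℝ × ℝ)} (x) : 0 ≤ mind K E x := by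
  apply integral_nonneg
  intro y
  exact mul_nonneg (hK.nonneg _) (indicator_nonneg (by simp) _)

lemma mind_le_one {K : ℝ × ℝ → ℝ} {ε : ℝ} (hK : Moll K ε) {E : Set (ℝ × ℝ)} (hE : MeasurableSet E) (hI : E ⊆ Isq) (x) : mind K E x ≤ 1 := by
  rw [← hK.int_sub x]
  apply integral_mono (conv_integrand hK.smooth.continuous hK.cs (integrable_ind hE hI) x)
    (hK.integrable.comp_sub_left x)
  intro y
  have := hK.nonneg (x - y)
  by_cases hy : y ∈ E <;> simp [hy, this]

lemma mind_zero {K : ℝ × ℝ → ℝ} {ε : ℝ} (hK : Moll K ε) {E : Set (ℝ × ℝ)} (hI : E ⊆ Isq) {x} (hx : 1 + ε ≤ ‖x‖) : mind K E x = 0 := by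
  apply integral_eq_zero_of_ae
  refine Eventually.of_forall fun y => ?_
  by_cases hy : y ∈ E
  · have h1 := mem_Isq.1 (hI hy)
    have h2 : ‖y‖ ≤ 1 := by rw [Prod.norm_def]; exact max_le h1.1 h1.2
    have h3 : K (x - y) = 0 := by
      by_contra hne
      have := hK.supp _ hne
      have h4 : ‖x‖ ≤ ‖x - y‖ + ‖y‖ := by simpa using norm_add_le (x - y) y
      linarith
    simp [h3]
  · simp [hy]

lemma mind_cs {K : ℝ × ℝ → ℝ} {ε : ℝ} (hK : Moll K ε) {E : Set (ℝ × ℝ)} (hI : E ⊆ Isq) : HasCompactSupport (mind K E) := by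
  apply HasCompactSupport.of_support_subset_isCompact (isCompact_closedBall (0 : ℝ × ℝ) (1 + ε))
  intro x hx
  by_contra h
  apply hx
  apply mind_zero hK hI
  rw [mem_closedBall_zero_iff] at h
  linarith

/-- one-dimensional integration by parts -/
lemma ibp1 {ω v : ℝ → ℝ} (hω : Integrable ω) (hv : ContDiff ℝ 1 v) (hc : HasCompactSupport v) :
    ∫ y, (∫ z in Iic y, ω z) * deriv v y = - ∫ z, ω z * v z := by
  have hd : Continuous (deriv v) := hv.continuous_deriv le_rfl
  have hdi : Integrable (deriv v) := hd.integrable_of_hasCompactSupport hc.deriv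
  have hIntg : Integrable (Function.uncurry fun y z => {p : ℝ × ℝ | p.2 ≤ p.1}.indicator
      (fun p => deriv v p.1 * ω p.2) (y, z)) (volume.prod volume) := by
    have := (hdi.mul_prod hω).indicator (s := {p : ℝ × ℝ | p.2 ≤ p.1})
      (measurableSet_le (by fun_prop) (by fun_prop))
    exact this
  have e1 : ∀ y, (∫ z in Iic y, ω z) * deriv v y = ∫ z, {p : ℝ × ℝ | p.2 ≤ p.1}.indicator
      (fun p => deriv v p.1 * ω p.2) (y, z) := by
    intro y
    rw [← integral_indicator measurableSet_Iic, ← integral_mul_const]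
    congr 1; ext z
    by_cases h : z ≤ y <;> simp [h, mul_comm]
  have e2 : ∀ z, - (ω z * v z) = ∫ y, {p : ℝ × ℝ | p.2 ≤ p.1}.indicator
      (fun p => deriv v p.1 * ω p.2) (y, z) := by
    intro z
    have h1 := hc.integral_Ioi_deriv_eq hv z
    rw [← integral_Ici_eq_integral_Ioi, ← integral_indicator measurableSet_Ici] at h1
    rw [← mul_neg, ← h1, ← integral_const_mul]
    congr 1; ext y
    by_cases h : z ≤ y <;> simp [h, mul_comm]
  rw [← integral_neg]
  simp_rw [e1, e2]
  exact integral_integral_swap hIntg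

lemma prim_meas {w : ℝ × ℝ → ℝ} (hw : Measurable w) :
    Measurable (fun x : ℝ × ℝ => ∫ z in Iic x.2, w (x.1, z)) := by
  have h1 : StronglyMeasurable (fun p : (ℝ × ℝ) × ℝ => {p : (ℝ × ℝ) × ℝ | p.2 ≤ p.1.2}.indicator
      (fun p => w (p.1.1, p.2)) p) := by
    apply Measurable.stronglyMeasurable
    exact (hw.comp (by fun_prop)).indicator (measurableSet_le (by fun_prop) (by fun_prop))
  have h2 := (h1.integral_prod_right' (ν := volume)).measurable
  convert h2 using 2 with x
  rw [← integral_indicator measurableSet_Iic]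
  rfl

/-- integration by parts in the second variable -/
lemma ibp2 {u : ℝ × ℝ → ℝ} (hu : ContDiff ℝ (⊤ : ℕ∞) u) (hc : HasCompactSupport u)
    {w : ℝ × ℝ → ℝ} (hw : Measurable w) (hwi : Integrable w) {G : ℝ}
    (hG : ∀ x : ℝ × ℝ, |∫ z in Iic x.2, w (x.1, z)| ≤ G) :
    ∫ x, (∫ z in Iic x.2, w (x.1, z)) * fderiv ℝ u x (0,1) = - ∫ x, w x * u x := by
  have hcu : Continuous (fun x => fderiv ℝ u x (0,1)) := by
    have := hu.continuous_fderiv (by simp)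
    fun_prop
  have hcs : HasCompactSupport (fun x => fderiv ℝ u x (0,1)) := cs_fderiv_apply hc _
  have hui : Integrable (fun x => fderiv ℝ u x (0,1)) := hcu.integrable_of_hasCompactSupport hcs
  obtain ⟨B, hB⟩ := hc.exists_bound_of_continuous hu.continuous
  have i1 : Integrable (fun x : ℝ × ℝ => (∫ z in Iic x.2, w (x.1, z)) * fderiv ℝ u x (0,1)) :=
    hui.bdd_mul (c := G) (prim_meas hw).aestronglyMeasurable (Eventually.of_forall hG)
  have i2 : Integrable (fun x => w x * u x) :=
    hwi.mul_bdd (c := B) hu.continuous.aestronglyMeasurable (Eventually.of_forall hB)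
  rw [← integral_neg]
  rw [Measure.volume_eq_prod] at i1 i2 hwi ⊢
  rw [integral_prod _ i1, integral_prod (fun x => -(w x * u x)) i2.neg]
  apply integral_congr_ae
  filter_upwards [hwi.prod_right_ae] with t ht
  have hv : ContDiff ℝ 1 (fun y => u (t, y)) := (hu.of_le (by simp)).comp (by fun_prop)
  have hvc : HasCompactSupport (fun y => u (t, y)) := by
    refine HasCompactSupport.intro (hc.isCompact.image continuous_snd) fun y hy => ?_
    by_contra hne
    exact hy ⟨(t, y), subset_tsupport _ hne, rfl⟩
  have hder : ∀ y, deriv (fun y => u (t, y)) y = fderiv ℝ u (t, y) (0,1) := by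
    intro y
    have h1 : HasDerivAt (fun y : ℝ => (t, y)) (0, 1) y :=
      (hasDerivAt_const y t).prodMk (hasDerivAt_id y)
    exact (((hu.differentiable (by simp)) (t, y)).hasFDerivAt.comp_hasDerivAt y h1).deriv
  have := ibp1 ht hv hvc
  simp_rw [hder] at this
  rw [this, integral_neg]

/-- one-directional flux bound -/
lemma fluxR {τ : ℝ × ℝ → ℝ} (h : IsNorm2 τ) {E : Set (ℝ × ℝ)} (hE : MeasurableSet E) (hI : E ⊆ Isq) {c : ℝ}
    (hp : Per τ E c) {q : ℝ} (hq : Adm τ (0, q)) {w : ℝ × ℝ → ℝ} (hw : Measurable w)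
    (hwi : Integrable w) {r : ℝ} (hr : r < 1) (hs : ∀ x, w x ≠ 0 → ‖x‖ ≤ r)
    (h0 : ∀ t, ∫ z, w (t, z) = 0)
    (hG : ∀ x : ℝ × ℝ, |∫ z in Iic x.2, w (x.1, z)| ≤ 1) :
    q * ∫ x in E, w x ≤ c := by
  have hlim : Tendsto (fun n => q * ∫ x, w x * mind (Kseq n) E x) atTop (nhds (q * ∫ x in E, w x)) := by
    apply Filter.Tendsto.const_mul
    rw [← integral_indicator hE]
    apply tendsto_integral_of_dominated_convergence (fun x => ‖w x‖)
    · intro n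
      exact (hw.mul (mind_smooth (Kseq_moll n) hE hI).continuous.measurable).aestronglyMeasurable
    · exact hwi.norm
    · intro n
      refine Eventually.of_forall fun x => ?_
      have h1 := mind_nonneg (Kseq_moll n) (E := E) x
      have h2 := mind_le_one (Kseq_moll n) hE hI x
      rw [norm_mul]
      apply mul_le_of_le_one_right (norm_nonneg _)
      rw [Real.norm_eq_abs, abs_of_nonneg h1]; exact h2
    · filter_upwards [mind_tendsto hE hI] with x hx
      have := hx.const_mul (w x)
      convert this using 2
      by_cases hx : x ∈ E <;> simp [hx]
  have hev : ∀ᶠ n : ℕ in atTop, r + 1 / ((n:ℝ) + 1) < 1 := by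
    have := (tendsto_one_div_add_atTop_nhds_zero_nat (𝕜 := ℝ)).const_add r
    rw [add_zero] at this
    exact this.eventually_lt_const hr
  apply le_of_tendsto hlim
  filter_upwards [hev] with n hn
  have key := factM h hE hI hp (Kseq_moll n) hn
    (f0 := fun x => (∫ z in Iic x.2, w (x.1, z)) • ((0:ℝ), q))
    ((prim_meas hw).smul_const _) (fun x => hq.smul_abs h (hG x)) (by
      intro x hx
      have hx1 : (∫ z in Iic x.2, w (x.1, z)) ≠ 0 := fun h0 => hx (by simp [h0])
      rw [Prod.norm_def]
      apply max_le
      · by_contra hcon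
        push Not at hcon
        apply hx1
        apply integral_eq_zero_of_ae
        refine Eventually.of_forall fun z => ?_
        by_contra hne
        have := (norm_fst_le (x.1, z)).trans (hs (x.1, z) hne)
        simp at this hcon
        linarith
      · by_contra hcon
        push Not at hcon
        have hbig : ∀ z, w (x.1, z) ≠ 0 → |z| ≤ r := fun z hne =>
          (norm_snd_le (x.1, z)).trans (hs (x.1, z) hne)
        rw [Real.norm_eq_abs, lt_abs] at hcon
        apply hx1
        rcases hcon with hcon | hcon
        · rw [← h0 x.1]
          apply setIntegral_eq_integral_of_forall_compl_eq_zero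
          intro z hz
          by_contra hne
          have := (abs_le.1 (hbig z hne)).2
          simp at hz; linarith
        · rw [← integral_indicator measurableSet_Iic]
          apply integral_eq_zero_of_ae
          refine Eventually.of_forall fun z => ?_
          by_cases hz : z ≤ x.2
          · simp only [mem_Iic, hz, indicator_of_mem, Pi.zero_apply]
            by_contra hne
            have := (abs_le.1 (hbig z hne)).1
            linarith
          · simp [hz])
  have e := ibp2 (mind_smooth (Kseq_moll n) hE hI) (mind_cs (Kseq_moll n) hI) hw hwi hG
  have e2 : ∀ x : ℝ × ℝ, dot2 ((∫ z in Iic x.2, w (x.1, z)) • ((0:ℝ), q)) (grad (mind (Kseq n) E) x) =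
      q * ((∫ z in Iic x.2, w (x.1, z)) * fderiv ℝ (mind (Kseq n) E) x (0,1)) := by
    intro x; simp [dot2, grad]; ring
  simp_rw [e2] at key
  rw [integral_const_mul, e] at key
  linarith

open MeasureTheory Set Filter ENNReal

lemma meas_absle (r : ℝ) : MeasurableSet {t : ℝ | |t| ≤ r} := measurableSet_le (by fun_prop) measurable_const
lemma meas_abslt (r : ℝ) : MeasurableSet {t : ℝ | |t| < r} := measurableSet_lt (by fun_prop) measurable_const

/-- column measure -/
noncomputable def colm (E : Set (ℝ × ℝ)) (t : ℝ) : ℝ := volume.real (Prod.mk t ⁻¹' E)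

lemma colm_measurable {E : Set (ℝ × ℝ)} (hE : MeasurableSet E) : Measurable (colm E) :=
  (measurable_measure_prodMk_left hE).ennreal_toReal

lemma slice_subset {E : Set (ℝ × ℝ)} (hI : E ⊆ Isq) (t) : Prod.mk t ⁻¹' E ⊆ Icc (-1) 1 := by
  intro y hy
  have := (mem_Isq.1 (hI hy)).2
  exact abs_le.1 this

lemma slice_fin {E : Set (ℝ × ℝ)} (hI : E ⊆ Isq) (t) : volume (Prod.mk t ⁻¹' E) ≠ ⊤ :=
  ((measure_mono (slice_subset hI t)).trans_lt (by simp)).ne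

lemma colm_nonneg (E : Set (ℝ × ℝ)) (t : ℝ) : 0 ≤ colm E t := measureReal_nonneg

lemma colm_le_two {E : Set (ℝ × ℝ)} (hI : E ⊆ Isq) (t : ℝ) : colm E t ≤ 2 := by
  have := measureReal_mono (μ := volume) (slice_subset hI t) (by simp)
  refine this.trans ?_
  simp [Measure.real]; norm_num

lemma frac_bound {A ℓ m L : ℝ} (hL : 0 < L) (hA0 : 0 ≤ A) (hAl : A ≤ ℓ) (hAm : A ≤ m) (hmA : m - A ≤ L - ℓ)
    (hmL : m ≤ L) (hm : 0 ≤ m) : |A - ℓ * (m / L)| ≤ m * (1 - m / L) := by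
  have h1 : 0 ≤ m / L := by positivity
  have h2 : m / L ≤ 1 := by rw [div_le_one hL]; exact hmL
  have h3 : m / L * L = m := by field_simp
  set k := m / L
  rw [abs_le]
  constructor
  · nlinarith
  · nlinarith

lemma colbound_aux {τ : ℝ × ℝ → ℝ} (h : IsNorm2 τ) {E : Set (ℝ × ℝ)} (hE : MeasurableSet E) (hI : E ⊆ Isq) {c : ℝ}
    (hp : Per τ E c) {q : ℝ} (hq : Adm τ (0, q)) {r η : ℝ} (hr0 : 0 < r) (hr : r < 1) (hη : 0 < η) :
    q * volume.real {t | |t| ≤ r ∧ η ≤ colm (E ∩ {x | |x.2| ≤ r}) t ∧ colm (E ∩ {x | |x.2| ≤ r}) t ≤ 2 * r - η}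
      ≤ c := by
  set E' := E ∩ {x : ℝ × ℝ | |x.2| ≤ r} with hE'
  have hE'm : MeasurableSet E' := hE.inter (measurableSet_le (by fun_prop) measurable_const)
  have hI' : E' ⊆ Isq := inter_subset_left.trans hI
  set m := colm E' with hm
  have hmm : Measurable m := colm_measurable hE'm
  set G := {t | |t| ≤ r ∧ η ≤ m t ∧ m t ≤ 2 * r - η} with hG
  have hGm : MeasurableSet G :=
    (meas_absle r).inter
      ((measurableSet_le measurable_const hmm).inter (measurableSet_le hmm measurable_const))
  set L := 2 * r with hL
  have hL0 : 0 < L := by positivity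
  let D : ℝ → ℝ := fun t => m t * (1 - m t / L)
  have hDm : Measurable D := by fun_prop
  let Q : Set (ℝ × ℝ) := {x | x.1 ∈ G ∧ |x.2| ≤ r}
  have hQm : MeasurableSet Q := (measurable_fst hGm).inter (measurable_snd (meas_absle r))
  let w : ℝ × ℝ → ℝ := Q.indicator (fun x => (E.indicator 1 x - m x.1 / L) / D x.1)
  have hwm : Measurable w := by
    apply Measurable.indicator _ hQm
    exact (((measurable_const (a := (1:ℝ))).indicator hE).sub
      ((hmm.comp measurable_fst).div_const _)).div (hDm.comp measurable_fst)
  have hD : ∀ t ∈ G, η * (η / L) ≤ D t := by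
    rintro t ⟨_, h1, h2⟩
    have : η / L ≤ 1 - m t / L := by
      rw [div_le_iff₀ hL0, sub_mul, div_mul_cancel₀ _ hL0.ne']
      linarith
    exact mul_le_mul h1 this (by positivity) (by linarith)
  have hηL : 0 < η * (η / L) := by positivity
  have hw0 : ∀ x, x ∉ Q → w x = 0 := fun x hx => indicator_of_notMem hx _
  have hw1 : ∀ x, x ∈ Q → w x = (E.indicator 1 x - m x.1 / L) / D x.1 := fun x hx => indicator_of_mem hx _
  have hQball : Q ⊆ Metric.closedBall 0 r := by
    rintro x ⟨h1, h2⟩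
    rw [mem_closedBall_zero_iff, Prod.norm_def]
    exact max_le h1.1 h2
  have hwi : Integrable w := by
    have hi : Integrable (Q.indicator fun _ => (1 / (η * (η / L)) : ℝ)) := by
      rw [integrable_indicator_iff hQm]
      exact integrableOn_const ((measure_mono hQball).trans_lt measure_closedBall_lt_top).ne
    refine hi.mono' hwm.aestronglyMeasurable (Eventually.of_forall fun x => ?_)
    by_cases hx : x ∈ Q
    · rw [hw1 x hx, indicator_of_mem hx, norm_div]
      have hDx := hD _ hx.1
      have : ‖D x.1‖ = D x.1 := by rw [Real.norm_eq_abs, abs_of_pos (hηL.trans_le hDx)]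
      rw [this]
      apply div_le_div₀ zero_le_one _ hηL hDx
      have a1 : 0 ≤ m x.1 / L := div_nonneg (colm_nonneg _ _) hL0.le
      have a2 : m x.1 / L ≤ 1 := by
        rw [div_le_one hL0]; have := hx.1.2.2; linarith
      rw [Real.norm_eq_abs, abs_le]
      by_cases hxE : x ∈ E
      · simp only [hxE, indicator_of_mem, Pi.one_apply]; constructor <;> linarith
      · simp only [hxE, not_false_eq_true, indicator_of_notMem]; constructor <;> linarith
    · rw [hw0 x hx, indicator_of_notMem hx]; simp
  -- slice integrals
  have hslice : ∀ (S : Set ℝ) (hS : MeasurableSet S) (t), t ∈ G →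
      ∫ z in S, w (t, z) = (volume.real (Prod.mk t ⁻¹' E' ∩ S) - volume.real (Icc (-r) r ∩ S) * (m t / L)) / D t := by
    intro S hS t ht
    have hms : MeasurableSet (Prod.mk t ⁻¹' E') := measurable_prodMk_left hE'm
    have e : ∀ z, S.indicator (fun z => w (t, z)) z = (((Prod.mk t ⁻¹' E') ∩ S).indicator 1 z
        - (Icc (-r) r ∩ S).indicator (fun _ => m t / L) z) / D t := by
      intro z
      by_cases hz : z ∈ S
      · by_cases hzr : |z| ≤ r
        · have hzI : z ∈ Icc (-r) r := abs_le.1 hzr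
          rw [indicator_of_mem hz, hw1 (t, z) ⟨ht, hzr⟩, indicator_of_mem (show z ∈ Icc (-r) r ∩ S from ⟨hzI, hz⟩)]
          by_cases hzE : (t, z) ∈ E
          · rw [indicator_of_mem hzE, indicator_of_mem (show z ∈ Prod.mk t ⁻¹' E' ∩ S from ⟨⟨hzE, hzr⟩, hz⟩)]; simp
          · rw [indicator_of_notMem hzE, indicator_of_notMem (show z ∉ _ ∩ S from fun h => hzE h.1.1)]
        · have hzI : z ∉ Icc (-r) r := fun h => hzr (abs_le.2 h)
          rw [indicator_of_mem hz, hw0 (t, z) (fun h => hzr h.2), indicator_of_notMem (show z ∉ Icc (-r) r ∩ S from fun h => hzI h.1),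
            indicator_of_notMem (show z ∉ Prod.mk t ⁻¹' E' ∩ S from fun h => hzr h.1.2)]
          simp
      · simp [hz]
    have i1 : Integrable (((Prod.mk t ⁻¹' E') ∩ S).indicator (1 : ℝ → ℝ)) := by
      rw [integrable_indicator_iff (hms.inter hS)]
      exact integrableOn_const ((measure_mono inter_subset_left).trans_lt (slice_fin hI' t).lt_top).ne
    have i2 : Integrable ((Icc (-r) r ∩ S).indicator (fun _ => m t / L)) := by
      rw [integrable_indicator_iff (measurableSet_Icc.inter hS)]
      exact integrableOn_const ((measure_mono inter_subset_left).trans_lt (by simp)).ne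
    rw [← integral_indicator hS]
    simp_rw [e]
    rw [integral_div, integral_sub i1 i2, integral_indicator_one (hms.inter hS),
      integral_indicator_const _ (measurableSet_Icc.inter hS), smul_eq_mul]
  have hIcc : volume.real (Icc (-r) r) = L := by
    simp [Measure.real]
    rw [ENNReal.toReal_ofReal (by linarith)]; linarith
  have hsub : ∀ t, Prod.mk t ⁻¹' E' ⊆ Icc (-r) r := fun t z hz => abs_le.1 hz.2
  have hw0' : ∀ t, t ∉ G → ∀ z, w (t, z) = 0 := fun t ht z => hw0 _ (fun h => ht h.1)
  have key := fluxR h hE hI hp hq hwm hwi hr (by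
    intro x hx
    by_contra hcon
    exact hx (hw0 x fun hQ => hcon (by simpa using hQball hQ))) (by
    intro t
    by_cases ht : t ∈ G
    · rw [← setIntegral_univ, hslice univ MeasurableSet.univ t ht, inter_univ, inter_univ, hIcc]
      have : volume.real (Prod.mk t ⁻¹' E') = m t := rfl
      rw [this]; field_simp; simp
    · simp [hw0' t ht]) (by
    intro x
    by_cases ht : x.1 ∈ G
    · rw [hslice (Iic x.2) measurableSet_Iic x.1 ht]
      have hDp := hηL.trans_le (hD _ ht)
      rw [abs_div, abs_of_pos hDp, div_le_one hDp]
      have hms : MeasurableSet (Prod.mk x.1 ⁻¹' E') := measurable_prodMk_left hE'm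
      apply frac_bound hL0 measureReal_nonneg
      · exact measureReal_mono (inter_subset_inter_left _ (hsub _))
          ((measure_mono inter_subset_left).trans_lt (by simp)).ne
      · exact measureReal_mono inter_subset_left (slice_fin hI' _)
      · have a1 := measureReal_inter_add_sdiff (μ := volume) (s := Prod.mk x.1 ⁻¹' E') (t := Iic x.2) measurableSet_Iic
          (slice_fin hI' _)
        have a2 := measureReal_inter_add_sdiff (μ := volume) (s := Icc (-r) r) (t := Iic x.2) measurableSet_Iic (by simp)
        have a3 : volume.real (Prod.mk x.1 ⁻¹' E' \ Iic x.2) ≤ volume.real (Icc (-r) r \ Iic x.2) :=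
          measureReal_mono (sdiff_subset_sdiff_left (hsub _)) ((measure_mono sdiff_subset).trans_lt (by simp)).ne
        have : volume.real (Prod.mk x.1 ⁻¹' E') = m x.1 := rfl
        linarith
      · have := ht.2.2; linarith
      · exact colm_nonneg _ _
    · simp [hw0' _ ht])
  have hfin : ∫ x in E, w x = volume.real G := by
    rw [← integral_indicator hE, Measure.volume_eq_prod, integral_prod]
    · have e : ∀ t, ∫ z, E.indicator w (t, z) = G.indicator 1 t := by
        intro t
        by_cases ht : t ∈ G
        · have e2 : ∀ z, E.indicator w (t, z) = (Prod.mk t ⁻¹' E').indicator (fun z => w (t, z)) z := by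
            intro z
            by_cases hz : (t, z) ∈ E
            · by_cases hzr : |z| ≤ r
              · rw [indicator_of_mem hz, indicator_of_mem (show z ∈ _ ⁻¹' E' from ⟨hz, hzr⟩)]
              · rw [indicator_of_mem hz, hw0 (t, z) (fun h => hzr h.2), indicator_of_notMem (fun h => hzr h.2)]
            · rw [indicator_of_notMem hz, indicator_of_notMem (fun h => hz h.1)]
          have hms : MeasurableSet (Prod.mk t ⁻¹' E') := measurable_prodMk_left hE'm
          simp_rw [e2]
          rw [integral_indicator hms, hslice _ hms t ht, inter_self, inter_eq_self_of_subset_right (hsub t),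
            indicator_of_mem ht]
          have : volume.real (Prod.mk t ⁻¹' E') = m t := rfl
          rw [this]
          have hDp := hηL.trans_le (hD _ ht)
          rw [Pi.one_apply, div_eq_one_iff_eq hDp.ne']
          simp only [D]; ring
        · rw [indicator_of_notMem ht]
          apply integral_eq_zero_of_ae
          refine Eventually.of_forall fun z => ?_
          simp [indicator, hw0' t ht]
      simp_rw [e]
      rw [integral_indicator_one hGm]
    · rw [← Measure.volume_eq_prod]; exact hwi.indicator hE
  rw [hfin] at key
  exact key

lemma colbound {τ : ℝ × ℝ → ℝ} (h : IsNorm2 τ) {E : Set (ℝ × ℝ)} (hE : MeasurableSet E) (hI : E ⊆ Isq) {c : ℝ}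
    (hp : Per τ E c) {q : ℝ} (hq : Adm τ (0, q)) :
    q * volume.real {t | |t| < 1 ∧ 0 < colm E t ∧ colm E t < 2} ≤ c := by
  set S := {t | |t| < 1 ∧ 0 < colm E t ∧ colm E t < 2} with hS
  have hmm := colm_measurable hE
  have hSm : MeasurableSet S :=
    (meas_abslt 1).inter
      ((measurableSet_lt measurable_const hmm).inter (measurableSet_lt hmm measurable_const))
  let η : ℕ → ℝ := fun n => 1 / ((n:ℝ) + 2)
  have hη : ∀ n, 0 < η n := fun n => by simp only [η]; positivity
  have hη1 : ∀ n, η n < 1 := fun n => by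
    simp only [η]; rw [div_lt_one (by positivity)]
    have : (0:ℝ) ≤ n := by positivity
    linarith
  have hηl : Tendsto η atTop (nhds 0) := by
    have := (tendsto_one_div_add_atTop_nhds_zero_nat (𝕜 := ℝ)).comp (tendsto_add_atTop_nat 1)
    refine this.congr fun n => ?_
    simp [η]; ring
  let G : ℕ → Set ℝ := fun n => {t | |t| ≤ 1 - η n ∧ η n ≤ colm (E ∩ {x | |x.2| ≤ 1 - η n}) t ∧
    colm (E ∩ {x | |x.2| ≤ 1 - η n}) t ≤ 2 * (1 - η n) - η n}
  have hGm : ∀ n, MeasurableSet (G n) := fun n => by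
    have hm2 : Measurable (colm (E ∩ {x | |x.2| ≤ 1 - η n})) :=
      colm_measurable (hE.inter (measurableSet_le (by fun_prop) measurable_const))
    exact (meas_absle (1 - η n)).inter
      ((measurableSet_le measurable_const hm2).inter (measurableSet_le hm2 measurable_const))
  have hGk : ∀ n, q * volume.real (G n) ≤ c := fun n =>
    colbound_aux h hE hI hp hq (by linarith [hη1 n]) (by linarith [hη n]) (hη n)
  have hGsub : ∀ n, G n ⊆ Icc (-1) 1 := fun n t ht => abs_le.1 (ht.1.trans (by linarith [hη n]))
  have hlow : ∀ t n, colm E t - 2 * η n ≤ colm (E ∩ {x | |x.2| ≤ 1 - η n}) t := by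
    intro t n
    have hsub : Prod.mk t ⁻¹' E ⊆ (Prod.mk t ⁻¹' (E ∩ {x | |x.2| ≤ 1 - η n})) ∪
        (Icc (-1) (-1 + η n) ∪ Icc (1 - η n) 1) := by
      intro z hz
      have hz1 := slice_subset hI t hz
      by_cases hzr : |z| ≤ 1 - η n
      · left; exact ⟨hz, hzr⟩
      · right
        push Not at hzr
        rcases lt_abs.1 hzr with h | h
        · right; exact ⟨h.le, hz1.2⟩
        · left; exact ⟨hz1.1, by linarith⟩
    have hfin : volume ((Prod.mk t ⁻¹' (E ∩ {x | |x.2| ≤ 1 - η n})) ∪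
        (Icc (-1) (-1 + η n) ∪ Icc (1 - η n) 1)) ≠ ⊤ := by
      refine ((measure_union_le _ _).trans_lt (ENNReal.add_lt_top.2 ⟨(slice_fin (inter_subset_left.trans hI) t).lt_top,
        (measure_union_le _ _).trans_lt ?_⟩)).ne
      simp
    have a1 := (measureReal_mono hsub hfin).trans (measureReal_union_le _ _)
    have a2 : volume.real (Icc (-1) (-1 + η n) ∪ Icc (1 - η n) 1) ≤ 2 * η n := by
      refine (measureReal_union_le _ _).trans ?_
      have := hη n
      simp [Measure.real, ENNReal.toReal_ofReal this.le]
      linarith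
    unfold colm
    linarith
  have hup : ∀ t n, colm (E ∩ {x | |x.2| ≤ 1 - η n}) t ≤ colm E t := fun t n =>
    measureReal_mono (preimage_mono inter_subset_left) (slice_fin hI t)
  have hlim : Tendsto (fun n => volume.real (G n ∩ S)) atTop (nhds (volume.real S)) := by
    have e : ∀ A : Set ℝ, MeasurableSet A → volume.real A = ∫ t, A.indicator (1 : ℝ → ℝ) t :=
      fun A hA => (integral_indicator_one hA).symm
    rw [e S hSm]
    simp_rw [fun n => e (G n ∩ S) ((hGm n).inter hSm)]
    apply tendsto_integral_of_dominated_convergence ((Icc (-1:ℝ) 1).indicator 1)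
    · intro n
      exact ((measurable_const (a := (1:ℝ))).indicator ((hGm n).inter hSm)).aestronglyMeasurable
    · rw [integrable_indicator_iff measurableSet_Icc]
      exact integrableOn_const (by simp)
    · intro n
      refine Eventually.of_forall fun t => ?_
      by_cases ht : t ∈ G n ∩ S
      · rw [indicator_of_mem ht, indicator_of_mem (hGsub n ht.1)]; simp
      · rw [indicator_of_notMem ht, norm_zero]; exact indicator_nonneg (by simp) _
    · refine Eventually.of_forall fun t => ?_
      by_cases ht : t ∈ S
      · have hev : ∀ᶠ n in atTop, t ∈ G n := by
          have h1 : ∀ᶠ n in atTop, η n < 1 - |t| := hηl.eventually_lt_const (by linarith [ht.1])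
          have h2 : ∀ᶠ n in atTop, η n < colm E t / 3 := hηl.eventually_lt_const (by linarith [ht.2.1])
          have h3 : ∀ᶠ n in atTop, η n < (2 - colm E t) / 3 := hηl.eventually_lt_const (by linarith [ht.2.2])
          filter_upwards [h1, h2, h3] with n h1 h2 h3
          refine ⟨by linarith, ?_, ?_⟩
          · have := hlow t n; linarith
          · have := hup t n; linarith
        apply tendsto_const_nhds.congr'
        filter_upwards [hev] with n hn
        rw [indicator_of_mem ht, indicator_of_mem (show t ∈ G n ∩ S from ⟨hn, ht⟩)]
      · simp [ht]
  rcases le_total 0 q with hq0 | hq0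
  · apply le_of_tendsto (hlim.const_mul q)
    refine Eventually.of_forall fun n => ?_
    refine le_trans ?_ (hGk n)
    apply mul_le_mul_of_nonneg_left _ hq0
    exact measureReal_mono inter_subset_left ((measure_mono (hGsub n)).trans_lt (by simp)).ne
  · exact (mul_nonpos_of_nonpos_of_nonneg hq0 measureReal_nonneg).trans (hp.nonneg h)

open MeasureTheory Set Filter ENNReal

/-- swapped set -/
def swp (E : Set (ℝ × ℝ)) : Set (ℝ × ℝ) := Prod.swap ⁻¹' E

lemma swp_swp (E) : swp (swp E) = E := rfl
lemma swp_Isq : swp Isq = Isq := by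
  ext x; simp only [swp, mem_preimage, mem_Isq, Prod.fst_swap, Prod.snd_swap]; tauto
lemma swp_meas {E} (hE : MeasurableSet E) : MeasurableSet (swp E) := measurable_swap hE
lemma swp_sub {E} (hI : E ⊆ Isq) : swp E ⊆ Isq := by
  rw [← swp_Isq]; exact preimage_mono hI
lemma mp_swap : MeasurePreserving (Prod.swap : ℝ × ℝ → ℝ × ℝ) volume volume := Measure.measurePreserving_swap
lemma swp_vol {E} (hE : MeasurableSet E) : volume (swp E) = volume E :=
  mp_swap.measure_preimage hE.nullMeasurableSet

lemma TF.swap {τ f} (hf : TF (fun x => τ x.swap) f) : TF τ (fun x => (f x.swap).swap) := by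
  have hs : ContDiff ℝ (⊤ : ℕ∞) (Prod.swap : ℝ × ℝ → ℝ × ℝ) := contDiff_snd.prodMk contDiff_fst
  have hts : tsupport (fun x => (f x.swap).swap) ⊆ Prod.swap ⁻¹' (tsupport f) := by
    apply closure_minimal _ ((isClosed_tsupport f).preimage continuous_swap)
    intro x hx
    apply subset_tsupport
    intro h0
    apply hx
    simp only [h0]; rfl
  refine ⟨hs.comp (hf.smooth.comp hs), ?_, ?_, ?_⟩
  · apply HasCompactSupport.of_support_subset_isCompact (hf.cs.isCompact.image continuous_swap)
    intro x hx
    exact ⟨x.swap, hts (subset_tsupport _ hx), rfl⟩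
  · intro x hx
    have := hf.supp (hts hx)
    exact ⟨this.2, this.1⟩
  · intro x v
    have := hf.adm x.swap v.swap
    simp [dot2] at this ⊢
    linarith

lemma div2_swap {f : ℝ × ℝ → ℝ × ℝ} (hf : Differentiable ℝ f) (x) :
    div2 (fun x => (f x.swap).swap) x = div2 f x.swap := by
  let S : (ℝ × ℝ) →L[ℝ] (ℝ × ℝ) := (ContinuousLinearMap.snd ℝ ℝ ℝ).prod (ContinuousLinearMap.fst ℝ ℝ ℝ)
  have h1 : HasFDerivAt (fun x => S (f (S x))) (S.comp ((fderiv ℝ f (S x)).comp S)) x :=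
    S.hasFDerivAt.comp x ((hf (S x)).hasFDerivAt.comp x S.hasFDerivAt)
  unfold div2
  have h2 : fderiv ℝ (fun x => (f x.swap).swap) x = S.comp ((fderiv ℝ f (S x)).comp S) := h1.fderiv
  rw [h2]
  show (fderiv ℝ f (S x) (S (1,0))).2 + (fderiv ℝ f (S x) (S (0,1))).1 = _
  have a : S (1,0) = (0,1) := rfl
  have b : S (0,1) = (1,0) := rfl
  have d : S x = x.swap := rfl
  rw [a, b, d, add_comm]

lemma Per.swp {τ E c} (hE : MeasurableSet E) (hp : Per τ E c) : Per (fun x => τ x.swap) (swp E) c := by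
  intro f hf
  have h1 := hp _ hf.swap
  simp_rw [div2_swap (hf.smooth.differentiable (by simp))] at h1
  have h2 := mp_swap.setIntegral_preimage_emb MeasurableEquiv.prodComm.measurableEmbedding
    (fun x => div2 f x.swap) E
  have h3 : ∫ x in Prod.swap ⁻¹' E, div2 f x.swap.swap = ∫ x in E, div2 f x.swap := h2
  simp only [Prod.swap_swap] at h3
  unfold _root_.swp
  rw [h3]; exact h1

lemma adm_swap {τ} {a b : ℝ} (h : Adm τ (a, b)) : Adm (fun x => τ x.swap) (b, a) := by
  intro v
  have := h v.swap
  simp [dot2] at this ⊢; linarith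

lemma colm_compl {E} (hE : MeasurableSet E) (hI : E ⊆ Isq) {t : ℝ} (ht : |t| ≤ 1) :
    colm (Isq \ E) t = 2 - colm E t := by
  have e : Prod.mk t ⁻¹' (Isq \ E) = Icc (-1) 1 \ (Prod.mk t ⁻¹' E) := by
    ext z
    simp only [mem_preimage, Set.mem_sdiff, mem_Isq, mem_Icc, ← abs_le]
    tauto
  unfold colm
  rw [e, measureReal_sdiff (slice_subset hI t) (measurable_prodMk_left hE) (by simp)]
  congr 1
  simp [Measure.real]; norm_num

lemma swp_compl (E) : swp (Isq \ E) = Isq \ swp E := by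
  have : swp (Isq \ E) = swp Isq \ swp E := rfl
  rw [this, swp_Isq]

/-- Null columns and full rows cannot coexist. -/
lemma dichotomy {E : Set (ℝ × ℝ)} (hE : MeasurableSet E) (hI : E ⊆ Isq)
    (hA : 0 < volume {t : ℝ | |t| < 1 ∧ colm E t = 0}) :
    volume {s : ℝ | |s| < 1 ∧ colm (swp E) s = 2} = 0 := by
  set A := {t : ℝ | |t| < 1 ∧ colm E t = 0} with hAdef
  set B := {s : ℝ | |s| < 1 ∧ colm (swp E) s = 2} with hBdef
  have hAm : MeasurableSet A := (meas_abslt 1).inter (colm_measurable hE (measurableSet_singleton 0))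
  have hBm : MeasurableSet B := (meas_abslt 1).inter (colm_measurable (swp_meas hE) (measurableSet_singleton 2))
  have h1 : volume ((A ×ˢ B) ∩ E) = 0 := by
    rw [Measure.volume_eq_prod, Measure.measure_prod_null ((hAm.prod hBm).inter hE)]
    refine Eventually.of_forall fun t => ?_
    by_cases ht : t ∈ A
    · have : volume (Prod.mk t ⁻¹' E) = 0 := by
        have := ht.2
        unfold colm at this
        rwa [measureReal_eq_zero_iff (slice_fin hI t)] at this
      exact measure_mono_null (preimage_mono inter_subset_right) this
    · have : Prod.mk t ⁻¹' ((A ×ˢ B) ∩ E) = ∅ := by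
        ext z; simp [ht]
      simp [this]
  have h2 : volume ((B ×ˢ A) \ swp E) = 0 := by
    rw [Measure.volume_eq_prod, Measure.measure_prod_null ((hBm.prod hAm).diff (swp_meas hE))]
    refine Eventually.of_forall fun s => ?_
    by_cases hs : s ∈ B
    · have h3 : colm (Isq \ swp E) s = 0 := by
        rw [colm_compl (swp_meas hE) (swp_sub hI) hs.1.le, hs.2]; norm_num
      have : volume (Prod.mk s ⁻¹' (Isq \ swp E)) = 0 := by
        unfold colm at h3
        rwa [measureReal_eq_zero_iff (slice_fin sdiff_subset s)] at h3
      refine measure_mono_null (preimage_mono (sdiff_subset_sdiff_left ?_)) this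
      rintro ⟨x, y⟩ ⟨h4, h5⟩
      exact mem_Isq.2 ⟨h4.1.le, h5.1.le⟩
    · have : Prod.mk s ⁻¹' ((B ×ˢ A) \ swp E) = ∅ := by
        ext z; simp [hs]
      simp [this]
  have h3 : volume ((A ×ˢ B) \ E) = 0 := by
    rw [← swp_vol ((hAm.prod hBm).diff hE)]
    convert h2 using 2
    ext x; simp [swp]
  have h4 : volume (A ×ˢ B) = 0 := by
    rw [← measure_inter_add_sdiff (A ×ˢ B) hE, h1, h3, add_zero]
  rw [Measure.volume_eq_prod, Measure.prod_prod, mul_eq_zero] at h4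
  exact h4.resolve_left hA.ne'

lemma exists_free {τ : ℝ × ℝ → ℝ} (h : IsNorm2 τ) {E : Set (ℝ × ℝ)} (hE : MeasurableSet E) (hI : E ⊆ Isq) {c : ℝ}
    (hp : Per τ E c) {q μ : ℝ} (hq : Adm τ (0, q)) (hq0 : 0 < q) (hμ : 0 ≤ μ) (hμ1 : μ < 1)
    (hc : c < q * (2 - 2 * μ)) :
    0 < volume {t : ℝ | |t| < 1 - μ ∧ colm E t = 0} ∨ 0 < volume {t : ℝ | |t| < 1 - μ ∧ colm E t = 2} := by
  by_contra hcon
  push Not at hcon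
  have h1 := nonpos_iff_eq_zero.1 hcon.1
  have h2 := nonpos_iff_eq_zero.1 hcon.2
  have hcb := colbound h hE hI hp hq
  have hfin : volume {t | |t| < 1 ∧ 0 < colm E t ∧ colm E t < 2} ≠ ⊤ :=
    ((measure_mono (t := Icc (-1) 1) fun t ht => abs_le.1 ht.1.le).trans_lt (by simp)).ne
  have hsub : Ioo (-(1 - μ)) (1 - μ) ⊆ {t | |t| < 1 ∧ 0 < colm E t ∧ colm E t < 2} ∪
      ({t : ℝ | |t| < 1 - μ ∧ colm E t = 0} ∪ {t : ℝ | |t| < 1 - μ ∧ colm E t = 2}) := by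
    intro t ht
    have ht' : |t| < 1 - μ := abs_lt.2 ht
    rcases (colm_nonneg E t).eq_or_lt with h0 | h0
    · right; left; exact ⟨ht', h0.symm⟩
    · rcases (colm_le_two hI t).eq_or_lt with h3 | h3
      · right; right; exact ⟨ht', h3⟩
      · left; exact ⟨by linarith, h0, h3⟩
  have h5 : volume (Ioo (-(1 - μ)) (1 - μ)) ≤ volume {t | |t| < 1 ∧ 0 < colm E t ∧ colm E t < 2} := by
    refine (measure_mono hsub).trans ((measure_union_le _ _).trans ?_)
    have := measure_union_null h1 h2
    rw [this, add_zero]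
  rw [Real.volume_Ioo] at h5
  have h6 := ENNReal.toReal_mono hfin h5
  rw [ENNReal.toReal_ofReal (by linarith)] at h6
  have h7 : 2 - 2 * μ ≤ volume.real {t | |t| < 1 ∧ 0 < colm E t ∧ colm E t < 2} := by
    unfold Measure.real; linarith
  nlinarith

lemma pos_widen {E : Set (ℝ × ℝ)} {μ a : ℝ} (hμ : 0 ≤ μ) (h : 0 < volume {t : ℝ | |t| < 1 - μ ∧ colm E t = a}) :
    0 < volume {t : ℝ | |t| < 1 ∧ colm E t = a} :=
  h.trans_le (measure_mono fun t ht => ⟨by linarith [ht.1], ht.2⟩)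

lemma set_compl_eq {E : Set (ℝ × ℝ)} (hE : MeasurableSet E) (hI : E ⊆ Isq) {μ : ℝ} (hμ : 0 ≤ μ) :
    {t : ℝ | |t| < 1 - μ ∧ colm (Isq \ E) t = 0} = {t : ℝ | |t| < 1 - μ ∧ colm E t = 2} := by
  ext t
  simp only [mem_setOf_eq]
  apply and_congr_right
  intro ht
  rw [colm_compl hE hI (by linarith)]
  constructor <;> intro h <;> linarith

lemma cross {τ : ℝ × ℝ → ℝ} (h : IsNorm2 τ) {E : Set (ℝ × ℝ)} (hE : MeasurableSet E) (hI : E ⊆ Isq) {c : ℝ}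
    (hp : Per τ E c) {p q μ : ℝ} (hq : Adm τ (0, q)) (hp' : Adm τ (p, 0)) (hq0 : 0 < q) (hp0 : 0 < p)
    (hμ : 0 ≤ μ) (hμ1 : μ < 1) (hc : c < q * (2 - 2 * μ)) (hc' : c < p * (2 - 2 * μ)) :
    ∃ F, (F = E ∨ F = Isq \ E) ∧ 0 < volume {t : ℝ | |t| < 1 - μ ∧ colm F t = 0} ∧
      0 < volume {t : ℝ | |t| < 1 - μ ∧ colm (swp F) t = 0} := by
  have hA := exists_free h hE hI hp hq hq0 hμ hμ1 hc
  have hB := exists_free h.swap (swp_meas hE) (swp_sub hI) (hp.swp hE) (adm_swap hp') hp0 hμ hμ1 hc'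
  rcases hA with hA | hA <;> rcases hB with hB | hB
  · exact ⟨E, Or.inl rfl, hA, hB⟩
  · have := dichotomy hE hI (pos_widen hμ hA)
    exact absurd this (pos_widen hμ hB).ne'
  · have := dichotomy (swp_meas hE) (swp_sub hI) (pos_widen hμ hB)
    exact absurd this (pos_widen hμ hA).ne'
  · refine ⟨Isq \ E, Or.inr rfl, ?_, ?_⟩
    · rw [set_compl_eq hE hI hμ]; exact hA
    · rw [swp_compl, set_compl_eq (swp_meas hE) (swp_sub hI) hμ]; exact hB

lemma vol_fin {E : Set (ℝ × ℝ)} (hI : E ⊆ Isq) : volume E ≠ ⊤ :=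
  ((measure_mono hI).trans_lt (by rw [volume_Isq]; simp)).ne

lemma vol_compl {E} (hE : MeasurableSet E) (hI : E ⊆ Isq) : volume.real (Isq \ E) = 4 - volume.real E := by
  rw [measureReal_sdiff hI hE (by rw [volume_Isq]; simp)]
  simp [Measure.real, volume_Isq]

lemma vol_eq_colm {E} (hE : MeasurableSet E) (hI : E ⊆ Isq) : volume.real E = ∫ t, colm E t := by
  unfold Measure.real colm
  rw [Measure.volume_eq_prod, Measure.prod_apply hE, integral_eq_lintegral_of_nonneg_ae
    (Eventually.of_forall fun t => measureReal_nonneg) (colm_measurable hE).aestronglyMeasurable]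
  congr 1
  apply lintegral_congr
  intro t
  exact (ENNReal.ofReal_toReal (slice_fin hI t)).symm

lemma small_vol {τ : ℝ × ℝ → ℝ} (h : IsNorm2 τ) {E : Set (ℝ × ℝ)} (hE : MeasurableSet E) (hI : E ⊆ Isq) {c : ℝ}
    (hp : Per τ E c) {q : ℝ} (hq : Adm τ (0, q)) (hq0 : 0 < q)
    (hB : 0 < volume {t : ℝ | |t| < 1 ∧ colm (swp E) t = 0}) : q * volume.real E ≤ 2 * c := by
  have h2 := dichotomy (swp_meas hE) (swp_sub hI) hB
  rw [swp_swp] at h2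
  have hcb := colbound h hE hI hp hq
  set S := {t | |t| < 1 ∧ 0 < colm E t ∧ colm E t < 2} with hS
  have hSm : MeasurableSet S :=
    (meas_abslt 1).inter ((measurableSet_lt measurable_const (colm_measurable hE)).inter
      (measurableSet_lt (colm_measurable hE) measurable_const))
  have hSf : volume S ≠ ⊤ := ((measure_mono (t := Icc (-1) 1) fun t ht => abs_le.1 ht.1.le).trans_lt (by simp)).ne
  have h3 : volume.real E ≤ 2 * volume.real S := by
    have e : ∫ t, S.indicator (fun _ => (2:ℝ)) t = 2 * volume.real S := by
      rw [integral_indicator_const _ hSm, smul_eq_mul, mul_comm]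
    rw [vol_eq_colm hE hI, ← e]
    apply integral_mono_of_nonneg (Eventually.of_forall fun t => colm_nonneg E t)
    · rw [integrable_indicator_iff hSm]; exact integrableOn_const hSf
    · have n1 : ∀ᵐ t : ℝ, ¬ (|t| < 1 ∧ colm E t = 2) := by
        rw [ae_iff]; simpa using h2
      have n2 : ∀ᵐ t : ℝ, t ≠ 1 := by simp [ae_iff]
      have n3 : ∀ᵐ t : ℝ, t ≠ -1 := by simp [ae_iff]
      filter_upwards [n1, n2, n3] with t h1 h2 h3
      by_cases ht : t ∈ S
      · rw [indicator_of_mem ht]; exact colm_le_two hI t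
      · rw [indicator_of_notMem ht]
        by_contra hpos
        push Not at hpos
        have hlt : |t| < 1 := by
          rw [abs_lt]
          by_contra hcon
          have : Prod.mk t ⁻¹' E = ∅ := by
            ext z
            simp only [mem_preimage, mem_empty_iff_false, iff_false]
            intro hz
            have h4 := abs_le.1 (mem_Isq.1 (hI hz)).1
            apply hcon
            exact ⟨lt_of_le_of_ne h4.1 (Ne.symm h3), lt_of_le_of_ne h4.2 h2⟩
          unfold colm at hpos
          rw [this] at hpos
          simp at hpos
        refine ht ⟨hlt, hpos, lt_of_le_of_ne (colm_le_two hI t) fun h5 => h1 ⟨hlt, h5⟩⟩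
  nlinarith

/-- Positivity. -/
lemma isoper {τ : ℝ × ℝ → ℝ} (h : IsNorm2 τ) : ∃ κ : ℝ, 0 < κ ∧ ∀ E, MeasurableSet E → E ⊆ Isq →
    volume.real E ≤ 3 → ∀ c, Per τ E c → κ * volume.real E ≤ c := by
  obtain ⟨k, hk, hlow⟩ := h.lower
  have hq : Adm τ (0, k) := fun v => by
    refine le_trans ?_ (hlow v)
    simp only [dot2]
    have := (le_abs_self _).trans (norm_snd_le v)
    nlinarith
  have hp' : Adm τ (k, 0) := fun v => by
    refine le_trans ?_ (hlow v)
    simp only [dot2]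
    have := (le_abs_self _).trans (norm_fst_le v)
    nlinarith
  refine ⟨k / 6, by positivity, fun E hE hI hV c hp => ?_⟩
  have hV0 : 0 ≤ volume.real E := measureReal_nonneg
  by_cases hc : c < k
  · obtain ⟨F, hF, hA, hB⟩ := cross h hE hI hp hq hp' hk hk (μ := 1/2) (by norm_num) (by norm_num)
      (by linarith) (by linarith)
    have hB' := pos_widen (by norm_num) hB
    rcases hF with rfl | rfl
    · have := small_vol h hE hI hp hq hk hB'
      nlinarith
    · have := small_vol h (measurableSet_Isq.diff hE) sdiff_subset (hp.compl h hE) hq hk hB'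
      rw [vol_compl hE hI] at this
      nlinarith
  · nlinarith

open MeasureTheory Set Filter ENNReal

/-- Shear homeomorphism. -/
noncomputable def shear (m : ℝ) : (ℝ × ℝ) ≃ₜ (ℝ × ℝ) where
  toFun z := (z.1, z.2 - m * z.1)
  invFun z := (z.1, z.2 + m * z.1)
  left_inv z := by ext <;> simp
  right_inv z := by ext <;> simp
  continuous_toFun := by fun_prop
  continuous_invFun := by fun_prop

lemma shear_apply (m : ℝ) (z : ℝ × ℝ) : shear m z = (z.1, z.2 - m * z.1) := rfl

lemma shear_mp (m : ℝ) : MeasurePreserving (shear m) (volume : Measure (ℝ × ℝ)) volume := by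
  rw [Measure.volume_eq_prod]
  have := MeasurePreserving.skew_product (μa := (volume : Measure ℝ)) (μb := (volume : Measure ℝ))
    (μc := (volume : Measure ℝ)) (μd := (volume : Measure ℝ)) (f := id) (MeasurePreserving.id _)
    (g := fun s t => t - m * s) (by unfold Function.uncurry; fun_prop)
    (Eventually.of_forall fun s => (measurePreserving_sub_right volume (m * s)).map_eq)
  exact this

lemma int_fst_deriv {F : ℝ × ℝ → ℝ} (hF : ContDiff ℝ (⊤ : ℕ∞) F) (hc : HasCompactSupport F) (C : ℝ) :
    ∫ z in univ ×ˢ Iic C, fderiv ℝ F z (1,0) = 0 := by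
  have hcont : Continuous (fun z => fderiv ℝ F z (1,0)) := by
    have h1 : Continuous (fderiv ℝ F) := hF.continuous_fderiv (by simp)
    fun_prop
  have hIntg : Integrable (fun z => fderiv ℝ F z (1,0)) :=
    hcont.integrable_of_hasCompactSupport (hc.fderiv_apply ℝ (1,0))
  rw [Measure.volume_eq_prod, ← Measure.prod_restrict, Measure.restrict_univ]
  rw [integral_prod_symm]
  · have : ∀ t, ∫ s, fderiv ℝ F (s,t) (1,0) = 0 := by
      intro t
      have hd : ∀ s, deriv (fun s => F (s,t)) s = fderiv ℝ F (s,t) (1,0) := by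
        intro s
        have h1 : HasFDerivAt F (fderiv ℝ F (s,t)) (s,t) :=
          (hF.differentiable (by simp) _).hasFDerivAt
        have h2 : HasDerivAt (fun s : ℝ => (s, t)) ((1:ℝ), (0:ℝ)) s :=
          (hasDerivAt_id s).prodMk (hasDerivAt_const s t)
        exact (h1.comp_hasDerivAt s h2).deriv
      simp_rw [← hd]
      apply integral_eq_zero_of_hasDerivAt_of_integrable (f := fun s => F (s,t))
      · intro s
        apply DifferentiableAt.hasDerivAt
        have : Differentiable ℝ F := hF.differentiable (by simp)
        fun_prop
      · have h1 : ContDiff ℝ 1 (fun s => F (s,t)) := (hF.of_le (by simp)).comp (by fun_prop)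
        apply (h1.continuous_deriv le_rfl).integrable_of_hasCompactSupport
        apply HasCompactSupport.deriv
        have : Topology.IsClosedEmbedding (fun s : ℝ => (s,t)) := by
          apply Topology.IsClosedEmbedding.of_continuous_injective_isClosedMap (by fun_prop)
          · intro a b h; simpa using h
          · intro K hK
            have : (fun s : ℝ => (s,t)) '' K = K ×ˢ {t} := by
              ext ⟨a,b⟩; simp [eq_comm]
            rw [this]; exact hK.prod isClosed_singleton
        exact hc.comp_isClosedEmbedding this
      · have h1 : Continuous (fun s => F (s,t)) := hF.continuous.comp (by fun_prop)
        apply h1.integrable_of_hasCompactSupport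
        have : Topology.IsClosedEmbedding (fun s : ℝ => (s,t)) := by
          apply Topology.IsClosedEmbedding.of_continuous_injective_isClosedMap (by fun_prop)
          · intro a b h; simpa using h
          · intro K hK
            have : (fun s : ℝ => (s,t)) '' K = K ×ˢ {t} := by
              ext ⟨a,b⟩; simp [eq_comm]
            rw [this]; exact hK.prod isClosed_singleton
        exact hc.comp_isClosedEmbedding this
    simp [this]
  · have := hIntg.integrableOn (s := univ ×ˢ Iic C)
    rwa [IntegrableOn, Measure.volume_eq_prod, ← Measure.prod_restrict, Measure.restrict_univ] at this

lemma int_snd_deriv {F : ℝ × ℝ → ℝ} (hF : ContDiff ℝ (⊤ : ℕ∞) F) (hc : HasCompactSupport F) (C : ℝ) :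
    ∫ z in univ ×ˢ Iic C, fderiv ℝ F z (0,1) = ∫ s, F (s, C) := by
  have hcont : Continuous (fun z => fderiv ℝ F z (0,1)) := by
    have h1 : Continuous (fderiv ℝ F) := hF.continuous_fderiv (by simp)
    fun_prop
  have hIntg : Integrable (fun z => fderiv ℝ F z (0,1)) :=
    hcont.integrable_of_hasCompactSupport (hc.fderiv_apply ℝ (0,1))
  rw [Measure.volume_eq_prod, ← Measure.prod_restrict, Measure.restrict_univ]
  rw [integral_prod]
  · congr 1
    ext s
    have hd : ∀ t, deriv (fun t => F (s,t)) t = fderiv ℝ F (s,t) (0,1) := by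
      intro t
      have h1 : HasFDerivAt F (fderiv ℝ F (s,t)) (s,t) :=
        (hF.differentiable (by simp) _).hasFDerivAt
      have h2 : HasDerivAt (fun t : ℝ => (s, t)) ((0:ℝ), (1:ℝ)) t :=
        (hasDerivAt_const t s).prodMk (hasDerivAt_id t)
      exact (h1.comp_hasDerivAt t h2).deriv
    simp_rw [← hd]
    have h1 : ContDiff ℝ 1 (fun t => F (s,t)) := (hF.of_le (by simp)).comp (by fun_prop)
    refine HasCompactSupport.integral_Iic_deriv_eq h1 ?_ C
    have : Topology.IsClosedEmbedding (fun t : ℝ => (s,t)) := by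
      apply Topology.IsClosedEmbedding.of_continuous_injective_isClosedMap (by fun_prop)
      · intro a b h; simpa using h
      · intro K hK
        have : (fun t : ℝ => (s,t)) '' K = {s} ×ˢ K := by
          ext ⟨a,b⟩; simp [eq_comm, and_comm]
        rw [this]; exact isClosed_singleton.prod hK
    exact hc.comp_isClosedEmbedding this
  · have := hIntg.integrableOn (s := univ ×ˢ Iic C)
    rwa [IntegrableOn, Measure.volume_eq_prod, ← Measure.prod_restrict, Measure.restrict_univ] at this

lemma meas_half (m C : ℝ) : MeasurableSet {x : ℝ × ℝ | x.2 + m * x.1 ≤ C} :=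
  (isClosed_le (by fun_prop : Continuous fun x : ℝ × ℝ => x.2 + m * x.1) continuous_const).measurableSet

lemma half_per {τ} (hτ : IsNorm2 τ) (m C : ℝ) :
    Per τ (Isq ∩ {x | x.2 + m * x.1 ≤ C}) (2 * τ (m, 1)) := by
  intro f hf
  have hd : Differentiable ℝ f := hf.smooth.differentiable (by simp)
  rw [← setIntegral_eq_of_subset_of_forall_sdiff_eq_zero (t := {x : ℝ × ℝ | x.2 + m * x.1 ≤ C}) (meas_half m C)
    inter_subset_right (fun x hx => hf.div2_zero fun h => hx.2 ⟨Usq_subset_Isq h, hx.1⟩)]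
  rw [← (shear_mp m).setIntegral_preimage_emb (shear m).measurableEmbedding]
  have e : (shear m) ⁻¹' {x : ℝ × ℝ | x.2 + m * x.1 ≤ C} = univ ×ˢ Iic C := by
    ext z; simp [shear_apply]
  rw [e]
  have hSs : ContDiff ℝ (⊤ : ℕ∞) (shear m) := by
    have : (shear m : ℝ × ℝ → ℝ × ℝ) = fun z => (z.1, z.2 - m * z.1) := rfl
    rw [this]; fun_prop
  have hfS : ContDiff ℝ (⊤ : ℕ∞) (fun z => f (shear m z)) := hf.smooth.comp hSs
  have hcS : HasCompactSupport (fun z => f (shear m z)) := hf.cs.comp_homeomorph (shear m)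
  set F : ℝ × ℝ → ℝ := fun z => (f (shear m z)).1 with hFdef
  set G : ℝ × ℝ → ℝ := fun z => m * (f (shear m z)).1 + (f (shear m z)).2 with hGdef
  have hF : ContDiff ℝ (⊤ : ℕ∞) F := hfS.fst
  have hG : ContDiff ℝ (⊤ : ℕ∞) G := (contDiff_const.mul hfS.fst).add hfS.snd
  have hFc : HasCompactSupport F := hcS.comp_left (g := Prod.fst) rfl
  have hGc : HasCompactSupport G := hcS.comp_left (g := fun w : ℝ × ℝ => m * w.1 + w.2) (by simp)
  have key : ∀ z, div2 f (shear m z) = fderiv ℝ F z (1,0) + fderiv ℝ G z (0,1) := by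
    intro z
    have hS : HasFDerivAt (shear m) ((ContinuousLinearMap.fst ℝ ℝ ℝ).prod
        (ContinuousLinearMap.snd ℝ ℝ ℝ - m • ContinuousLinearMap.fst ℝ ℝ ℝ)) z :=
      (ContinuousLinearMap.hasFDerivAt ((ContinuousLinearMap.fst ℝ ℝ ℝ).prod
        (ContinuousLinearMap.snd ℝ ℝ ℝ - m • ContinuousLinearMap.fst ℝ ℝ ℝ)))
    have h0 := (hd (shear m z)).hasFDerivAt.comp z hS
    have h1 : HasFDerivAt F _ z := h0.fst
    have h2 : HasFDerivAt G _ z := (h0.fst.const_mul m).add h0.snd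
    rw [h1.fderiv, h2.fderiv]
    have e1 : ((1:ℝ), -m) = (1,0) - m • (0,1) := by ext <;> simp
    have e2 : fderiv ℝ f (shear m z) (1, -m) = fderiv ℝ f (shear m z) (1,0) - m • fderiv ℝ f (shear m z) (0,1) := by
      rw [e1, map_sub, map_smul]
    simp [div2, e2]
    ring
  simp_rw [key]
  rw [integral_add]
  · rw [int_fst_deriv hF hFc, int_snd_deriv hG hGc, zero_add]
    have hb : ∀ s, G (s, C) ≤ (Icc (-1:ℝ) 1).indicator (fun _ => τ (m,1)) s := by
      intro s
      by_cases hs : s ∈ Icc (-1:ℝ) 1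
      · rw [indicator_of_mem hs]
        have := hf.adm (shear m (s,C)) (m,1)
        simpa [dot2, hGdef] using this
      · rw [indicator_of_notMem hs]
        have : f (shear m (s,C)) = 0 := by
          by_contra h0
          have := hf.supp (subset_tsupport f h0)
          apply hs
          have := this.1
          rw [shear_apply, abs_lt] at this
          exact ⟨this.1.le, this.2.le⟩
        simp [hGdef, this]
    by_cases hi : Integrable (fun s => G (s,C))
    · refine (integral_mono hi ?_ hb).trans ?_
      · exact (integrable_indicator_iff measurableSet_Icc).2 (by simp)
      · rw [integral_indicator measurableSet_Icc]
        simp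
        norm_num
    · rw [integral_undef hi]
      have := hτ.nonneg (m,1)
      linarith
  · apply Integrable.integrableOn
    have h1 : Continuous (fderiv ℝ F) := hF.continuous_fderiv (by simp)
    exact Continuous.integrable_of_hasCompactSupport (by fun_prop) (hFc.fderiv_apply ℝ (1,0))
  · apply Integrable.integrableOn
    have h1 : Continuous (fderiv ℝ G) := hG.continuous_fderiv (by simp)
    exact Continuous.integrable_of_hasCompactSupport (by fun_prop) (hGc.fderiv_apply ℝ (0,1))

open MeasureTheory Set Filter ENNReal

lemma exists_min {τ} (hτ : IsNorm2 τ) : ∃ m, 0 < τ (m,1) ∧ Adm τ (0, τ (m,1)) := by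
  obtain ⟨k, hk, hlow⟩ := hτ.lower
  have hc : Continuous (fun x : ℝ => τ (x,1)) := hτ.continuous.comp (by fun_prop)
  obtain ⟨m, hm⟩ := hc.exists_forall_le (by
    apply tendsto_atTop_mono (f := fun x : ℝ => k * ‖x‖)
    · intro x
      refine le_trans ?_ (hlow (x,1))
      gcongr
      simp [Prod.norm_def]
    · exact Filter.Tendsto.const_mul_atTop hk (tendsto_norm_cocompact_atTop))
  refine ⟨m, hτ.pos (by simp), ?_⟩
  intro v
  simp only [dot2, mul_zero, zero_add]
  rcases le_or_gt v.2 0 with h | h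
  · exact (mul_nonpos_of_nonpos_of_nonneg h (hτ.nonneg _)).trans (hτ.nonneg _)
  · have e : v = v.2 • (v.1 / v.2, (1:ℝ)) := by
      ext
      · simp; field_simp
      · simp
    conv_rhs => rw [e, hτ.smul, abs_of_pos h]
    gcongr
    exact hm _

lemma half_vol (m : ℝ) (V : ℝ) (h0 : 0 ≤ V) (h4 : V ≤ 4) :
    ∃ C, volume.real (Isq ∩ {x : ℝ × ℝ | x.2 + m * x.1 ≤ C}) = V := by
  set g : ℝ → ℝ := fun C => volume.real (Isq ∩ {x : ℝ × ℝ | x.2 + m * x.1 ≤ C}) with hg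
  have hstep : ∀ C C', C ≤ C' → g C' - g C ≤ 2 * (C' - C) ∧ g C ≤ g C' := by
    intro C C' h
    have hsub : Isq ∩ {x : ℝ × ℝ | x.2 + m * x.1 ≤ C} ⊆ Isq ∩ {x : ℝ × ℝ | x.2 + m * x.1 ≤ C'} :=
      fun x hx => ⟨hx.1, le_trans (show x.2 + m * x.1 ≤ C from hx.2) h⟩
    refine ⟨?_, measureReal_mono hsub (vol_fin inter_subset_left)⟩
    have h1 := measureReal_sdiff hsub (measurableSet_Isq.inter (meas_half m C)) (vol_fin inter_subset_left)
    simp only [hg]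
    rw [← h1]
    have hm : MeasurableSet ((Isq ∩ {x : ℝ × ℝ | x.2 + m * x.1 ≤ C'}) \ (Isq ∩ {x : ℝ × ℝ | x.2 + m * x.1 ≤ C})) :=
      (measurableSet_Isq.inter (meas_half m C')).diff (measurableSet_Isq.inter (meas_half m C))
    have h2 := (shear_mp m).measure_preimage hm.nullMeasurableSet
    have h3 : (shear m) ⁻¹' ((Isq ∩ {x : ℝ × ℝ | x.2 + m * x.1 ≤ C'}) \ (Isq ∩ {x : ℝ × ℝ | x.2 + m * x.1 ≤ C}))
        ⊆ Icc (-1) 1 ×ˢ Ioc C C' := by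
      intro z hz
      simp only [mem_preimage, Set.mem_sdiff, mem_inter_iff, mem_Isq, shear_apply, Set.mem_ofPred_eq] at hz
      obtain ⟨⟨⟨a, b⟩, d⟩, e⟩ := hz
      rw [abs_le] at a
      refine ⟨a, ?_, by linarith⟩
      by_contra h
      exact e ⟨⟨abs_le.2 a, b⟩, by push Not at h; linarith⟩
    rw [Measure.real, ← h2]
    have h4 := measure_mono (μ := volume) h3
    rw [Measure.volume_eq_prod, Measure.prod_prod] at h4
    simp only [Real.volume_Icc, Real.volume_Ioc] at h4
    rw [← ENNReal.ofReal_mul (by norm_num)] at h4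
    refine (ENNReal.toReal_mono ENNReal.ofReal_ne_top h4).trans ?_
    rw [ENNReal.toReal_ofReal (by apply mul_nonneg <;> linarith)]
    linarith
  have hcont : Continuous g := by
    have : LipschitzWith 2 g := by
      apply LipschitzWith.of_dist_le_mul
      intro x y
      simp only [Real.dist_eq, NNReal.coe_ofNat]
      rcases le_total x y with h | h
      · obtain ⟨a, b⟩ := hstep x y h
        rw [abs_of_nonpos (by linarith), abs_of_nonpos (by linarith)]; linarith
      · obtain ⟨a, b⟩ := hstep y x h
        rw [abs_of_nonneg (by linarith), abs_of_nonneg (by linarith)]; linarith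
    exact this.continuous
  have hbd : ∀ x ∈ Isq, |x.2 + m * x.1| ≤ 1 + |m| := by
    intro x hx
    rw [mem_Isq] at hx
    refine (abs_add_le _ _).trans ?_
    rw [abs_mul]
    nlinarith [abs_nonneg m, abs_nonneg x.1]
  have e0 : g (-(2 + |m|)) = 0 := by
    have : Isq ∩ {x : ℝ × ℝ | x.2 + m * x.1 ≤ -(2 + |m|)} = ∅ := by
      ext x
      simp only [mem_inter_iff, Set.mem_ofPred_eq, mem_empty_iff_false, iff_false, not_and, not_le]
      intro hx
      have := (abs_le.1 (hbd x hx)).1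
      linarith
    simp only [hg, this, measureReal_empty]
  have e4 : g (2 + |m|) = 4 := by
    have : Isq ∩ {x : ℝ × ℝ | x.2 + m * x.1 ≤ (2 + |m|)} = Isq := by
      apply inter_eq_left.2
      intro x hx
      have := (abs_le.1 (hbd x hx)).2
      simp only [Set.mem_ofPred_eq]
      linarith
    simp [hg, this, Measure.real, volume_Isq]
  have := intermediate_value_Icc (a := -(2 + |m|)) (b := 2 + |m|) (by have := abs_nonneg m; linarith) hcont.continuousOn
  rw [e0, e4] at this
  obtain ⟨C, -, hC⟩ := this ⟨h0, h4⟩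
  exact ⟨C, hC⟩

/-- a set of given volume and energy `2 q` -/
lemma half_exists {τ} (hτ : IsNorm2 τ) (m V : ℝ) (h0 : 0 ≤ V) (h4 : V ≤ 4) :
    ∃ E, MeasurableSet E ∧ E ⊆ Isq ∧ volume.real E = V ∧ Per τ E (2 * τ (m,1)) := by
  obtain ⟨C, hC⟩ := half_vol m V h0 h4
  exact ⟨_, measurableSet_Isq.inter (meas_half m C), inter_subset_left, hC, half_per hτ m C⟩

open MeasureTheory Set Filter ENNReal

lemma integral_affine {r : ℝ} (hr : 0 < r) (b : ℝ × ℝ) (g : ℝ × ℝ → ℝ) :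
    ∫ x, g (r • x + b) = (r ^ 2)⁻¹ * ∫ x, g x := by
  have := Measure.integral_comp_smul (volume : Measure (ℝ × ℝ)) (fun x => g (x + b)) r
  rw [this, integral_add_right_eq_self g b]
  simp

lemma affine_meas {S : Set (ℝ × ℝ)} (hS : MeasurableSet S) (r : ℝ) (b : ℝ × ℝ) :
    MeasurableSet {x : ℝ × ℝ | r • x + b ∈ S} :=
  (by fun_prop : Measurable fun x : ℝ × ℝ => r • x + b) hS

lemma setIntegral_affine {r : ℝ} (hr : 0 < r) (b : ℝ × ℝ) (g : ℝ × ℝ → ℝ) {S : Set (ℝ × ℝ)}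
    (hS : MeasurableSet S) :
    ∫ x in {x : ℝ × ℝ | r • x + b ∈ S}, g (r • x + b) = (r ^ 2)⁻¹ * ∫ x in S, g x := by
  rw [← integral_indicator hS, ← integral_affine hr b, ← integral_indicator (affine_meas hS r b)]
  rfl

lemma vol_affine {r : ℝ} (hr : 0 < r) (b : ℝ × ℝ) {S : Set (ℝ × ℝ)}
    (hS : MeasurableSet S) :
    volume.real {x : ℝ × ℝ | r • x + b ∈ S} = (r ^ 2)⁻¹ * volume.real S := by
  have := setIntegral_affine hr b (fun _ => 1) hS
  simpa using this

lemma affine_per {τ} {r : ℝ} (hr : 0 < r) (b : ℝ × ℝ) {S : Set (ℝ × ℝ)} (hS : MeasurableSet S) {c : ℝ}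
    (hp : Per τ S c)
    (H : ∀ f, TF τ f → ∃ g, TF τ g ∧ ∀ y ∈ S, div2 g y = div2 (fun y => f (r⁻¹ • y + -(r⁻¹ • b))) y) :
    Per τ {x : ℝ × ℝ | r • x + b ∈ S} (r⁻¹ * c) := by
  intro f hf
  obtain ⟨g, hg, hgS⟩ := H f hf
  have h1 := hp g hg
  have h2 : ∀ y, div2 (fun y => f (r⁻¹ • y + -(r⁻¹ • b))) y = r⁻¹ * div2 f (r⁻¹ • y + -(r⁻¹ • b)) := fun y =>
    div2_comp_affine r⁻¹ _ (hf.smooth.differentiable (by simp) _)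
  rw [setIntegral_congr_fun hS hgS] at h1
  simp_rw [h2] at h1
  rw [integral_const_mul] at h1
  have h3 := setIntegral_affine hr b (fun y => div2 f (r⁻¹ • y + -(r⁻¹ • b))) hS
  have h4 : ∀ x : ℝ × ℝ, r⁻¹ • (r • x + b) + -(r⁻¹ • b) = x := by
    intro x
    rw [smul_add, smul_smul, inv_mul_cancel₀ hr.ne']; simp
  simp_rw [h4] at h3
  rw [h3]
  calc (r^2)⁻¹ * ∫ x in S, div2 f (r⁻¹ • x + -(r⁻¹ • b))
      = r⁻¹ * (r⁻¹ * ∫ x in S, div2 f (r⁻¹ • x + -(r⁻¹ • b))) := by field_simp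
    _ ≤ r⁻¹ * c := by gcongr

lemma tsupport_comp_affine (f : ℝ × ℝ → ℝ × ℝ) {r : ℝ} (hr : r ≠ 0) (b : ℝ × ℝ) :
    tsupport (fun y => f (r • y + b)) = {y | r • y + b ∈ tsupport f} := by
  have := tsupport_comp_eq_preimage f ((Homeomorph.smulOfNeZero r hr).trans (Homeomorph.addRight b))
  exact this

lemma cs_comp_affine {f : ℝ × ℝ → ℝ × ℝ} (hc : HasCompactSupport f) {r : ℝ} (hr : r ≠ 0) (b : ℝ × ℝ) :
    HasCompactSupport (fun y => f (r • y + b)) :=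
  hc.comp_homeomorph ((Homeomorph.smulOfNeZero r hr).trans (Homeomorph.addRight b))

/-- zoom in -/
lemma zoom_per {τ} {ρ : ℝ} (hr : 0 < ρ) (hr1 : ρ ≤ 1) {P : ℝ × ℝ} (hP : P ∈ Isq) {S : Set (ℝ × ℝ)}
    (hS : MeasurableSet S) {c : ℝ} (hp : Per τ S c) :
    Per τ {x : ℝ × ℝ | ρ • x + (1 - ρ) • P ∈ S} (ρ⁻¹ * c) := by
  apply affine_per hr _ hS hp
  intro f hf
  refine ⟨_, ⟨?_, cs_comp_affine hf.cs (inv_ne_zero hr.ne') _, ?_, fun x => hf.adm _⟩, fun y _ => rfl⟩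
  · exact hf.smooth.comp (by fun_prop)
  · rw [tsupport_comp_affine f (inv_ne_zero hr.ne')]
    intro y hy
    have h1 := hf.supp hy
    set z := ρ⁻¹ • y + -(ρ⁻¹ • (1 - ρ) • P) with hz
    have e : y = ρ • z + (1 - ρ) • P := by
      rw [hz, smul_add, smul_neg, smul_smul, smul_smul, mul_inv_cancel₀ hr.ne']; simp
    rw [mem_Isq] at hP
    have aux : ∀ u v : ℝ, |u| < 1 → |v| ≤ 1 → |ρ * u + (1 - ρ) * v| < 1 := by
      intro u v hu hv
      rw [abs_lt] at *; rw [abs_le] at hv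
      constructor <;> nlinarith
    rw [e]
    exact ⟨aux _ _ h1.1 hP.1, aux _ _ h1.2 hP.2⟩

lemma cutoff_exists {K : Set (ℝ × ℝ)} (hK : IsCompact K) (hKU : K ⊆ Usq) :
    ∃ χ : ℝ × ℝ → ℝ, ContDiff ℝ (⊤ : ℕ∞) χ ∧ (∀ x, χ x ∈ Icc (0:ℝ) 1) ∧ tsupport χ ⊆ Usq ∧
      ∀ x ∈ K, ∀ᶠ y in nhds x, χ y = 1 := by
  obtain ⟨V, hVo, hKV, hVU⟩ : ∃ V, IsOpen V ∧ K ⊆ V ∧ closure V ⊆ Usq := by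
    obtain ⟨V, h1, h2, h3, -⟩ := exists_open_between_and_isCompact_closure hK isOpen_Usq hKU
    exact ⟨V, h1, h2, h3⟩
  obtain ⟨f, h1, h2, h3⟩ := exists_contMDiffMap_one_nhds_of_subset_interior (n := (⊤ : ℕ∞)) (modelWithCornersSelf ℝ (ℝ × ℝ))
    hK.isClosed (t := V) (by rwa [hVo.interior_eq])
  refine ⟨f, f.contMDiff.contDiff, h3, ?_, ?_⟩
  · refine (closure_mono ?_).trans hVU
    intro x hx
    by_contra h
    exact hx (h2 x h)
  · intro x hx
    exact (eventually_nhdsSet_iff_forall.1 h1) x hx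

lemma cut_field {τ} (hτ : IsNorm2 τ) {g : ℝ × ℝ → ℝ × ℝ} (hsm : ContDiff ℝ (⊤ : ℕ∞) g) (hcs : HasCompactSupport g)
    (ha : ∀ x, Adm τ (g x)) {S Q : Set (ℝ × ℝ)} (hQ : IsClosed Q) (hSQ : S ⊆ Q) (hU : tsupport g ∩ Q ⊆ Usq) :
    ∃ g', TF τ g' ∧ ∀ y ∈ S, div2 g' y = div2 g y := by
  have hK : IsCompact (tsupport g ∩ Q) := IsCompact.inter_right hcs hQ
  obtain ⟨χ, h1, h2, h3, h4⟩ := cutoff_exists hK hU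
  refine ⟨fun x => χ x • g x, ⟨h1.smul hsm, ?_, ?_, ?_⟩, ?_⟩
  · exact hcs.of_isClosed_subset (isClosed_tsupport _) (tsupport_smul_subset_right χ g)
  · exact subset_trans (tsupport_smul_subset_left χ g) h3
  · intro x
    exact (ha x).smul hτ (h2 x).1 (h2 x).2
  · intro y hy
    by_cases hyt : y ∈ tsupport g
    · have h5 := h4 y ⟨hyt, hSQ hy⟩
      have h6 : (fun x => χ x • g x) =ᶠ[nhds y] g := by
        filter_upwards [h5] with x hx
        simp [hx]
      unfold div2
      rw [h6.fderiv_eq]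
    · rw [div2_zero hyt, div2_zero]
      intro h
      exact hyt (tsupport_smul_subset_right χ g h)

lemma inv_aux {ρ : ℝ} (hr : 0 < ρ) (P y : ℝ × ℝ) :
    ρ⁻¹⁻¹ • y + -(ρ⁻¹⁻¹ • -(ρ⁻¹ • (1 - ρ) • P)) = ρ • y + (1 - ρ) • P := by
  rw [inv_inv, smul_neg, smul_smul, mul_inv_cancel₀ hr.ne', one_smul, neg_neg]

/-- shrink -/
lemma shrink_per {τ} (hτ : IsNorm2 τ) {ρ : ℝ} (hr : 0 < ρ) {P : ℝ × ℝ} {S Q : Set (ℝ × ℝ)}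
    (hS : MeasurableSet S) {c : ℝ} (hp : Per τ S c) (hQ : IsClosed Q) (hSQ : S ⊆ Q)
    (H : ∀ x ∈ Q, ρ • x + (1 - ρ) • P ∈ Usq → x ∈ Usq) :
    Per τ {x : ℝ × ℝ | ρ⁻¹ • x + -(ρ⁻¹ • (1 - ρ) • P) ∈ S} (ρ * c) := by
  have := affine_per (τ := τ) (inv_pos.2 hr) (-(ρ⁻¹ • (1 - ρ) • P)) hS hp ?_
  · rwa [inv_inv] at this
  intro f hf
  have e : (fun y => f (ρ⁻¹⁻¹ • y + -(ρ⁻¹⁻¹ • -(ρ⁻¹ • (1 - ρ) • P)))) = fun y => f (ρ • y + (1 - ρ) • P) := by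
    funext y; rw [inv_aux hr]
  rw [e]
  have hts := tsupport_comp_affine f hr.ne' ((1 - ρ) • P)
  have hcs := cs_comp_affine hf.cs hr.ne' ((1 - ρ) • P)
  have hsm : ContDiff ℝ (⊤ : ℕ∞) (fun y => f (ρ • y + (1 - ρ) • P)) := hf.smooth.comp (by fun_prop)
  refine cut_field hτ hsm hcs (fun x => hf.adm _) hQ hSQ ?_
  rintro x ⟨hx1, hx2⟩
  rw [hts] at hx1
  exact H x hx2 (hf.supp hx1)

open MeasureTheory Set Filter ENNReal

lemma st_deriv_zero {s : ℝ} (hs : s ≤ 0 ∨ 1 ≤ s) : deriv Real.smoothTransition s = 0 := by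
  rcases hs with h | h
  · have h0 := Real.smoothTransition.zero_of_nonpos h
    apply IsLocalMin.deriv_eq_zero
    exact Eventually.of_forall fun x => by rw [h0]; exact Real.smoothTransition.nonneg x
  · have h0 := Real.smoothTransition.one_of_one_le h
    apply IsLocalMax.deriv_eq_zero
    exact Eventually.of_forall fun x => by rw [h0]; exact Real.smoothTransition.le_one x

lemma st_deriv_bound : ∃ C, 0 ≤ C ∧ ∀ s, |deriv Real.smoothTransition s| ≤ C := by
  have hc : Continuous (deriv Real.smoothTransition) :=
    (Real.smoothTransition.contDiff (n := 1)).continuous_deriv le_rfl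
  obtain ⟨C, hC⟩ := (isCompact_Icc (a := (0:ℝ)) (b := 1)).exists_bound_of_continuousOn hc.continuousOn
  refine ⟨max C 0, le_max_right _ _, fun s => ?_⟩
  by_cases hs : s ∈ Icc (0:ℝ) 1
  · exact (hC s hs).trans (le_max_left _ _)
  · rw [st_deriv_zero (by
      by_contra h; push Not at h; exact hs ⟨h.1.le, h.2.le⟩)]
    simp

/-- smooth step in the first variable -/
noncomputable def stp (t0 δ : ℝ) (x : ℝ × ℝ) : ℝ := Real.smoothTransition (((x.1 - t0) / δ + 1) / 2)

lemma stp_contDiff (t0 δ : ℝ) : ContDiff ℝ (⊤ : ℕ∞) (stp t0 δ) := by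
  unfold stp
  exact Real.smoothTransition.contDiff.comp (by fun_prop)

lemma stp_fderiv (t0 δ : ℝ) (x v : ℝ × ℝ) : fderiv ℝ (stp t0 δ) x v =
    deriv Real.smoothTransition (((x.1 - t0) / δ + 1) / 2) * (v.1 / δ / 2) := by
  have h1 : HasFDerivAt (fun x : ℝ × ℝ => ((x.1 - t0) / δ + 1) / 2)
      ((2:ℝ)⁻¹ • δ⁻¹ • ContinuousLinearMap.fst ℝ ℝ ℝ) x := by
    have h : HasFDerivAt (fun x : ℝ × ℝ => x.1) (ContinuousLinearMap.fst ℝ ℝ ℝ) x := hasFDerivAt_fst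
    have h2 := (((h.sub_const t0).const_mul δ⁻¹).add_const 1).const_mul (2:ℝ)⁻¹
    refine h2.congr_of_eventuallyEq (Eventually.of_forall fun y => ?_)
    simp only; ring
  have h2 : HasDerivAt Real.smoothTransition (deriv Real.smoothTransition (((x.1 - t0) / δ + 1) / 2))
      (((x.1 - t0) / δ + 1) / 2) :=
    ((Real.smoothTransition.contDiff (n := 1)).differentiable (by simp) _).hasDerivAt
  have h3 : HasFDerivAt (stp t0 δ) _ x := h2.comp_hasFDerivAt x h1
  rw [h3.fderiv]
  simp
  left; ring

/-- Strip thinness at `t0`. -/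
def Thin (F : Set (ℝ × ℝ)) (t0 : ℝ) : Prop :=
  ∀ ε > 0, ∃ δ > 0, δ ≤ 1 ∧ volume.real (F ∩ {x | |x.1 - t0| < δ}) ≤ ε * δ

lemma Thin.mono {F G : Set (ℝ × ℝ)} {t0} (hF : Thin F t0) (h : G ⊆ F) (hI : F ⊆ Isq) : Thin G t0 := by
  intro ε hε
  obtain ⟨δ, h1, h2, h3⟩ := hF ε hε
  exact ⟨δ, h1, h2, (measureReal_mono (inter_subset_inter_left _ h)
    (vol_fin (inter_subset_left.trans hI))).trans h3⟩

lemma TF.blend {τ f g} (hf : TF τ f) (hg : TF τ g) (t0 δ : ℝ) :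
    TF τ (fun x => f x + stp t0 δ x • (g x - f x)) := by
  have hsub : tsupport (fun x => f x + stp t0 δ x • (g x - f x)) ⊆ tsupport f ∪ tsupport g := by
    apply closure_minimal _ ((isClosed_tsupport f).union (isClosed_tsupport g))
    intro x hx
    by_contra h
    rw [mem_union, not_or] at h
    apply hx
    simp [image_eq_zero_of_notMem_tsupport h.1, image_eq_zero_of_notMem_tsupport h.2]
  refine ⟨hf.smooth.add ((stp_contDiff t0 δ).smul (hg.smooth.sub hf.smooth)), ?_,
    hsub.trans (union_subset hf.supp hg.supp), ?_⟩
  · exact (IsCompact.union hf.cs hg.cs).of_isClosed_subset (isClosed_tsupport _) hsub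
  · intro x
    have e : f x + stp t0 δ x • (g x - f x) = (1 - stp t0 δ x) • f x + stp t0 δ x • g x := by
      rw [smul_sub, sub_smul, one_smul]; abel
    rw [e]
    exact adm_convex (hf.adm x) (hg.adm x) (sub_nonneg.2 (Real.smoothTransition.le_one _))
      (Real.smoothTransition.nonneg _) (by ring)

lemma div2_blend {τ f g} (hf : TF τ f) (hg : TF τ g) (t0 δ : ℝ) (x) :
    div2 (fun x => f x + stp t0 δ x • (g x - f x)) x =
      div2 f x + stp t0 δ x * (div2 g x - div2 f x) +
      deriv Real.smoothTransition (((x.1 - t0) / δ + 1) / 2) / δ / 2 * ((g x).1 - (f x).1) := by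
  have df := hf.smooth.differentiable (by simp)
  have dg := hg.smooth.differentiable (by simp)
  have ds := (stp_contDiff t0 δ).differentiable (by simp)
  have hdiff : DifferentiableAt ℝ (fun x => g x - f x) x := (dg x).sub (df x)
  have hsm : DifferentiableAt ℝ (fun x => stp t0 δ x • (g x - f x)) x := (ds x).smul hdiff
  rw [div2_add (df x) hsm, div2_smul hdiff (ds x), stp_fderiv, stp_fderiv]
  have : div2 (fun x => g x - f x) x = div2 g x - div2 f x := by
    unfold div2
    rw [fderiv_fun_sub (dg x) (df x)]
    simp; ring
  rw [this]
  simp; ring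

lemma meas_left (t0 : ℝ) : MeasurableSet {x : ℝ × ℝ | x.1 ≤ t0} :=
  (isClosed_le (by fun_prop : Continuous fun x : ℝ × ℝ => x.1) continuous_const).measurableSet

lemma meas_strip (t0 δ : ℝ) : MeasurableSet {x : ℝ × ℝ | |x.1 - t0| < δ} :=
  (isOpen_lt (by fun_prop : Continuous fun x : ℝ × ℝ => |x.1 - t0|) continuous_const).measurableSet

lemma cut_two {τ} {F : Set (ℝ × ℝ)} (hF : MeasurableSet F) (hI : F ⊆ Isq) {t0 c : ℝ} (ht : Thin F t0)
    (hp : Per τ F c) {f g} (hf : TF τ f) (hg : TF τ g) :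
    (∫ x in F ∩ {x | x.1 ≤ t0}, div2 f x) + (∫ x in F \ {x | x.1 ≤ t0}, div2 g x) ≤ c := by
  obtain ⟨C, hC0, hC⟩ := st_deriv_bound
  obtain ⟨Mf, hMf⟩ := div2_bound hf.smooth hf.cs
  obtain ⟨Mg, hMg⟩ := div2_bound hg.smooth hg.cs
  obtain ⟨Bf, hBf⟩ := hf.cs.exists_bound_of_continuous hf.smooth.continuous
  obtain ⟨Bg, hBg⟩ := hg.cs.exists_bound_of_continuous hg.smooth.continuous
  have hMf0 : 0 ≤ Mf := (abs_nonneg _).trans (hMf 0)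
  have hMg0 : 0 ≤ Mg := (abs_nonneg _).trans (hMg 0)
  have hBf0 : 0 ≤ Bf := (norm_nonneg _).trans (hBf 0)
  have hBg0 : 0 ≤ Bg := (norm_nonneg _).trans (hBg 0)
  set L : Set (ℝ × ℝ) := {x | x.1 ≤ t0} with hL
  have hLm : MeasurableSet L := meas_left t0
  set D0 : ℝ × ℝ → ℝ := L.piecewise (div2 f) (div2 g) with hD0
  have hif := div2_integrable hf.smooth hf.cs
  have hig := div2_integrable hg.smooth hg.cs
  have hi0 : Integrable D0 := Integrable.piecewise hLm hif.integrableOn hig.integrableOn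
  have e0 : (∫ x in F ∩ L, div2 f x) + (∫ x in F \ L, div2 g x) = ∫ x in F, D0 x := by
    rw [← integral_inter_add_sdiff hLm hi0.integrableOn]
    congr 1
    · apply setIntegral_congr_fun (hF.inter hLm)
      intro x hx; simp [hD0, hx.2]
    · apply setIntegral_congr_fun (hF.diff hLm)
      intro x hx; simp [hD0, hx.2]
  rw [e0]
  set M := Mf + Mg + C * (Bf + Bg) with hM
  have hM0 : 0 ≤ M := by positivity
  have main : ∀ ε > 0, ∫ x in F, D0 x ≤ c + ε * M := by
    intro ε hε
    obtain ⟨δ, hδ, hδ1, hv⟩ := ht ε hε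
    have hw := hf.blend hg t0 δ
    have h1 := hp _ hw
    have hiw := div2_integrable hw.smooth hw.cs
    have hpt : ∀ x, D0 x ≤ div2 (fun x => f x + stp t0 δ x • (g x - f x)) x +
        {x : ℝ × ℝ | |x.1 - t0| < δ}.indicator (fun _ => M / δ) x := by
      intro x
      rw [div2_blend hf hg]
      by_cases hx : x ∈ {x : ℝ × ℝ | |x.1 - t0| < δ}
      · rw [indicator_of_mem hx]
        have s0 : 0 ≤ stp t0 δ x := Real.smoothTransition.nonneg _
        have s1 : stp t0 δ x ≤ 1 := Real.smoothTransition.le_one _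
        have a1 := abs_le.1 (hMf x)
        have a2 := abs_le.1 (hMg x)
        have hb1 : |(g x).1 - (f x).1| ≤ Bf + Bg := by
          refine (abs_sub _ _).trans ?_
          have := (norm_fst_le (f x)).trans (hBf x)
          have := (norm_fst_le (g x)).trans (hBg x)
          simp only [Real.norm_eq_abs] at *
          linarith
        have hb2 : |deriv Real.smoothTransition (((x.1 - t0) / δ + 1) / 2) / δ / 2 * ((g x).1 - (f x).1)|
            ≤ C * (Bf + Bg) / δ := by
          rw [abs_mul, abs_div, abs_div, abs_of_pos hδ, abs_of_pos (two_pos : (0:ℝ) < 2)]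
          calc _ ≤ C / δ / 2 * (Bf + Bg) := by gcongr; exact hC _
            _ = C * (Bf + Bg) / δ / 2 := by ring
            _ ≤ C * (Bf + Bg) / δ := half_le_self (by positivity)
        have hb3 := (abs_le.1 hb2).1
        have e2 : M / δ = (Mf + Mg) / δ + C * (Bf + Bg) / δ := by rw [hM]; ring
        have e3 : Mf + Mg ≤ (Mf + Mg) / δ := by
          rw [le_div_iff₀ hδ]; nlinarith
        rw [e2]
        by_cases hxL : x ∈ L
        · simp only [hD0, piecewise_eq_of_mem _ _ _ hxL]
          have : -(Mf + Mg) ≤ stp t0 δ x * (div2 g x - div2 f x) := by nlinarith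
          linarith
        · simp only [hD0, piecewise_eq_of_notMem _ _ _ hxL]
          have : -(Mf + Mg) ≤ (1 - stp t0 δ x) * (div2 f x - div2 g x) := by nlinarith
          nlinarith
      · rw [indicator_of_notMem hx]
        rw [Set.mem_ofPred_eq, not_lt, le_abs'] at hx
        rcases hx with hx | hx
        · have hs : ((x.1 - t0) / δ + 1) / 2 ≤ 0 := by
            have : (x.1 - t0) / δ ≤ -1 := by rw [div_le_iff₀ hδ]; linarith
            linarith
          have hxL : x ∈ L := by simp only [hL, Set.mem_ofPred_eq]; linarith
          rw [st_deriv_zero (Or.inl hs)]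
          simp only [hD0, piecewise_eq_of_mem _ _ _ hxL, stp, Real.smoothTransition.zero_of_nonpos hs]
          simp
        · have hs : 1 ≤ ((x.1 - t0) / δ + 1) / 2 := by
            have : 1 ≤ (x.1 - t0) / δ := by rw [le_div_iff₀ hδ]; linarith
            linarith
          have hxL : x ∉ L := by simp only [hL, Set.mem_ofPred_eq]; linarith
          rw [st_deriv_zero (Or.inr hs)]
          simp only [hD0, piecewise_eq_of_notMem _ _ _ hxL, stp, Real.smoothTransition.one_of_one_le hs]
          simp
    have hind : IntegrableOn ({x : ℝ × ℝ | |x.1 - t0| < δ}.indicator (fun _ => M / δ)) F := by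
      apply IntegrableOn.indicator _ (meas_strip t0 δ)
      exact integrableOn_const (vol_fin hI)
    calc ∫ x in F, D0 x ≤ ∫ x in F, (div2 (fun x => f x + stp t0 δ x • (g x - f x)) x +
        {x : ℝ × ℝ | |x.1 - t0| < δ}.indicator (fun _ => M / δ) x) :=
          setIntegral_mono hi0.integrableOn (hiw.integrableOn.add hind) hpt
      _ = (∫ x in F, div2 (fun x => f x + stp t0 δ x • (g x - f x)) x) +
          volume.real (F ∩ {x : ℝ × ℝ | |x.1 - t0| < δ}) * (M / δ) := by
        rw [integral_add hiw.integrableOn hind, setIntegral_indicator (meas_strip t0 δ)]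
        simp
      _ ≤ c + ε * δ * (M / δ) := by gcongr
      _ = c + ε * M := by field_simp
  apply _root_.le_of_forall_pos_le_add
  intro ε hε
  refine (main (ε / (M + 1)) (by positivity)).trans ?_
  gcongr
  rw [div_mul_eq_mul_div, div_le_iff₀ (by positivity)]
  nlinarith

lemma cut_split {τ} (hτ : IsNorm2 τ) {F : Set (ℝ × ℝ)} (hF : MeasurableSet F) (hI : F ⊆ Isq) {t0 c : ℝ} (ht : Thin F t0)
    (hp : Per τ F c) :
    ∃ c1 c2, c1 + c2 ≤ c ∧ Per τ (F ∩ {x | x.1 ≤ t0}) c1 ∧ Per τ (F \ {x | x.1 ≤ t0}) c2 := by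
  set A : Set ℝ := {y | ∃ f, TF τ f ∧ y = ∫ x in F ∩ {x | x.1 ≤ t0}, div2 f x} with hA
  have hbd : ∀ g, TF τ g → ∀ y ∈ A, y ≤ c - ∫ x in F \ {x | x.1 ≤ t0}, div2 g x := by
    rintro g hg y ⟨f, hf, rfl⟩
    have := cut_two hF hI ht hp hf hg
    linarith
  have hne : A.Nonempty := ⟨_, _, TF.zero hτ, rfl⟩
  refine ⟨sSup A, c - sSup A, by linarith, ?_, ?_⟩
  · intro f hf
    exact le_csSup ⟨_, hbd _ (TF.zero hτ)⟩ ⟨f, hf, rfl⟩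
  · intro g hg
    have := csSup_le hne (hbd g hg)
    linarith

open MeasureTheory Set Filter ENNReal

lemma thin_exists {F : Set (ℝ × ℝ)} (hF : MeasurableSet F) (hI : F ⊆ Isq) {β : ℝ}
    (h : 0 < volume {t : ℝ | |t| < β ∧ colm F t = 0}) : ∃ t0, |t0| < β ∧ Thin F t0 := by
  have hIntg : LocallyIntegrable (colm F) := by
    have hm := colm_measurable hF
    intro x
    refine ⟨Icc (x - 1) (x + 1), Icc_mem_nhds (by linarith) (by linarith), ?_⟩
    apply Measure.integrableOn_of_bounded (M := 2) (by simp) hm.aestronglyMeasurable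
    exact Eventually.of_forall fun t => by
      rw [Real.norm_eq_abs, abs_of_nonneg (colm_nonneg F t)]; exact colm_le_two hI t
  have hae := _root_.LocallyIntegrable.ae_hasDerivAt_integral hIntg
  obtain ⟨t0, ⟨ht1, ht2⟩, ht3⟩ : ∃ t0, t0 ∈ {t : ℝ | |t| < β ∧ colm F t = 0} ∧
      ∀ (c : ℝ), HasDerivAt (fun x => ∫ t in c..x, colm F t) (colm F t0) t0 := by
    by_contra hcon
    push Not at hcon
    refine h.ne' (measure_mono_null ?_ hae)
    intro t ht hh
    obtain ⟨c, hc⟩ := hcon t ht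
    exact hc (hh c)
  refine ⟨t0, ht1, ?_⟩
  intro ε hε
  have hd := ht3 t0
  rw [ht2, hasDerivAt_iff_isLittleO] at hd
  have hd2 := hd.def (half_pos hε)
  rw [Metric.eventually_nhds_iff] at hd2
  obtain ⟨δ', hδ', hd3⟩ := hd2
  set δ := min (δ' / 2) 1 with hδ
  have hδ0 : 0 < δ := by positivity
  have hδ1 : δ ≤ 1 := min_le_right _ _
  have hδ2 : δ < δ' := lt_of_le_of_lt (min_le_left _ _) (by linarith)
  refine ⟨δ, hδ0, hδ1, ?_⟩
  have hv : volume.real (F ∩ {x | |x.1 - t0| < δ}) ≤ ∫ t in (t0 - δ)..(t0 + δ), colm F t := by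
    rw [vol_eq_colm (hF.inter (meas_strip t0 δ)) (inter_subset_left.trans hI)]
    rw [intervalIntegral.integral_of_le (by linarith), ← integral_indicator measurableSet_Ioc]
    apply le_of_eq
    apply integral_congr_ae
    have : ∀ᵐ t : ℝ, t ≠ t0 + δ := by
      rw [ae_iff]; simp
    filter_upwards [this] with t ht
    by_cases hts : |t - t0| < δ
    · rw [abs_lt] at hts
      rw [indicator_of_mem (show t ∈ Ioc (t0 - δ) (t0 + δ) from ⟨by linarith, by linarith⟩)]
      unfold colm
      congr 1
      ext z
      simp only [mem_preimage, mem_inter_iff, Set.mem_ofPred_eq, abs_lt, and_iff_left_iff_imp]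
      exact fun _ => hts
    · rw [indicator_of_notMem (show t ∉ Ioc (t0 - δ) (t0 + δ) from fun hm => hts (by
        rw [abs_lt]; exact ⟨by linarith [hm.1], by linarith [lt_of_le_of_ne hm.2 ht]⟩))]
      unfold colm
      have : Prod.mk t ⁻¹' (F ∩ {x | |x.1 - t0| < δ}) = ∅ := by
        ext z
        simp only [mem_preimage, mem_inter_iff, Set.mem_ofPred_eq, mem_empty_iff_false, iff_false, not_and]
        exact fun _ => hts
      simp [this]
  refine hv.trans ?_
  have hii : ∀ u v, IntervalIntegrable (colm F) volume u v := fun u v =>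
    intervalIntegrable_iff.mpr <| (MeasureTheory.LocallyIntegrable.integrableOn_isCompact hIntg isCompact_uIcc).mono_set uIoc_subset_uIcc
  rw [← intervalIntegral.integral_add_adjacent_intervals (hii (t0 - δ) t0) (hii t0 (t0 + δ))]
  have a1 := hd3 (y := t0 + δ) (by rw [Real.dist_eq]; simp [abs_of_pos hδ0, hδ2])
  have a2 := hd3 (y := t0 - δ) (by rw [Real.dist_eq]; simp [abs_of_pos hδ0, hδ2])
  simp [abs_of_pos hδ0] at a1 a2
  rw [intervalIntegral.integral_symm] at a2
  have b1 := (abs_le.1 a1).2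
  have b2 := (abs_le.1 a2).1
  linarith

lemma Per.union {τ} {A B : Set (ℝ × ℝ)} (hB : MeasurableSet B) (hd : Disjoint A B)
    {a b : ℝ} (ha : Per τ A a) (hb : Per τ B b) : Per τ (A ∪ B) (a + b) := by
  intro f hf
  have hi := div2_integrable hf.smooth hf.cs
  rw [setIntegral_union hd hB hi.integrableOn hi.integrableOn]
  exact add_le_add (ha f hf) (hb f hf)

lemma cut_split_row {τ} (hτ : IsNorm2 τ) {F : Set (ℝ × ℝ)} (hF : MeasurableSet F) (hI : F ⊆ Isq) {t0 c : ℝ}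
    (ht : Thin (swp F) t0) (hp : Per τ F c) :
    ∃ c1 c2, c1 + c2 ≤ c ∧ Per τ (F ∩ {x | x.2 ≤ t0}) c1 ∧ Per τ (F \ {x | x.2 ≤ t0}) c2 := by
  obtain ⟨c1, c2, h, h1, h2⟩ := cut_split hτ.swap (swp_meas hF) (swp_sub hI) ht (hp.swp hF)
  refine ⟨c1, c2, h, ?_, ?_⟩
  · exact h1.swp ((swp_meas hF).inter (meas_left t0))
  · exact h2.swp ((swp_meas hF).diff (meas_left t0))

/-- corner rectangle -/
def Qc (t0 s0 : ℝ) (P : ℝ × ℝ) : Set (ℝ × ℝ) :=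
  {x | x ∈ Isq ∧ 0 ≤ P.1 * (x.1 - t0) ∧ 0 ≤ P.2 * (x.2 - s0)}

lemma Qc_closed (t0 s0 : ℝ) (P : ℝ × ℝ) : IsClosed (Qc t0 s0 P) := by
  refine isCompact_Isq.isClosed.inter (IsClosed.inter ?_ ?_)
  · exact isClosed_le continuous_const (by fun_prop : Continuous fun x : ℝ × ℝ => P.1 * (x.1 - t0))
  · exact isClosed_le continuous_const (by fun_prop : Continuous fun x : ℝ × ℝ => P.2 * (x.2 - s0))

/-- A corner. -/
def IsCrn (P : ℝ × ℝ) : Prop := (P.1 = 1 ∨ P.1 = -1) ∧ (P.2 = 1 ∨ P.2 = -1)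

lemma IsCrn.mem {P} (h : IsCrn P) : P ∈ Isq := by
  rw [mem_Isq]
  rcases h with ⟨h1 | h1, h2 | h2⟩ <;> rw [h1, h2] <;> simp

lemma zoom_sub {ρ μ t0 s0 : ℝ} (hρ : 0 < ρ) (hρ1 : ρ ≤ 1) (hρμ : 1 - μ / 2 ≤ ρ) (ht : |t0| < 1 - μ) (hs : |s0| < 1 - μ)
    {P} (hP : IsCrn P) {S : Set (ℝ × ℝ)} (hS : S ⊆ Qc t0 s0 P) :
    {x : ℝ × ℝ | ρ • x + (1 - ρ) • P ∈ S} ⊆ Isq := by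
  intro x hx
  obtain ⟨h1, h2, h3⟩ := hS hx
  rw [mem_Isq] at h1 ⊢
  have aux : ∀ σ t y : ℝ, (σ = 1 ∨ σ = -1) → |t| < 1 - μ → |ρ * y + (1 - ρ) * σ| ≤ 1 →
      0 ≤ σ * (ρ * y + (1 - ρ) * σ - t) → |y| ≤ 1 := by
    intro σ t y hσ ht h1 h2
    rw [abs_lt] at ht
    rw [abs_le] at h1 ⊢
    rcases hσ with rfl | rfl
    · constructor
      · by_contra hc; push Not at hc; nlinarith
      · by_contra hc; push Not at hc; nlinarith
    · constructor
      · by_contra hc; push Not at hc; nlinarith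
      · by_contra hc; push Not at hc; nlinarith
  exact ⟨aux _ _ _ hP.1 ht h1.1 h2, aux _ _ _ hP.2 hs h1.2 h3⟩

lemma shrink_U {ρ t0 s0 : ℝ} (hρ : 0 < ρ) (ht : |t0| < 1) (hs : |s0| < 1) {P} (hP : IsCrn P) :
    ∀ x ∈ Qc t0 s0 P, ρ • x + (1 - ρ) • P ∈ Usq → x ∈ Usq := by
  rintro x ⟨h1, h2, h3⟩ hU
  rw [mem_Isq] at h1
  have aux : ∀ σ t y : ℝ, (σ = 1 ∨ σ = -1) → |t| < 1 → |y| ≤ 1 → |ρ * y + (1 - ρ) * σ| < 1 →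
      0 ≤ σ * (y - t) → |y| < 1 := by
    intro σ t y hσ ht h0 h1 h2
    rw [abs_lt] at ht h1 ⊢
    rw [abs_le] at h0
    rcases hσ with rfl | rfl
    · constructor
      · linarith
      · by_contra hc; push Not at hc; nlinarith
    · constructor
      · by_contra hc; push Not at hc; nlinarith
      · linarith
  exact ⟨aux _ _ _ hP.1 ht h1.1 hU.1 h2, aux _ _ _ hP.2 hs h1.2 hU.2 h3⟩

lemma zoom_step {τ} {ρ μ t0 s0 : ℝ} (hρ : 0 < ρ) (hρ1 : ρ ≤ 1) (hρμ : 1 - μ / 2 ≤ ρ) (ht : |t0| < 1 - μ) (hs : |s0| < 1 - μ)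
    {P} (hP : IsCrn P) {S : Set (ℝ × ℝ)} (hSm : MeasurableSet S) (hS : S ⊆ Qc t0 s0 P) {c : ℝ} (hp : Per τ S c) :
    ∃ E, MeasurableSet E ∧ E ⊆ Isq ∧ volume.real E = (ρ ^ 2)⁻¹ * volume.real S ∧ Per τ E (ρ⁻¹ * c) :=
  ⟨_, affine_meas hSm ρ _, zoom_sub hρ hρ1 hρμ ht hs hP hS, vol_affine hρ _ hSm, zoom_per hρ hρ1 hP.mem hSm hp⟩

lemma shrink_step {τ} (hτ : IsNorm2 τ) {ρ t0 s0 : ℝ} (hρ : 0 < ρ) (hρ1 : ρ ≤ 1) (ht : |t0| < 1) (hs : |s0| < 1)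
    {P} (hP : IsCrn P) {S : Set (ℝ × ℝ)} (hSm : MeasurableSet S) (hS : S ⊆ Qc t0 s0 P) {c : ℝ} (hp : Per τ S c) :
    ∃ E, MeasurableSet E ∧ (∀ x ∈ E, ∃ y ∈ S, x = ρ • y + (1 - ρ) • P) ∧ E ⊆ Isq ∧
      volume.real E = ρ ^ 2 * volume.real S ∧ Per τ E (ρ * c) := by
  refine ⟨{x : ℝ × ℝ | ρ⁻¹ • x + -(ρ⁻¹ • (1 - ρ) • P) ∈ S}, affine_meas hSm _ _, ?_, ?_, ?_,
    shrink_per hτ hρ hSm hp (Qc_closed t0 s0 P) hS (shrink_U hρ ht hs hP)⟩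
  · intro x hx
    refine ⟨_, hx, ?_⟩
    rw [smul_add, smul_neg, smul_smul, smul_smul ρ, mul_inv_cancel₀ hρ.ne']; simp
  · intro x hx
    have e : x = ρ • (ρ⁻¹ • x + -(ρ⁻¹ • (1 - ρ) • P)) + (1 - ρ) • P := by
      rw [smul_add, smul_neg, smul_smul, smul_smul ρ, mul_inv_cancel₀ hρ.ne']; simp
    rw [e]
    have hc : Convex ℝ Isq := convex_Icc _ _
    exact hc (hS hx).1 hP.mem hρ.le (by linarith) (by ring)
  · rw [vol_affine (inv_pos.2 hρ) _ hSm]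
    simp

open MeasureTheory Set Filter ENNReal

lemma half_existsP {τ} (hτ : IsNorm2 τ) (m V : ℝ) (h0 : 0 ≤ V) (h4 : V ≤ 4) :
    ∃ E, MeasurableSet E ∧ E ⊆ Isq ∧ volume.real E = V ∧ Per τ E (2 * τ (1,m)) := by
  obtain ⟨E, h1, h2, h3, h5⟩ := half_exists hτ.swap m V h0 h4
  refine ⟨swp E, swp_meas h1, swp_sub h2, ?_, h5.swp h1⟩
  rw [Measure.real, swp_vol h1]; exact h3

set_option maxHeartbeats 1000000 in
/-- four pieces -/
lemma four {τ} (hτ : IsNorm2 τ) {F : Set (ℝ × ℝ)} (hF : MeasurableSet F) (hI : F ⊆ Isq) {t0 s0 c : ℝ}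
    (ht : Thin F t0) (hs : Thin (swp F) s0) (hp : Per τ F c) :
    ∃ (S : Fin 4 → Set (ℝ × ℝ)) (P : Fin 4 → ℝ × ℝ) (d : Fin 4 → ℝ),
      (∀ i, MeasurableSet (S i)) ∧ (∀ i, IsCrn (P i)) ∧ (∀ i, S i ⊆ Qc t0 s0 (P i)) ∧ (∀ i, Per τ (S i) (d i)) ∧
      (∑ i, d i ≤ c) ∧ (∑ i, volume.real (S i) = volume.real F) ∧
      (∀ ρ : ℝ, 0 < ρ → ρ ≤ 1 → ∀ i j, i ≠ j → ∀ y ∈ S i, ∀ z ∈ S j, ρ • y + (1 - ρ) • P i ≠ ρ • z + (1 - ρ) • P j) := by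
  obtain ⟨c1, c2, hc, h1, h2⟩ := cut_split hτ hF hI ht hp
  have hL := meas_left t0
  have hB : MeasurableSet {x : ℝ × ℝ | x.2 ≤ s0} := measurable_swap (meas_left s0)
  have hF1 := hF.inter hL
  have hF2 := hF.diff hL
  have hI1 : F ∩ {x | x.1 ≤ t0} ⊆ Isq := inter_subset_left.trans hI
  have hI2 : F \ {x | x.1 ≤ t0} ⊆ Isq := sdiff_subset.trans hI
  obtain ⟨d0, d1, hd, h3, h4⟩ := cut_split_row hτ hF1 hI1
    (hs.mono (preimage_mono inter_subset_left) (swp_sub hI)) h1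
  obtain ⟨d2, d3, hd', h5, h6⟩ := cut_split_row hτ hF2 hI2
    (hs.mono (preimage_mono sdiff_subset) (swp_sub hI)) h2
  refine ⟨![(F ∩ {x | x.1 ≤ t0}) ∩ {x | x.2 ≤ s0}, (F ∩ {x | x.1 ≤ t0}) \ {x | x.2 ≤ s0},
    (F \ {x | x.1 ≤ t0}) ∩ {x | x.2 ≤ s0}, (F \ {x | x.1 ≤ t0}) \ {x | x.2 ≤ s0}],
    ![(-1,-1), (-1,1), (1,-1), (1,1)], ![d0,d1,d2,d3], ?_, ?_, ?_, ?_, ?_, ?_, ?_⟩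
  · intro i; fin_cases i
    · exact hF1.inter hB
    · exact hF1.diff hB
    · exact hF2.inter hB
    · exact hF2.diff hB
  · intro i; fin_cases i <;> simp [IsCrn]
  · intro i; fin_cases i
    all_goals
      intro x hx
      simp at hx
      have hx0 : x ∈ Isq := hI (by tauto)
      refine ⟨hx0, ?_, ?_⟩ <;> simp <;> linarith
  · intro i; fin_cases i
    · exact h3
    · exact h4
    · exact h5
    · exact h6
  · simp [Fin.sum_univ_four]; linarith
  · simp only [Fin.sum_univ_four]
    have e1 := measureReal_inter_add_sdiff (μ := volume) (s := F) hL (vol_fin hI)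
    have e2 := measureReal_inter_add_sdiff (μ := volume) (s := F ∩ {x | x.1 ≤ t0}) hB (vol_fin hI1)
    have e3 := measureReal_inter_add_sdiff (μ := volume) (s := F \ {x | x.1 ≤ t0}) hB (vol_fin hI2)
    simp at e1 e2 e3 ⊢
    linarith
  · intro ρ h0 hρ1
    have key : ∀ σ σ' y z t : ℝ, |y| ≤ 1 → |z| ≤ 1 → y ≤ t → t < z →
        ρ * y + (1 - ρ) * (-1) ≠ ρ * z + (1 - ρ) * 1 := by
      intro σ σ' y z t h1 h2 h3 h4 h
      rw [abs_le] at h1 h2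
      nlinarith
    have kk : ∀ i, ∀ x ∈ (![(F ∩ {x | x.1 ≤ t0}) ∩ {x | x.2 ≤ s0}, (F ∩ {x | x.1 ≤ t0}) \ {x | x.2 ≤ s0},
      (F \ {x | x.1 ≤ t0}) ∩ {x | x.2 ≤ s0}, (F \ {x | x.1 ≤ t0}) \ {x | x.2 ≤ s0}] : Fin 4 → Set (ℝ × ℝ)) i,
      |x.1| ≤ 1 ∧ |x.2| ≤ 1 := by
      intro i x hx
      rw [← mem_Isq]
      apply hI
      fin_cases i <;> simp at hx <;> tauto
    intro i j hij y hy z hz h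
    have ky := kk i y hy
    have kz := kk j z hz
    have e1 := congrArg Prod.fst h
    have e2 := congrArg Prod.snd h
    clear h kk
    fin_cases i <;> fin_cases j <;> simp at hij hy hz e1 e2
    all_goals first
      | exact key 0 0 y.1 z.1 t0 ky.1 kz.1 hy.1.2 hz.1.2 (by linarith only [e1])
      | exact key 0 0 z.1 y.1 t0 kz.1 ky.1 hz.1.2 hy.1.2 (by linarith only [e1])
      | exact key 0 0 y.2 z.2 s0 ky.2 kz.2 hy.2 hz.2 (by linarith only [e2])
      | exact key 0 0 z.2 y.2 s0 kz.2 ky.2 hz.2 hy.2 (by linarith only [e2])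

set_option maxHeartbeats 1000000 in
lemma strict_step {τ} (hτ : IsNorm2 τ) {a a' : ℝ} (ha' : 0 < a') (haa : a' < a) (ha : a ≤ 3) :
    ∃ κ : ℝ, 0 ≤ κ ∧ κ < 1 ∧ ∀ R, MeasurableSet R → R ⊆ Isq → ∀ c, Per τ R c → 0 < volume.real R →
      volume.real R ≤ a' → ∃ E c', MeasurableSet E ∧ E ⊆ Isq ∧ 0 < volume.real E ∧ volume.real E < a ∧
        Per τ E c' ∧ c' * volume.real R ≤ κ * c * volume.real E := by
  obtain ⟨m, hq0, hq⟩ := exists_min hτ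
  obtain ⟨m', hp0, hp'⟩ := exists_min hτ.swap
  have hp : Adm τ (τ (1,m'), 0) := adm_swap hp'
  change 0 < τ (1,m') at hp0
  set q := τ (m,1) with hqd
  set p := τ (1,m') with hpd
  set a2 := (a + a') / 2 with ha2
  have h2 : 0 < a2 := by rw [ha2]; linarith
  set k := Real.sqrt (a' / a2) with hk
  have hk0 : 0 < k := Real.sqrt_pos.2 (by positivity)
  have hk2 : k ^ 2 = a' / a2 := Real.sq_sqrt (by positivity)
  have hk1 : k < 1 := by
    have : k ^ 2 < 1 := by rw [hk2, div_lt_one h2, ha2]; linarith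
    nlinarith
  have hka : a' = k ^ 2 * a2 := by rw [hk2]; field_simp
  set μ := (1 - k) / 2 with hμ
  set d := (a - a') / 16 with hd
  set ρ := max (1 - μ / 2) (1 - d) with hρ
  have hμ0 : 0 < μ := by rw [hμ]; linarith
  have hμ1 : μ < 1 := by rw [hμ]; linarith
  have hd0 : 0 < d := by rw [hd]; linarith
  have hd1 : d < 1 := by rw [hd]; linarith
  have hρ1 : ρ < 1 := max_lt (by linarith) (by linarith)
  have hρμ : 1 - μ / 2 ≤ ρ := le_max_left _ _
  have hρd : 1 - d ≤ ρ := le_max_right _ _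
  have hρ0 : 0 < ρ := by linarith
  have hρ2 : 1 - 4 * d < ρ ^ 2 := by nlinarith
  have hρs : ρ ^ 2 ≤ 1 := by nlinarith
  have hA1 : a' < ρ ^ 2 * a := by
    have : a * (1 - 4 * d) < a * ρ ^ 2 := mul_lt_mul_of_pos_left hρ2 (by linarith)
    have : a * d ≤ 3 * d := mul_le_mul_of_nonneg_right ha hd0.le
    linarith
  have hA2 : ∀ V, 0 ≤ V → V ≤ a' → 4 - ρ ^ 2 * (4 - V) < a := by
    intro V h0 h1
    have : ρ ^ 2 * V ≤ 1 * V := mul_le_mul_of_nonneg_right hρs h0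
    linarith
  clear_value ρ d μ k
  refine ⟨max k ρ, hk0.le.trans (le_max_left _ _), max_lt hk1 hρ1, ?_⟩
  intro R hR hI c hper hV0 hVa
  have hc0 := hper.nonneg hτ
  have case1 : ∀ b, 2 * k * b ≤ c → (∃ E, MeasurableSet E ∧ E ⊆ Isq ∧ volume.real E = a2 ∧ Per τ E (2 * b)) →
      ∃ E c', MeasurableSet E ∧ E ⊆ Isq ∧ 0 < volume.real E ∧ volume.real E < a ∧
        Per τ E c' ∧ c' * volume.real R ≤ max k ρ * c * volume.real E := by
    rintro b hb ⟨E, e1, e2, e3, e4⟩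
    refine ⟨E, 2 * b, e1, e2, by rw [e3]; exact h2, by rw [e3, ha2]; linarith, e4, ?_⟩
    have hb0 := e4.nonneg hτ
    rw [e3]
    calc 2 * b * volume.real R ≤ 2 * b * a' := by gcongr
      _ = k * (2 * k * b) * a2 := by rw [hka]; ring
      _ ≤ k * c * a2 := by gcongr
      _ ≤ max k ρ * c * a2 := by gcongr; exact le_max_left _ _
  by_cases hcq : 2 * k * q ≤ c
  · exact case1 q hcq (half_exists hτ m a2 h2.le (by rw [ha2]; linarith))
  by_cases hcp : 2 * k * p ≤ c
  · exact case1 p hcp (half_existsP hτ m' a2 h2.le (by rw [ha2]; linarith))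
  push Not at hcq hcp
  obtain ⟨F, hFE, hf1, hf2⟩ := cross hτ hR hI hper hq hp hq0 hp0 hμ0.le hμ1
    (by rw [hμ]; nlinarith) (by rw [hμ]; nlinarith)
  have hFm : MeasurableSet F := by
    rcases hFE with rfl | rfl
    · exact hR
    · exact measurableSet_Isq.diff hR
  have hFI : F ⊆ Isq := by
    rcases hFE with rfl | rfl
    · exact hI
    · exact sdiff_subset
  have hFp : Per τ F c := by
    rcases hFE with rfl | rfl
    · exact hper
    · exact hper.compl hτ hR
  obtain ⟨t0, ht1, ht2⟩ := thin_exists hFm hFI hf1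
  obtain ⟨s0, hs1, hs2⟩ := thin_exists (swp_meas hFm) (swp_sub hFI) hf2
  obtain ⟨S, P, e, hSm, hP, hSQ, hSp, hsum, hvol, hdis⟩ := four hτ hFm hFI ht2 hs2 hFp
  rcases hFE with rfl | hFE
  · have : ∃ i, 0 < volume.real (S i) ∧ e i * volume.real F ≤ c * volume.real (S i) := by
      by_contra hcon
      push Not at hcon
      have h1 : ∀ i, c * volume.real (S i) ≤ e i * volume.real F := by
        intro i
        rcases (measureReal_nonneg : 0 ≤ volume.real (S i)).eq_or_lt with h | h
        · rw [← h, mul_zero]; exact mul_nonneg ((hSp i).nonneg hτ) hV0.le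
        · exact (hcon i h).le
      obtain ⟨i, hi⟩ : ∃ i, 0 < volume.real (S i) := by
        by_contra hn
        push Not at hn
        have : ∑ i, volume.real (S i) ≤ 0 := Finset.sum_nonpos fun i _ => hn i
        linarith
      have h2 : ∑ i, c * volume.real (S i) < ∑ i, e i * volume.real F :=
        Finset.sum_lt_sum (fun i _ => h1 i) ⟨i, Finset.mem_univ _, hcon i hi⟩
      rw [← Finset.mul_sum, ← Finset.sum_mul, hvol] at h2
      exact absurd h2 (not_lt.2 (mul_le_mul_of_nonneg_right hsum hV0.le))
    obtain ⟨i, hi1, hi2⟩ := this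
    obtain ⟨E, e1, e2, e3, e4⟩ := zoom_step hρ0 hρ1.le hρμ ht1 hs1 (hP i) (hSm i) (hSQ i) (hSp i)
    have hle : volume.real (S i) ≤ volume.real F := by
      rw [← hvol]
      exact Finset.single_le_sum (f := fun i => volume.real (S i)) (fun i _ => measureReal_nonneg) (Finset.mem_univ i)
    refine ⟨E, _, e1, e2, by rw [e3]; positivity, ?_, e4, ?_⟩
    · rw [e3, inv_mul_lt_iff₀ (by positivity)]
      linarith
    · rw [e3]
      calc ρ⁻¹ * e i * volume.real F = ρ⁻¹ * (e i * volume.real F) := by ring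
        _ ≤ ρ⁻¹ * (c * volume.real (S i)) := by gcongr
        _ = ρ * c * ((ρ^2)⁻¹ * volume.real (S i)) := by field_simp
        _ ≤ _ := by gcongr; exact le_max_right _ _
  · choose W w1 w2 w3 w4 w5 using fun i => shrink_step hτ hρ0 hρ1.le (ht1.trans_le (by linarith))
      (hs1.trans_le (by linarith)) (hP i) (hSm i) (hSQ i) (hSp i)
    have hWd : ∀ i j, i ≠ j → Disjoint (W i) (W j) := by
      intro i j hij
      rw [Set.disjoint_left]
      intro x hx hx'
      obtain ⟨y, hy, rfl⟩ := w2 i x hx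
      obtain ⟨z, hz, hz'⟩ := w2 j _ hx'
      exact hdis ρ hρ0 hρ1.le i j hij y hy z hz hz'
    have hUp := ((((w5 0).union (w1 1) (hWd 0 1 (by decide)) (w5 1)).union (w1 2)
      (by rw [disjoint_union_left]; exact ⟨hWd 0 2 (by decide), hWd 1 2 (by decide)⟩) (w5 2)).union (w1 3)
      (by rw [disjoint_union_left, disjoint_union_left]; exact ⟨⟨hWd 0 3 (by decide), hWd 1 3 (by decide)⟩, hWd 2 3 (by decide)⟩) (w5 3))
    have hUv : volume.real (W 0 ∪ W 1 ∪ W 2 ∪ W 3) = ρ ^ 2 * (4 - volume.real R) := by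
      rw [measureReal_union (by rw [disjoint_union_left, disjoint_union_left]; exact ⟨⟨hWd 0 3 (by decide), hWd 1 3 (by decide)⟩, hWd 2 3 (by decide)⟩) (w1 3)
          (vol_fin (union_subset (union_subset (w3 0) (w3 1)) (w3 2))) (vol_fin (w3 3)),
        measureReal_union (by rw [disjoint_union_left]; exact ⟨hWd 0 2 (by decide), hWd 1 2 (by decide)⟩) (w1 2)
          (vol_fin (union_subset (w3 0) (w3 1))) (vol_fin (w3 2)),
        measureReal_union (hWd 0 1 (by decide)) (w1 1) (vol_fin (w3 0)) (vol_fin (w3 1)), w4, w4, w4, w4,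
        ← vol_compl hR hI, ← hFE, ← hvol, Fin.sum_univ_four]
      ring
    have hUI : W 0 ∪ W 1 ∪ W 2 ∪ W 3 ⊆ Isq := union_subset (union_subset (union_subset (w3 0) (w3 1)) (w3 2)) (w3 3)
    have hUm : MeasurableSet (W 0 ∪ W 1 ∪ W 2 ∪ W 3) := (((w1 0).union (w1 1)).union (w1 2)).union (w1 3)
    have hUp' : Per τ (W 0 ∪ W 1 ∪ W 2 ∪ W 3) (ρ * c) := by
      refine hUp.mono ?_
      rw [Fin.sum_univ_four] at hsum
      nlinarith
    have hEv := vol_compl hUm hUI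
    rw [hUv] at hEv
    have hge : volume.real R ≤ 4 - ρ ^ 2 * (4 - volume.real R) := by nlinarith
    refine ⟨Isq \ (W 0 ∪ W 1 ∪ W 2 ∪ W 3), ρ * c, measurableSet_Isq.diff hUm, sdiff_subset, ?_, ?_, hUp'.compl hτ hUm, ?_⟩
    · rw [hEv]; linarith
    · rw [hEv]
      exact hA2 _ hV0.le hVa
    · rw [hEv]
      calc ρ * c * volume.real R ≤ ρ * c * (4 - ρ ^ 2 * (4 - volume.real R)) := by gcongr
        _ ≤ _ := by gcongr; (· linarith); exact le_max_right _ _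

open MeasureTheory Set Filter ENNReal

/-- unit circle -/
noncomputable def ecirc (t : ℝ) : ℝ × ℝ := (Real.cos (t * (2 * Real.pi)), Real.sin (t * (2 * Real.pi)))

lemma ecirc_ne (t : ℝ) : ecirc t ≠ 0 := by
  intro h
  have h1 := congrArg Prod.fst h
  have h2 := congrArg Prod.snd h
  simp only [ecirc, Prod.fst_zero, Prod.snd_zero] at h1 h2
  have := Real.sin_sq_add_cos_sq (t * (2 * Real.pi))
  rw [h1, h2] at this; norm_num at this

lemma ecirc_per (t : ℝ) : ecirc (t + 1) = ecirc t := by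
  simp [ecirc, add_mul]

lemma ecirc_norm (t : ℝ) : ‖ecirc t‖ ≤ 1 := by
  rw [Prod.norm_def]
  exact max_le (Real.abs_cos_le_one _) (Real.abs_sin_le_one _)

lemma ecirc_lip (t s : ℝ) : ‖ecirc t - ecirc s‖ ≤ 2 * Real.pi * |t - s| := by
  have e : |t * (2 * Real.pi) - s * (2 * Real.pi)| = 2 * Real.pi * |t - s| := by
    rw [← sub_mul, abs_mul, abs_of_pos Real.two_pi_pos, mul_comm]
  rw [Prod.norm_def, ← e]
  exact max_le (Real.abs_cos_sub_cos_le _ _) (Real.abs_sin_sub_sin_le _ _)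

lemma ecirc_cont : Continuous ecirc := by
  unfold ecirc; fun_prop

lemma ecirc_inj {t s a b : ℝ} (ht : t ∈ Ico (0:ℝ) 1) (hs : s ∈ Ico (0:ℝ) 1) (ha : 0 < a) (hb : 0 < b)
    (h : a • ecirc t = b • ecirc s) : t = s := by
  have h1 := congrArg Prod.fst h
  have h2 := congrArg Prod.snd h
  simp only [ecirc, Prod.smul_mk, smul_eq_mul] at h1 h2
  have e1 := Real.sin_sq_add_cos_sq (t * (2 * Real.pi))
  have e2 := Real.sin_sq_add_cos_sq (s * (2 * Real.pi))
  have hab : a ^ 2 = b ^ 2 := by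
    linear_combination (a * Real.cos (t * (2 * Real.pi)) + b * Real.cos (s * (2 * Real.pi))) * h1
      + (a * Real.sin (t * (2 * Real.pi)) + b * Real.sin (s * (2 * Real.pi))) * h2
      - a ^ 2 * e1 + b ^ 2 * e2
  have hab' : a = b := by nlinarith
  subst hab'
  have h1' := mul_left_cancel₀ ha.ne' h1
  have h2' := mul_left_cancel₀ ha.ne' h2
  have h3 : Real.cos ((t - s) * (2 * Real.pi)) = 1 := by
    rw [sub_mul, Real.cos_sub, h1', h2']; linarith
  obtain ⟨n, hn⟩ := (Real.cos_eq_one_iff _).1 h3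
  have hn' : (n : ℝ) = t - s := mul_right_cancel₀ Real.two_pi_pos.ne' hn
  have : |(n : ℝ)| < 1 := by
    rw [hn', abs_lt]; constructor <;> linarith [ht.1, ht.2, hs.1, hs.2]
  have h0 : n = 0 := by
    rw [← Int.cast_abs] at this
    exact Int.abs_lt_one_iff.1 (by exact_mod_cast this)
  rw [h0] at hn'; simp at hn'; linarith

lemma ecirc_surj (y : ℝ × ℝ) (hy : y ≠ 0) : ∃ t ∈ Ico (0:ℝ) 1, ∃ a : ℝ, 0 < a ∧ y = a • ecirc t := by
  set w : ℂ := ⟨y.1, y.2⟩ with hw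
  have hw0 : w ≠ 0 := by
    intro h
    apply hy
    exact Prod.ext (congrArg Complex.re h) (congrArg Complex.im h)
  refine ⟨Int.fract (w.arg / (2 * Real.pi)), ⟨Int.fract_nonneg _, Int.fract_lt_one _⟩, ‖w‖, norm_pos_iff.2 hw0, ?_⟩
  have e : Int.fract (w.arg / (2 * Real.pi)) * (2 * Real.pi) = w.arg - ⌊w.arg / (2 * Real.pi)⌋ * (2 * Real.pi) := by
    rw [Int.fract, sub_mul, div_mul_cancel₀ _ Real.two_pi_pos.ne']
  unfold ecirc
  rw [e, Real.cos_sub_int_mul_two_pi, Real.sin_sub_int_mul_two_pi]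
  apply Prod.ext
  · exact (Complex.norm_mul_cos_arg w).symm
  · exact (Complex.norm_mul_sin_arg w).symm

lemma eNorm2_le (v : ℝ × ℝ) : eNorm2 v ≤ 2 * ‖v‖ := by
  unfold eNorm2
  rw [Real.sqrt_le_left (by positivity)]
  have h1 : |v.1| ≤ ‖v‖ := norm_fst_le v
  have h2 : |v.2| ≤ ‖v‖ := norm_snd_le v
  rw [← sq_abs v.1, ← sq_abs v.2]
  have := abs_nonneg v.1
  have := abs_nonneg v.2
  nlinarith

lemma varLength_lip {γ : ℝ → ℝ × ℝ} {L : ℝ} (hL : ∀ t s, ‖γ t - γ s‖ ≤ L * |t - s|) :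
    varLength eNorm2 γ ≠ ⊤ := by
  apply ne_top_of_le_ne_top (b := ENNReal.ofReal (2 * L)) ENNReal.ofReal_ne_top
  unfold varLength
  refine iSup_le fun n => iSup_le fun t => iSup_le fun ht => ENNReal.ofReal_le_ofReal ?_
  calc ∑ i : Fin n, eNorm2 (γ (t i.succ) - γ (t i.castSucc))
      ≤ ∑ i : Fin n, 2 * L * (t i.succ - t i.castSucc) := by
        refine Finset.sum_le_sum fun i _ => ?_
        have h0 : 0 ≤ t i.succ - t i.castSucc := sub_nonneg.2 (ht.1 (Fin.castSucc_lt_succ).le)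
        have := hL (t i.succ) (t i.castSucc)
        rw [abs_of_nonneg h0] at this
        linarith [eNorm2_le (γ (t i.succ) - γ (t i.castSucc))]
    _ = 2 * L := by
        rw [← Finset.mul_sum]
        have : ∑ i : Fin n, (t i.succ - t i.castSucc) = t (Fin.last n) - t 0 := by
          rw [Finset.sum_sub_distrib]
          have e1 := Fin.sum_univ_succ t
          have e2 := Fin.sum_univ_castSucc t
          linarith
        rw [this, ht.2.1, ht.2.2]; ring

lemma jordan_convex {K : Set (ℝ × ℝ)} (hc : Convex ℝ K) (hk : IsCompact K) (hi : (interior K).Nonempty) :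
    IsRectJordanCurve (frontier K) := by
  obtain ⟨z, hz⟩ := hi
  set K0 : Set (ℝ × ℝ) := (Homeomorph.addLeft z) ⁻¹' K with hK0
  have hc0 : Convex ℝ K0 := hc.affine_preimage ((AffineEquiv.constVAdd ℝ (ℝ × ℝ) z).toAffineMap)
  have hk0 : IsCompact K0 := (Homeomorph.addLeft z).isCompact_preimage.2 hk
  have hn : K0 ∈ nhds (0 : ℝ × ℝ) := by
    have : interior K ∈ nhds ((Homeomorph.addLeft z) 0) := isOpen_interior.mem_nhds (by simpa using hz)
    exact mem_of_superset ((Homeomorph.addLeft z).continuous.continuousAt.preimage_mem_nhds this) (preimage_mono interior_subset)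
  have hfr : ∀ x, x ∈ frontier K0 ↔ z + x ∈ frontier K := by
    intro x
    rw [hK0, ← Homeomorph.preimage_frontier]; rfl
  have hgp : ∀ x, x ≠ 0 → 0 < gauge K0 x := fun x hx =>
    (gauge_pos (absorbent_nhds_zero hn) ((NormedSpace.isVonNBounded_iff ℝ).2 hk0.isBounded)).2 hx
  have hgc := continuous_gauge hc0 hn
  obtain ⟨L0, hL0⟩ := hc0.lipschitz_gauge hn
  have hgl : ∀ x y, |gauge K0 x - gauge K0 y| ≤ L0 * ‖x - y‖ := fun x y => by
    have := hL0.dist_le_mul x y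
    rwa [Real.dist_eq, dist_eq_norm] at this
  have hp : ∀ t, 0 < gauge K0 (ecirc t) := fun t => hgp _ (ecirc_ne t)
  obtain ⟨m, hm0, hm⟩ : ∃ m > 0, ∀ t, m ≤ gauge K0 (ecirc t) := by
    obtain ⟨t0, _, ht0⟩ := isCompact_Icc.exists_isMinOn (⟨0, by simp⟩ : (Icc (0:ℝ) 1).Nonempty)
      (hgc.comp ecirc_cont).continuousOn
    refine ⟨_, hp t0, fun t => ?_⟩
    obtain ⟨s, hs, a, ha, he⟩ := ecirc_surj (ecirc t) (ecirc_ne t)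
    have hper : ∀ n : ℤ, ecirc (t - n) = ecirc t := by
      intro n
      simp [ecirc, sub_mul, Real.cos_sub_int_mul_two_pi, Real.sin_sub_int_mul_two_pi]
    rw [← hper ⌊t⌋]
    exact ht0 ⟨Int.fract_nonneg t, (Int.fract_lt_one t).le⟩
  refine ⟨fun t => z + (gauge K0 (ecirc t))⁻¹ • ecirc t, ?_, ?_, ?_, ?_, ?_⟩
  · exact continuous_const.add (((hgc.comp ecirc_cont).inv₀ fun t => (hp t).ne').smul ecirc_cont)
  · intro t; simp only [ecirc_per]
  · intro t ht s hs h
    exact ecirc_inj ht hs (inv_pos.2 (hp t)) (inv_pos.2 (hp s)) (add_left_cancel h)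
  · ext x
    constructor
    · intro hx
      have hx' : gauge K0 (x - z) = 1 := (gauge_eq_one_iff_mem_frontier hc0 hn).2 ((hfr _).2 (by simpa using hx))
      have hne : x - z ≠ 0 := by
        intro h; rw [h, gauge_zero] at hx'; norm_num at hx'
      obtain ⟨t, ht, a, ha, he⟩ := ecirc_surj _ hne
      refine ⟨t, ⟨ht.1, ht.2.le⟩, ?_⟩
      rw [he, gauge_smul_of_nonneg ha.le, smul_eq_mul] at hx'
      have : (gauge K0 (ecirc t))⁻¹ = a := inv_eq_of_mul_eq_one_left hx'
      simp only [this]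
      rw [← he]; simp
    · rintro ⟨t, ht, rfl⟩
      refine (hfr _).1 ((gauge_eq_one_iff_mem_frontier hc0 hn).1 ?_)
      rw [gauge_smul_of_nonneg (inv_pos.2 (hp t)).le, smul_eq_mul, inv_mul_cancel₀ (hp t).ne']
  · apply varLength_lip (L := m⁻¹ * (2 * Real.pi) + m⁻¹ * m⁻¹ * (L0 * (2 * Real.pi)))
    intro t s
    have e : (z + (gauge K0 (ecirc t))⁻¹ • ecirc t) - (z + (gauge K0 (ecirc s))⁻¹ • ecirc s) =
        (gauge K0 (ecirc t))⁻¹ • (ecirc t - ecirc s) +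
        ((gauge K0 (ecirc t))⁻¹ * (gauge K0 (ecirc s))⁻¹ * (gauge K0 (ecirc s) - gauge K0 (ecirc t))) • ecirc s := by
      have h1 := (hp t).ne'
      have h2 := (hp s).ne'
      have : (gauge K0 (ecirc t))⁻¹ * (gauge K0 (ecirc s))⁻¹ * (gauge K0 (ecirc s) - gauge K0 (ecirc t)) =
        (gauge K0 (ecirc t))⁻¹ - (gauge K0 (ecirc s))⁻¹ := by field_simp
      rw [this, smul_sub, sub_smul]; abel
    rw [e]
    have i1 : (gauge K0 (ecirc t))⁻¹ ≤ m⁻¹ := inv_anti₀ hm0 (hm t)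
    have i2 : (gauge K0 (ecirc s))⁻¹ ≤ m⁻¹ := inv_anti₀ hm0 (hm s)
    have j1 := (inv_pos.2 (hp t)).le
    have j2 := (inv_pos.2 (hp s)).le
    refine (norm_add_le _ _).trans ?_
    rw [norm_smul, norm_smul, Real.norm_eq_abs, Real.norm_eq_abs, abs_of_nonneg j1, abs_mul, abs_of_nonneg (mul_nonneg j1 j2), add_mul]
    have hl := ecirc_lip t s
    have k2 : |gauge K0 (ecirc s) - gauge K0 (ecirc t)| ≤ L0 * (2 * Real.pi * |t - s|) := by
      rw [abs_sub_comm]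
      exact (hgl _ _).trans (by gcongr)
    have mp : 0 ≤ m⁻¹ := (inv_pos.2 hm0).le
    apply add_le_add
    · calc _ ≤ m⁻¹ * (2 * Real.pi * |t - s|) := by gcongr
        _ = _ := by ring
    · calc _ ≤ (m⁻¹ * m⁻¹ * (L0 * (2 * Real.pi * |t - s|))) * 1 := by
            gcongr
            exact ecirc_norm s
        _ = _ := by ring

open MeasureTheory Set Filter ENNReal

/-- affine function on the plane -/
def Aff (l : ℝ × ℝ → ℝ) : Prop := ∃ α β δ : ℝ, ∀ x, l x = α * x.1 + β * x.2 + δ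

lemma Aff.cont {l} (h : Aff l) : Continuous l := by
  obtain ⟨α, β, δ, h⟩ := h
  have : l = fun x => α * x.1 + β * x.2 + δ := funext h
  rw [this]; fun_prop

lemma Aff.comb {l} (h : Aff l) (t : ℝ) (x y : ℝ × ℝ) : l (x + t • (y - x)) = (1 - t) * l x + t * l y := by
  obtain ⟨α, β, δ, h⟩ := h
  simp only [h, Prod.fst_add, Prod.snd_add, Prod.smul_fst, Prod.smul_snd, Prod.fst_sub, Prod.snd_sub, smul_eq_mul]
  ring

lemma Aff.lin {l l'} (h : Aff l) (h' : Aff l') (a b c : ℝ) : Aff (fun x => a * l x + b * l' x + c) := by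
  obtain ⟨α, β, δ, h⟩ := h
  obtain ⟨α', β', δ', h'⟩ := h'
  exact ⟨a * α + b * α', a * β + b * β', a * δ + b * δ' + c, fun x => by simp only [h, h']; ring⟩

lemma Aff.convex {l} (h : Aff l) : Convex ℝ {x | 0 ≤ l x} := by
  intro x hx y hy a b ha hb hab
  have e : a • x + b • y = x + b • (y - x) := by
    have : a = 1 - b := by linarith
    rw [this, sub_smul, smul_sub, one_smul]; abel
  simp only [mem_ofPred_eq] at hx hy ⊢
  rw [e, h.comb]
  have : 0 ≤ 1 - b := by linarith
  positivity

lemma line_tendsto (x y : ℝ × ℝ) : Tendsto (fun n : ℕ => x + (1 / ((n : ℝ) + 1)) • (y - x)) atTop (nhds x) := by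
  have h := tendsto_one_div_add_atTop_nhds_zero_nat (𝕜 := ℝ)
  have := (h.smul_const (y - x)).const_add x
  simpa using this

/-- barycentric coordinates -/
structure Bary (l0 l1 l2 : ℝ × ℝ → ℝ) : Prop where
  a0 : Aff l0
  a1 : Aff l1
  a2 : Aff l2
  sum : ∀ x, l0 x + l1 x + l2 x = 1
  surj : ∀ u v w : ℝ, u + v + w = 1 → ∃ x, l0 x = u ∧ l1 x = v ∧ l2 x = w
  inj : ∀ x y, l0 x = l0 y → l1 x = l1 y → l2 x = l2 y → x = y

/-- closed triangle -/
def TriC (l0 l1 l2 : ℝ × ℝ → ℝ) : Set (ℝ × ℝ) := {x | 0 ≤ l0 x ∧ 0 ≤ l1 x ∧ 0 ≤ l2 x}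

/-- open triangle -/
def TriO (l0 l1 l2 : ℝ × ℝ → ℝ) : Set (ℝ × ℝ) := {x | 0 < l0 x ∧ 0 < l1 x ∧ 0 < l2 x}

/-- conclusion -/
def GoodK (l0 l1 l2 : ℝ × ℝ → ℝ) (s0 s1 s2 : ℝ) (K : Set (ℝ × ℝ)) : Prop :=
  Convex ℝ K ∧ IsClosed K ∧ (interior K).Nonempty ∧ K ⊆ TriC l0 l1 l2 ∧
    (∃ F : Set (ℝ × ℝ), F.Finite ∧ K ⊆ TriO l0 l1 l2 ∪ F) ∧
    (∀ x ∈ TriC l0 l1 l2, s0 * l0 x + s1 * l1 x + s2 * l2 x = 0 → x ∈ frontier K) ∧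
    (∀ x ∈ K, x ∈ closure {y | y ∈ TriC l0 l1 l2 ∧ s0 * l0 y + s1 * l1 y + s2 * l2 y < 0})

lemma GoodK.rot {l0 l1 l2 : ℝ × ℝ → ℝ} {s0 s1 s2 : ℝ} {K : Set (ℝ × ℝ)} (h : GoodK l1 l2 l0 s1 s2 s0 K) :
    GoodK l0 l1 l2 s0 s1 s2 K := by
  have e1 : TriC l1 l2 l0 = TriC l0 l1 l2 := by ext x; simp only [TriC, mem_ofPred_eq]; tauto
  have e2 : TriO l1 l2 l0 = TriO l0 l1 l2 := by ext x; simp only [TriO, mem_ofPred_eq]; tauto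
  have e3 : ∀ x, s1 * l1 x + s2 * l2 x + s0 * l0 x = s0 * l0 x + s1 * l1 x + s2 * l2 x := fun x => by ring
  unfold GoodK at h ⊢
  rw [e1, e2] at h
  simp only [e3] at h
  exact h

lemma Bary.rot {l0 l1 l2} (h : Bary l0 l1 l2) : Bary l1 l2 l0 where
  a0 := h.a1
  a1 := h.a2
  a2 := h.a0
  sum x := by linarith [h.sum x]
  surj u v w e := by
    obtain ⟨x, h1, h2, h3⟩ := h.surj w u v (by linarith)
    exact ⟨x, h2, h3, h1⟩
  inj x y h1 h2 h3 := h.inj x y h3 h1 h2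

lemma apex {l0 l1 l2} (h : Bary l0 l1 l2) {s0 s1 s2 : ℝ} (h1 : s0 * s1 < 0) (h2 : s0 * s2 < 0) :
    ∃ K, GoodK l0 l1 l2 s0 s1 s2 K := by
  have hs0 : s0 ≠ 0 := by rintro rfl; simp at h1
  -- crossing parameters
  obtain ⟨p, hp0, hp1, hp⟩ : ∃ p : ℝ, 0 < p ∧ p < 1 ∧ s1 = s0 * (1 - 1 / p) := by
    have hd : s0 - s1 ≠ 0 := by intro h; have : s0 = s1 := by linarith
                                rw [← this] at h1; nlinarith [sq_nonneg s0]
    have hh : 0 < s0 * (s0 - s1) := by nlinarith [sq_nonneg s0]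
    refine ⟨s0 / (s0 - s1), ?_, ?_, by field_simp; ring⟩
    · rw [div_eq_mul_inv, show s0 * (s0 - s1)⁻¹ = (s0 * (s0 - s1)) * ((s0 - s1)⁻¹ * (s0 - s1)⁻¹) by field_simp]
      exact mul_pos hh (mul_self_pos.2 (inv_ne_zero hd))
    · have : 1 - s0 / (s0 - s1) = (-(s0 * s1)) * ((s0 * (s0 - s1))⁻¹) := by field_simp; ring
      have : 0 < 1 - s0 / (s0 - s1) := by rw [this]; exact mul_pos (by linarith) (inv_pos.2 hh)
      linarith
  obtain ⟨q, hq0, hq1, hq⟩ : ∃ q : ℝ, 0 < q ∧ q < 1 ∧ s2 = s0 * (1 - 1 / q) := by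
    have hd : s0 - s2 ≠ 0 := by intro h; have : s0 = s2 := by linarith
                                rw [← this] at h2; nlinarith [sq_nonneg s0]
    have hh : 0 < s0 * (s0 - s2) := by nlinarith [sq_nonneg s0]
    refine ⟨s0 / (s0 - s2), ?_, ?_, by field_simp; ring⟩
    · rw [div_eq_mul_inv, show s0 * (s0 - s2)⁻¹ = (s0 * (s0 - s2)) * ((s0 - s2)⁻¹ * (s0 - s2)⁻¹) by field_simp]
      exact mul_pos hh (mul_self_pos.2 (inv_ne_zero hd))
    · have : 1 - s0 / (s0 - s2) = (-(s0 * s2)) * ((s0 * (s0 - s2))⁻¹) := by field_simp; ring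
      have : 0 < 1 - s0 / (s0 - s2) := by rw [this]; exact mul_pos (by linarith) (inv_pos.2 hh)
      linarith
  obtain ⟨a, b, ha, hb, hab, hs⟩ : ∃ a b : ℝ, 0 < a ∧ 0 < b ∧ p * a + q * b < 1 ∧ s0 * (1 - a - b) < 0 := by
    rcases lt_or_gt_of_ne hs0 with hn | hn
    · refine ⟨1/4, 1/4, by norm_num, by norm_num, by linarith, by nlinarith⟩
    · have ip : 1 < 1 / p := by rw [lt_div_iff₀ hp0]; linarith
      have iq : 1 < 1 / q := by rw [lt_div_iff₀ hq0]; linarith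
      refine ⟨1/4 + 1/4 * (1/p), 1/4 + 1/4*(1/q), by positivity, by positivity, ?_, ?_⟩
      · have : p * (1/4 + 1/4 * (1/p)) + q * (1/4 + 1/4 * (1/q)) = p / 4 + q / 4 + 1/2 := by field_simp; ring
        rw [this]; linarith
      · nlinarith
  set k := 1 - a - b with hk
  have hk0 : k ≠ 0 := by rintro h; rw [h] at hs; simp at hs
  -- coordinates
  obtain ⟨g, hg⟩ : ∃ g : ℝ × ℝ → ℝ, ∀ x, g x = (1 - l1 x / p - l2 x / q) / k := ⟨_, fun _ => rfl⟩
  obtain ⟨A, hA⟩ : ∃ A : ℝ × ℝ → ℝ, ∀ x, A x = l1 x / p - a * g x := ⟨_, fun _ => rfl⟩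
  obtain ⟨B, hB⟩ : ∃ B : ℝ × ℝ → ℝ, ∀ x, B x = l2 x / q - b * g x := ⟨_, fun _ => rfl⟩
  have hgk : ∀ x, k * g x = 1 - l1 x / p - l2 x / q := fun x => by rw [hg]; field_simp
  have affg : Aff g := by
    have := h.a1.lin h.a2 (-(1 / (p * k))) (-(1 / (q * k))) (1 / k)
    convert this using 1; funext x; rw [hg]; field_simp; ring
  have affA : Aff A := by
    have := h.a1.lin affg (1 / p) (-a) 0
    convert this using 1; funext x; rw [hA]; field_simp; ring
  have affB : Aff B := by
    have := h.a2.lin affg (1 / q) (-b) 0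
    convert this using 1; funext x; rw [hB]; field_simp; ring
  have hsum : ∀ x, A x + B x + g x = 1 := by
    intro x
    rw [hA, hB]
    have := hgk x
    rw [hk] at this
    linarith
  have e1 : ∀ x, l1 x = p * (A x + a * g x) := by intro x; rw [hA]; field_simp; ring
  have e2 : ∀ x, l2 x = q * (B x + b * g x) := by intro x; rw [hB]; field_simp; ring
  have e0 : ∀ x, l0 x = A x * (1 - p) + B x * (1 - q) + g x * (1 - p * a - q * b) := by
    intro x
    have i1 := h.sum x
    rw [e1, e2] at i1
    linear_combination i1 - hsum x
  have es : ∀ x, s0 * l0 x + s1 * l1 x + s2 * l2 x = (s0 * k) * g x := by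
    intro x
    rw [mul_assoc, hgk, hp, hq]
    have : l0 x = 1 - l1 x - l2 x := by linarith [h.sum x]
    rw [this]; field_simp; ring
  have surj : ∀ u v w : ℝ, u + v + w = 1 → ∃ x, A x = u ∧ B x = v ∧ g x = w := by
    intro u v w huvw
    obtain ⟨x, x0, x1, x2⟩ := h.surj (1 - p * (u + a * w) - q * (v + b * w)) (p * (u + a * w)) (q * (v + b * w)) (by ring)
    have hgx : g x = w := by
      rw [hg, x1, x2, mul_div_cancel_left₀ _ hp0.ne', mul_div_cancel_left₀ _ hq0.ne', div_eq_iff hk0, hk]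
      linear_combination - huvw
    refine ⟨x, ?_, ?_, hgx⟩
    · rw [hA, hgx, x1, mul_div_cancel_left₀ _ hp0.ne']; ring
    · rw [hB, hgx, x2, mul_div_cancel_left₀ _ hq0.ne']; ring
  have inj : ∀ x y, A x = A y → B x = B y → g x = g y → x = y := by
    intro x y i1 i2 i3
    apply h.inj
    · rw [e0, e0, i1, i2, i3]
    · rw [e1, e1, i1, i3]
    · rw [e2, e2, i2, i3]
  refine ⟨{x | 0 ≤ A x} ∩ ({x | 0 ≤ B x} ∩ {x | 0 ≤ g x}), ?_, ?_, ?_, ?_, ?_, ?_, ?_⟩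
  · exact affA.convex.inter (affB.convex.inter affg.convex)
  · exact (isClosed_le continuous_const affA.cont).inter ((isClosed_le continuous_const affB.cont).inter (isClosed_le continuous_const affg.cont))
  · obtain ⟨x, x0, x1, x2⟩ := surj (1/3) (1/3) (1/3) (by norm_num)
    refine ⟨x, mem_interior.2 ⟨{x | 0 < A x} ∩ ({x | 0 < B x} ∩ {x | 0 < g x}), ?_, ?_, ?_⟩⟩
    · rintro y ⟨y1, y2, y3⟩
      simp only [mem_ofPred_eq] at y1 y2 y3
      exact ⟨y1.le, y2.le, y3.le⟩
    · exact (isOpen_lt continuous_const affA.cont).inter ((isOpen_lt continuous_const affB.cont).inter (isOpen_lt continuous_const affg.cont))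
    · simp only [mem_inter_iff, mem_ofPred_eq, x0, x1, x2]; norm_num
  · rintro x ⟨y1, y2, y3⟩
    simp only [mem_ofPred_eq] at y1 y2 y3
    have c1 : 0 < 1 - p := by linarith
    have c2 : 0 < 1 - q := by linarith
    have c3 : 0 < 1 - p * a - q * b := by linarith
    refine ⟨?_, ?_, ?_⟩
    · rw [e0]; positivity
    · rw [e1]; positivity
    · rw [e2]; positivity
  · obtain ⟨z, z0, z1, z2⟩ := surj 1 0 0 (by norm_num)
    obtain ⟨z', z0', z1', z2'⟩ := surj 0 1 0 (by norm_num)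
    refine ⟨{z, z'}, by simp, ?_⟩
    rintro x ⟨y1, y2, y3⟩
    simp only [mem_ofPred_eq] at y1 y2 y3
    have c1 : 0 < 1 - p := by linarith
    have c2 : 0 < 1 - q := by linarith
    have c3 : 0 < 1 - p * a - q * b := by linarith
    have hx := hsum x
    by_cases i1 : A x = 1
    · right; left
      exact inj _ _ (by linarith) (by linarith) (by linarith)
    by_cases i2 : B x = 1
    · right; right
      exact inj _ _ (by linarith) (by linarith) (by linarith)
    left
    have hA1 : A x < 1 := lt_of_le_of_ne (by linarith) i1
    have hB1 : B x < 1 := lt_of_le_of_ne (by linarith) i2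
    refine ⟨?_, ?_, ?_⟩
    · rw [e0]
      rcases y1.eq_or_lt with j1 | j1
      · rcases y2.eq_or_lt with j2 | j2
        · have : g x = 1 := by linarith
          rw [← j1, ← j2, this]; linarith
        · positivity
      · positivity
    · rw [e1]
      rcases y1.eq_or_lt with j1 | j1
      · have : 0 < g x := by linarith
        positivity
      · positivity
    · rw [e2]
      rcases y2.eq_or_lt with j1 | j1
      · have : 0 < g x := by linarith
        positivity
      · positivity
  · rintro x ⟨t0, t1, t2⟩ hx
    rw [es] at hx
    have hgx : g x = 0 := by
      rcases mul_eq_zero.1 hx with h | h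
      · exact absurd h hs.ne
      · exact h
    refine ⟨subset_closure ⟨?_, ?_, ?_⟩, ?_⟩
    · simp only [mem_ofPred_eq]; rw [hA, hgx]; simp; positivity
    · simp only [mem_ofPred_eq]; rw [hB, hgx]; simp; positivity
    · simp only [mem_ofPred_eq]; rw [hgx]
    · intro hin
      obtain ⟨y, y0, y1, y2⟩ := surj 1 1 (-1) (by norm_num)
      have := (line_tendsto x y).eventually (mem_interior_iff_mem_nhds.1 hin)
      obtain ⟨n, hn⟩ := this.exists
      have h3 := hn.2.2
      simp only [mem_ofPred_eq] at h3
      rw [affg.comb, hgx, y2] at h3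
      have : (0:ℝ) < 1 / ((n : ℝ) + 1) := by positivity
      linarith
  · rintro x ⟨y1, y2, y3⟩
    simp only [mem_ofPred_eq] at y1 y2 y3
    obtain ⟨y, z0, z1, z2⟩ := surj 0 0 1 (by norm_num)
    refine mem_closure_of_tendsto (line_tendsto x y) (Eventually.of_forall fun n => ?_)
    have ht : (0:ℝ) < 1 / ((n : ℝ) + 1) := by positivity
    have ht1 : 1 / ((n : ℝ) + 1) ≤ 1 := by
      rw [div_le_one (by positivity)]; have : (0:ℝ) ≤ n := by positivity
      linarith
    generalize 1 / ((n : ℝ) + 1) = t at ht ht1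
    have ht2 : 0 ≤ 1 - t := by linarith
    have m1 : 0 ≤ A (x + t • (y - x)) := by rw [affA.comb, z0]; simp; positivity
    have m2 : 0 ≤ B (x + t • (y - x)) := by rw [affB.comb, z1]; simp; positivity
    have m3 : 0 < g (x + t • (y - x)) := by rw [affg.comb, z2]; simp; positivity
    have c1 : 0 < 1 - p := by linarith
    have c2 : 0 < 1 - q := by linarith
    have c3 : 0 < 1 - p * a - q * b := by linarith
    refine ⟨⟨?_, ?_, ?_⟩, ?_⟩
    · rw [e0]; positivity
    · rw [e1]; positivity
    · rw [e2]; positivity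
    · rw [es]; exact mul_neg_of_neg_of_pos hs m3

lemma tri_all {l0 l1 l2} (h : Bary l0 l1 l2) {s0 s1 s2 : ℝ} (h0 : s0 ≠ 0) (h1 : s1 ≠ 0) (h2 : s2 ≠ 0) :
    (∀ x ∈ TriC l0 l1 l2, s0 * l0 x + s1 * l1 x + s2 * l2 x ≠ 0) ∨ ∃ K, GoodK l0 l1 l2 s0 s1 s2 K := by
  by_cases c01 : s0 * s1 < 0
  · right
    by_cases c02 : s0 * s2 < 0
    · exact apex h c01 c02
    · have c12 : s1 * s2 < 0 := by
        have : 0 < s0 * s2 := lt_of_le_of_ne (not_lt.1 c02) (by positivity)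
        have : (s0 * s1) * (s0 * s2) < 0 := mul_neg_of_neg_of_pos c01 this
        have : (s0 ^ 2) * (s1 * s2) < 0 := by linarith
        by_contra hc; push Not at hc; nlinarith [sq_nonneg s0, mul_nonneg (sq_nonneg s0) hc]
      obtain ⟨K, hK⟩ := apex h.rot c12 (by linarith : s1 * s0 < 0)
      exact ⟨K, hK.rot⟩
  · have p01 : 0 < s0 * s1 := lt_of_le_of_ne (not_lt.1 c01) (by positivity)
    by_cases c02 : s0 * s2 < 0
    · right
      have c12 : s2 * s1 < 0 := by
        have : (s0 * s1) * (s0 * s2) < 0 := mul_neg_of_pos_of_neg p01 c02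
        have : (s0 ^ 2) * (s2 * s1) < 0 := by linarith
        by_contra hc; push Not at hc; nlinarith [sq_nonneg s0, mul_nonneg (sq_nonneg s0) hc]
      obtain ⟨K, hK⟩ := apex h.rot.rot (by linarith : s2 * s0 < 0) c12
      exact ⟨K, hK.rot.rot⟩
    · left
      have p02 : 0 < s0 * s2 := lt_of_le_of_ne (not_lt.1 c02) (by positivity)
      rintro x ⟨x0, x1, x2⟩ hx
      have hs := h.sum x
      have hh : s0 * s0 * l0 x + (s0 * s1) * l1 x + (s0 * s2) * l2 x = 0 := by linear_combination s0 * hx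
      have p00 : 0 < s0 * s0 := mul_self_pos.2 h0
      have q0 : 0 ≤ s0 * s0 * l0 x := by positivity
      have q1 : 0 ≤ s0 * s1 * l1 x := by positivity
      have q2 : 0 ≤ s0 * s2 * l2 x := by positivity
      have r0 : l0 x = 0 := by
        have : s0 * s0 * l0 x = 0 := by linarith
        exact (mul_eq_zero.1 this).resolve_left p00.ne'
      have r1 : l1 x = 0 := by
        have : s0 * s1 * l1 x = 0 := by linarith
        exact (mul_eq_zero.1 this).resolve_left p01.ne'
      have r2 : l2 x = 0 := by
        have : s0 * s2 * l2 x = 0 := by linarith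
        exact (mul_eq_zero.1 this).resolve_left p02.ne'
      linarith

open MeasureTheory Set Filter ENNReal

lemma convex_Isq : Convex ℝ Isq := convex_Icc _ _

lemma Usq_sub_int : Usq ⊆ interior Isq := interior_maximal Usq_subset_Isq isOpen_Usq

lemma memR_grid {ι : Type*} [Fintype ι] (l0 l1 l2 : ι → ℝ × ℝ → ℝ) (hb : ∀ i, Bary (l0 i) (l1 i) (l2 i))
    (hT : ∀ i, TriC (l0 i) (l1 i) (l2 i) ⊆ Isq) (hO : ∀ i, TriO (l0 i) (l1 i) (l2 i) ⊆ Usq)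
    (hcov : ∀ x ∈ Isq, ∃ i, x ∈ TriC (l0 i) (l1 i) (l2 i))
    (hdis : ∀ i j, i ≠ j → Disjoint (TriO (l0 i) (l1 i) (l2 i)) (TriC (l0 j) (l1 j) (l2 j)))
    {s : ℝ × ℝ → ℝ} (hs : Continuous s) (S0 S1 S2 : ι → ℝ)
    (hS : ∀ i, ∀ x ∈ TriC (l0 i) (l1 i) (l2 i), s x = S0 i * l0 i x + S1 i * l1 i x + S2 i * l2 i x)
    (n0 : ∀ i, S0 i ≠ 0) (n1 : ∀ i, S1 i ≠ 0) (n2 : ∀ i, S2 i ≠ 0) (hpos : ∃ x ∈ Usq, 0 < s x) :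
    ∃ R, MemR R ∧ {x | x ∈ Isq ∧ 0 ≤ s x} ⊆ R ∧ volume (R \ {x | x ∈ Isq ∧ 0 ≤ s x}) = 0 := by
  classical
  have hall := fun i => tri_all (hb i) (n0 i) (n1 i) (n2 i)
  -- mixed triangles
  set M : Finset ι := Finset.univ.filter fun i => ∃ K, GoodK (l0 i) (l1 i) (l2 i) (S0 i) (S1 i) (S2 i) K with hM
  obtain ⟨K, hK⟩ : ∃ K : ι → Set (ℝ × ℝ), ∀ i ∈ M, GoodK (l0 i) (l1 i) (l2 i) (S0 i) (S1 i) (S2 i) (K i) := by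
    have : ∀ i, ∃ K, i ∈ M → GoodK (l0 i) (l1 i) (l2 i) (S0 i) (S1 i) (S2 i) K := by
      intro i
      by_cases h : i ∈ M
      · obtain ⟨K, hK⟩ := (Finset.mem_filter.1 h).2
        exact ⟨K, fun _ => hK⟩
      · exact ⟨∅, fun h' => absurd h' h⟩
    choose K hK using this
    exact ⟨K, hK⟩
  have hKI : ∀ i ∈ M, K i ⊆ Isq := fun i hi => (hK i hi).2.2.2.1.trans (hT i)
  set Fc : Finset (Set (ℝ × ℝ)) := insert (frontier Isq) (M.image fun i => frontier (K i)) with hFc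
  set Z : Set (ℝ × ℝ) := ⋃ C ∈ Fc, C with hZ
  have hcl : ∀ C ∈ Fc, IsClosed C := by
    intro C hC
    rcases Finset.mem_insert.1 hC with rfl | hC
    · exact isClosed_frontier
    · obtain ⟨i, _, rfl⟩ := Finset.mem_image.1 hC
      exact isClosed_frontier
  have hZc : IsClosed Z := Fc.finite_toSet.isClosed_biUnion hcl
  have hZ0 : volume Z = 0 := by
    refine (measure_biUnion_null_iff Fc.countable_toSet).2 fun C hC => ?_
    rcases Finset.mem_insert.1 hC with rfl | hC
    · exact convex_Isq.addHaar_frontier _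
    · obtain ⟨i, hi, rfl⟩ := Finset.mem_image.1 hC
      exact (hK i hi).1.addHaar_frontier _
  have hZI : Z ⊆ Isq := by
    refine iUnion₂_subset fun C hC => ?_
    rcases Finset.mem_insert.1 hC with rfl | hC
    · exact isCompact_Isq.isClosed.frontier_subset
    · obtain ⟨i, hi, rfl⟩ := Finset.mem_image.1 hC
      exact (hK i hi).2.1.frontier_subset.trans (hKI i hi)
  set P : Set (ℝ × ℝ) := {x | x ∈ Isq ∧ 0 ≤ s x} with hP
  have hPc : IsClosed P := isCompact_Isq.isClosed.inter (isClosed_le continuous_const hs)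
  have hRI : P ∪ Z ⊆ Isq := union_subset (fun x hx => hx.1) hZI
  have hRc : IsClosed (P ∪ Z) := hPc.union hZc
  refine ⟨P ∪ Z, ⟨isCompact_Isq.of_isClosed_subset hRc hRI, hRI, ?_, Fc, ?_, ?_, ?_⟩, subset_union_left, ?_⟩
  · obtain ⟨x, hx, hsx⟩ := hpos
    refine ⟨x, mem_interior.2 ⟨Usq ∩ {x | 0 < s x}, ?_, isOpen_Usq.inter (isOpen_lt continuous_const hs), hx, hsx⟩⟩
    rintro y ⟨y1, y2⟩
    exact Or.inl ⟨Usq_subset_Isq y1, le_of_lt (by simpa using y2)⟩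
  · intro C hC
    rcases Finset.mem_insert.1 hC with rfl | hC
    · obtain ⟨x, hx, _⟩ := hpos
      exact jordan_convex convex_Isq isCompact_Isq ⟨x, Usq_sub_int hx⟩
    · obtain ⟨i, hi, rfl⟩ := Finset.mem_image.1 hC
      exact jordan_convex (hK i hi).1 (isCompact_Isq.of_isClosed_subset (hK i hi).2.1 (hKI i hi)) (hK i hi).2.2.1
  · rw [hRc.frontier_eq]
    apply Subset.antisymm
    · rintro x ⟨hx, hni⟩
      by_contra hxZ
      have hxP : x ∈ P := hx.resolve_right hxZ
      have hxi : x ∈ interior Isq := by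
        by_contra hc
        exact hxZ (mem_biUnion (Finset.mem_insert_self _ _) (by rw [isCompact_Isq.isClosed.frontier_eq]; exact ⟨hxP.1, hc⟩))
      have hsx : 0 < s x := by
        refine lt_of_le_of_ne hxP.2 fun h0 => ?_
        obtain ⟨i, hi⟩ := hcov x hxP.1
        have h0' := (hS i x hi).symm.trans h0.symm
        rcases hall i with h | h
        · exact h x hi h0'
        · have hiM : i ∈ M := Finset.mem_filter.2 ⟨Finset.mem_univ _, h⟩
          exact hxZ (mem_biUnion (Finset.mem_insert_of_mem (Finset.mem_image_of_mem _ hiM))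
            ((hK i hiM).2.2.2.2.2.1 x hi h0'))
      apply hni
      refine mem_interior.2 ⟨interior Isq ∩ {x | 0 < s x}, ?_, isOpen_interior.inter (isOpen_lt continuous_const hs), hxi, hsx⟩
      rintro y ⟨y1, y2⟩
      exact Or.inl ⟨interior_subset y1, le_of_lt (by simpa using y2)⟩
    · intro x hx
      refine ⟨Or.inr hx, fun hin => ?_⟩
      obtain ⟨C, hC, hxC⟩ := mem_iUnion₂.1 hx
      rcases Finset.mem_insert.1 hC with rfl | hC
      · exact hxC.2 (interior_mono hRI hin)
      · obtain ⟨i, hi, rfl⟩ := Finset.mem_image.1 hC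
        have hxK := (hK i hi).2.1.frontier_subset hxC
        obtain ⟨y, hy1, hy2, hy3⟩ := mem_closure_iff.1 ((hK i hi).2.2.2.2.2.2 x hxK) _ isOpen_interior hin
        rw [← hS i y hy2] at hy3
        have hopen : IsOpen (interior (P ∪ Z) ∩ {x | s x < 0}) := isOpen_interior.inter (isOpen_lt hs continuous_const)
        have hpos := hopen.measure_pos volume ⟨y, hy1, hy3⟩
        refine hpos.ne' (measure_mono_null ?_ hZ0)
        rintro w ⟨w1, w2⟩
        refine (interior_subset w1).resolve_left fun hw => ?_
        have := hw.2
        simp only [mem_ofPred_eq] at w2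
        linarith
  · have fin0 : ∀ A : Set (ℝ × ℝ), A.Finite → (Measure.hausdorffMeasure 1 : Measure (ℝ × ℝ)) A = 0 := by
      intro A hA
      haveI := Measure.nullSingletonClass_hausdorff (ℝ × ℝ) (d := 1) one_pos
      exact hA.measure_zero _
    have key : ∀ i ∈ M, ∀ Y : Set (ℝ × ℝ), Disjoint (TriO (l0 i) (l1 i) (l2 i)) Y → (frontier (K i) ∩ Y).Finite := by
      intro i hi Y hY
      obtain ⟨F, hF, hKF⟩ := (hK i hi).2.2.2.2.1
      refine hF.subset ?_
      rintro x ⟨x1, x2⟩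
      refine (hKF ((hK i hi).2.1.frontier_subset x1)).resolve_left fun h => ?_
      exact Set.disjoint_left.1 hY h x2
    have dI : ∀ i, Disjoint (TriO (l0 i) (l1 i) (l2 i)) (frontier Isq) := by
      intro i
      refine Set.disjoint_left.2 fun x hx hx' => hx'.2 (Usq_sub_int (hO i hx))
    intro C hC C' hC' hne
    apply fin0
    rcases Finset.mem_insert.1 hC with rfl | hC
    · rcases Finset.mem_insert.1 hC' with rfl | hC'
      · exact absurd rfl hne
      · obtain ⟨j, hj, rfl⟩ := Finset.mem_image.1 hC'
        rw [inter_comm]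
        exact key j hj _ (dI j)
    · obtain ⟨i, hi, rfl⟩ := Finset.mem_image.1 hC
      rcases Finset.mem_insert.1 hC' with rfl | hC'
      · exact key i hi _ (dI i)
      · obtain ⟨j, hj, rfl⟩ := Finset.mem_image.1 hC'
        have hij : i ≠ j := by rintro rfl; exact hne rfl
        refine (key i hi _ (hdis i j hij)).subset (inter_subset_inter_right _ ?_)
        exact (hK j hj).2.1.frontier_subset.trans (hK j hj).2.2.2.1
  · exact measure_mono_null (fun x hx => hx.1.resolve_left hx.2) hZ0

open MeasureTheory Set Filter ENNReal

/-- hat function -/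
noncomputable def hat (x y : ℝ) : ℝ := max 0 (1 - max (max |x| |y|) |x - y|)

lemma hat_symm (x y : ℝ) : hat x y = hat y x := by
  unfold hat; rw [max_comm |x|, abs_sub_comm]

lemma hat_zero {x y : ℝ} (h : 1 ≤ |x| ∨ 1 ≤ |y| ∨ 1 ≤ |x - y|) : hat x y = 0 := by
  unfold hat
  apply max_eq_left
  rcases h with h | h | h
  · linarith [le_max_left |x| |y|, le_max_left (max |x| |y|) |x - y|]
  · linarith [le_max_right |x| |y|, le_max_left (max |x| |y|) |x - y|]
  · linarith [le_max_right (max |x| |y|) |x - y|]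

lemma hat_00 {a b : ℝ} (h0 : 0 ≤ b) (h1 : b ≤ a) (h2 : a ≤ 1) : hat a b = 1 - a := by
  unfold hat
  rw [abs_of_nonneg h0, abs_of_nonneg (h0.trans h1), abs_of_nonneg (by linarith : 0 ≤ a - b), max_eq_left h1,
    max_eq_left (a := a) (b := a - b) (by linarith), max_eq_right (by linarith)]

lemma hat_10 {a b : ℝ} (h0 : 0 ≤ b) (h1 : b ≤ a) (h2 : a ≤ 1) : hat (a - 1) b = a - b := by
  unfold hat
  rw [abs_of_nonneg h0, abs_of_nonpos (by linarith : a - 1 ≤ 0), abs_of_nonpos (by linarith : a - 1 - b ≤ 0),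
    max_eq_right (a := max (-(a - 1)) b) (max_le (by linarith) (by linarith)), max_eq_right (by linarith)]
  ring

lemma hat_11 {a b : ℝ} (h0 : 0 ≤ b) (h1 : b ≤ a) (h2 : a ≤ 1) : hat (a - 1) (b - 1) = b := by
  unfold hat
  rw [abs_of_nonpos (by linarith : b - 1 ≤ 0), abs_of_nonpos (by linarith : a - 1 ≤ 0), abs_of_nonneg (by linarith : 0 ≤ a - 1 - (b - 1)),
    max_eq_right (by linarith : -(a - 1) ≤ -(b - 1)), max_eq_left (a := -(b - 1)) (b := a - 1 - (b - 1)) (by linarith), max_eq_right (by linarith)]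
  ring

lemma hat_other {a b : ℝ} (h0 : 0 ≤ b) (h1 : b ≤ a) (h2 : a ≤ 1) (k l : ℤ)
    (h00 : ¬ (k = 0 ∧ l = 0)) (h10 : ¬ (k = 1 ∧ l = 0)) (h11 : ¬ (k = 1 ∧ l = 1)) : hat (a - k) (b - l) = 0 := by
  have far : ∀ t : ℝ, 0 ≤ t → t ≤ 1 → ∀ m : ℤ, m ≠ 0 → m ≠ 1 → 1 ≤ |t - m| := by
    intro t t0 t1 m m0 m1
    rcases (by omega : m ≤ -1 ∨ 2 ≤ m) with h | h
    · have : (m : ℝ) ≤ -1 := by exact_mod_cast h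
      rw [le_abs]; left; linarith
    · have : (2 : ℝ) ≤ m := by exact_mod_cast h
      rw [le_abs]; right; linarith
  apply hat_zero
  by_cases hk : k ≠ 0 ∧ k ≠ 1
  · exact Or.inl (far a (h0.trans h1) h2 k hk.1 hk.2)
  by_cases hl : l ≠ 0 ∧ l ≠ 1
  · exact Or.inr (Or.inl (far b h0 (h1.trans h2) l hl.1 hl.2))
  have : k = 0 ∧ l = 1 := by omega
  right; right
  rw [this.1, this.2, le_abs]; left; push_cast; linarith

/-- sum of hats -/
noncomputable def hsum (n : ℕ) (V : ℕ → ℕ → ℝ) (X Y : ℝ) : ℝ :=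
  ∑ p ∈ Finset.range (n + 1) ×ˢ Finset.range (n + 1), V p.1 p.2 * hat (X - p.1) (Y - p.2)

lemma hsum_lower {n : ℕ} (V : ℕ → ℕ → ℝ) {i j : ℕ} (hi : i < n) (hj : j < n) {a b : ℝ} (h0 : 0 ≤ b) (h1 : b ≤ a) (h2 : a ≤ 1) :
    hsum n V (i + a) (j + b) = V i j * (1 - a) + V (i+1) j * (a - b) + V (i+1) (j+1) * b := by
  unfold hsum
  have hsub : ({(i, j), (i+1, j), (i+1, j+1)} : Finset (ℕ × ℕ)) ⊆ Finset.range (n + 1) ×ˢ Finset.range (n + 1) := by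
    intro p hp
    simp only [Finset.mem_insert, Finset.mem_singleton] at hp
    rw [Finset.mem_product, Finset.mem_range, Finset.mem_range]
    rcases hp with rfl | rfl | rfl <;> constructor <;> simp <;> omega
  rw [← Finset.sum_subset hsub]
  · rw [Finset.sum_insert (by simp), Finset.sum_insert (by simp), Finset.sum_singleton]
    push_cast
    rw [show (i : ℝ) + a - i = a by ring, show (j : ℝ) + b - j = b by ring, show (i : ℝ) + a - (i + 1) = a - 1 by ring,
      show (j : ℝ) + b - (j + 1) = b - 1 by ring, hat_00 h0 h1 h2, hat_10 h0 h1 h2, hat_11 h0 h1 h2]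
    ring
  · rintro ⟨k, l⟩ _ hp
    simp only [Finset.mem_insert, Finset.mem_singleton, Prod.mk.injEq] at hp
    have := hat_other h0 h1 h2 ((k : ℤ) - i) ((l : ℤ) - j) (by omega) (by omega) (by omega)
    push_cast at this
    simp only
    rw [show (i : ℝ) + a - k = a - (k - i) by ring, show (j : ℝ) + b - l = b - (l - j) by ring, this, mul_zero]

lemma hsum_symm (n : ℕ) (V : ℕ → ℕ → ℝ) (X Y : ℝ) : hsum n V X Y = hsum n (fun i j => V j i) Y X := by
  unfold hsum
  rw [Finset.sum_product, Finset.sum_product_right]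
  refine Finset.sum_congr rfl fun i _ => Finset.sum_congr rfl fun j _ => ?_
  rw [hat_symm]

lemma hsum_upper {n : ℕ} (V : ℕ → ℕ → ℝ) {i j : ℕ} (hi : i < n) (hj : j < n) {a b : ℝ} (h0 : 0 ≤ a) (h1 : a ≤ b) (h2 : b ≤ 1) :
    hsum n V (i + a) (j + b) = V i j * (1 - b) + V i (j+1) * (b - a) + V (i+1) (j+1) * a := by
  rw [hsum_symm, hsum_lower (fun i j => V j i) hj hi h0 h1 h2]

/-- Lipschitz for some constant -/
def ExL (f : ℝ × ℝ → ℝ) : Prop := ∃ L, LipschitzWith L f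

lemma ExL.add {f g} (hf : ExL f) (hg : ExL g) : ExL (fun x => f x + g x) := by
  obtain ⟨L, hL⟩ := hf
  obtain ⟨L', hL'⟩ := hg
  exact ⟨_, hL.add hL'⟩

lemma ExL.mul {f} (hf : ExL f) (c : ℝ) : ExL (fun x => c * f x) := by
  obtain ⟨L, hL⟩ := hf
  exact ⟨_, (lipschitzWith_smul c).comp hL⟩

lemma ExL.max {f g} (hf : ExL f) (hg : ExL g) : ExL (fun x => max (f x) (g x)) := by
  obtain ⟨L, hL⟩ := hf
  obtain ⟨L', hL'⟩ := hg
  exact ⟨_, hL.max hL'⟩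

lemma ExL.const (c : ℝ) : ExL (fun _ => c) := ⟨0, LipschitzWith.const c⟩

lemma ExL.abs {f} (hf : ExL f) : ExL (fun x => |f x|) := by
  have : (fun x => |f x|) = fun x => Max.max (f x) ((-1) * f x) := by
    funext x; rw [abs_eq_max_neg]; simp
  rw [this]
  exact hf.max (hf.mul _)

lemma ExL.hat {f g} (hf : ExL f) (hg : ExL g) : ExL (fun x => hat (f x) (g x)) := by
  have e : (fun x => _root_.hat (f x) (g x)) = fun x => Max.max 0 (1 + (-1) * (Max.max (Max.max |f x| |g x|) |f x + (-1) * g x|)) := by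
    funext x; unfold _root_.hat; simp [sub_eq_add_neg]
  rw [e]
  exact (ExL.const 0).max ((ExL.const 1).add (((hf.abs.max hg.abs).max (hf.add (hg.mul _)).abs).mul _))

/-- scaled coordinate -/
noncomputable def gc (n : ℕ) (t : ℝ) : ℝ := (t + 1) * (n / 2)

/-- piecewise linear interpolant -/
noncomputable def pl (n : ℕ) (V : ℕ → ℕ → ℝ) (x : ℝ × ℝ) : ℝ := hsum n V (gc n x.1) (gc n x.2)

lemma pl_lip (n : ℕ) (V : ℕ → ℕ → ℝ) : ExL (pl n V) := by
  have h1 : ∀ c, ExL (fun x : ℝ × ℝ => gc n x.1 - c) := by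
    intro c
    have h : ExL (fun x : ℝ × ℝ => x.1) := ⟨1, LipschitzWith.prod_fst⟩
    convert (h.mul (n / 2)).add (ExL.const (n / 2 - c)) using 1
    funext x; unfold gc; ring
  have h2 : ∀ c, ExL (fun x : ℝ × ℝ => gc n x.2 - c) := by
    intro c
    have h : ExL (fun x : ℝ × ℝ => x.2) := ⟨1, LipschitzWith.prod_snd⟩
    convert (h.mul (n / 2)).add (ExL.const (n / 2 - c)) using 1
    funext x; unfold gc; ring
  have : pl n V = ∑ p ∈ Finset.range (n + 1) ×ˢ Finset.range (n + 1), fun x : ℝ × ℝ => V p.1 p.2 * hat (gc n x.1 - p.1) (gc n x.2 - p.2) := by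
    funext x; unfold pl hsum; rw [Finset.sum_apply]
  rw [this]
  refine Finset.sum_induction _ ExL (fun f g hf hg => hf.add hg) (ExL.const 0) fun p _ => ?_
  exact ((h1 _).hat (h2 _)).mul _

lemma pl_cont (n : ℕ) (V : ℕ → ℕ → ℝ) : Continuous (pl n V) := (pl_lip n V).choose_spec.continuous

open MeasureTheory Set Filter ENNReal

/-- barycentric coordinates on the grid -/
noncomputable def gl0 (n : ℕ) (p : Fin n × Fin n × Bool) (x : ℝ × ℝ) : ℝ :=
  cond p.2.2 (1 - (gc n x.1 - (p.1 : ℕ))) (1 - (gc n x.2 - (p.2.1 : ℕ)))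
/-- barycentric coordinates on the grid -/
noncomputable def gl1 (n : ℕ) (p : Fin n × Fin n × Bool) (x : ℝ × ℝ) : ℝ :=
  cond p.2.2 ((gc n x.1 - (p.1 : ℕ)) - (gc n x.2 - (p.2.1 : ℕ))) ((gc n x.2 - (p.2.1 : ℕ)) - (gc n x.1 - (p.1 : ℕ)))
/-- barycentric coordinates on the grid -/
noncomputable def gl2 (n : ℕ) (p : Fin n × Fin n × Bool) (x : ℝ × ℝ) : ℝ :=
  cond p.2.2 (gc n x.2 - (p.2.1 : ℕ)) (gc n x.1 - (p.1 : ℕ))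

lemma gc_le {n : ℕ} (hn : 0 < n) {t : ℝ} (h0 : 0 ≤ gc n t) (h1 : gc n t ≤ n) : |t| ≤ 1 := by
  have hn' : (0 : ℝ) < n := by exact_mod_cast hn
  unfold gc at h0 h1
  rw [abs_le]
  constructor
  · by_contra h
    push Not at h
    nlinarith
  · by_contra h
    push Not at h
    nlinarith

lemma gc_lt {n : ℕ} (hn : 0 < n) {t : ℝ} (h0 : 0 < gc n t) (h1 : gc n t < n) : |t| < 1 := by
  have hn' : (0 : ℝ) < n := by exact_mod_cast hn
  unfold gc at h0 h1
  rw [abs_lt]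
  constructor
  · by_contra h
    push Not at h
    nlinarith
  · by_contra h
    push Not at h
    nlinarith

lemma gc_inv {n : ℕ} (hn : 0 < n) (c : ℝ) : gc n (c * (2 / n) - 1) = c := by
  have hn' : (n : ℝ) ≠ 0 := by exact_mod_cast hn.ne'
  unfold gc; field_simp; ring

lemma gc_inj {n : ℕ} (hn : 0 < n) {s t : ℝ} (h : gc n s = gc n t) : s = t := by
  have hn' : (0 : ℝ) < n := by exact_mod_cast hn
  unfold gc at h
  have := mul_right_cancel₀ (by positivity) h
  linarith

lemma grid_bary {n : ℕ} (hn : 0 < n) (p : Fin n × Fin n × Bool) : Bary (gl0 n p) (gl1 n p) (gl2 n p) := by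
  obtain ⟨i, j, b⟩ := p
  cases b
  · refine ⟨⟨0, -(n / 2), 1 - n / 2 + (j : ℕ), fun x => by simp [gl0, gc]; ring⟩,
      ⟨-(n / 2), n / 2, (i : ℕ) - (j : ℕ), fun x => by simp [gl1, gc]; ring⟩,
      ⟨n / 2, 0, n / 2 - (i : ℕ), fun x => by simp [gl2, gc]; ring⟩, fun x => by simp [gl0, gl1, gl2], ?_, ?_⟩
    · intro u v w h
      refine ⟨(((i : ℕ) + w) * (2 / n) - 1, ((j : ℕ) + v + w) * (2 / n) - 1), ?_, ?_, ?_⟩ <;>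
      simp only [gl0, gl1, gl2, gc_inv hn, cond_false] <;> linarith
    · intro x y h0 h1 h2
      simp only [gl0, gl1, gl2, cond_false] at h0 h1 h2
      exact Prod.ext (gc_inj hn (by linarith)) (gc_inj hn (by linarith))
  · refine ⟨⟨-(n / 2), 0, 1 - n / 2 + (i : ℕ), fun x => by simp [gl0, gc]; ring⟩,
      ⟨(n / 2), -(n / 2), (j : ℕ) - (i : ℕ), fun x => by simp [gl1, gc]; ring⟩,
      ⟨0, n / 2, n / 2 - (j : ℕ), fun x => by simp [gl2, gc]; ring⟩, fun x => by simp [gl0, gl1, gl2], ?_, ?_⟩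
    · intro u v w h
      refine ⟨(((i : ℕ) + v + w) * (2 / n) - 1, ((j : ℕ) + w) * (2 / n) - 1), ?_, ?_, ?_⟩ <;>
      simp only [gl0, gl1, gl2, gc_inv hn, cond_true] <;> linarith
    · intro x y h0 h1 h2
      simp only [gl0, gl1, gl2, cond_true] at h0 h1 h2
      exact Prod.ext (gc_inj hn (by linarith)) (gc_inj hn (by linarith))

lemma grid_box {n : ℕ} {p : Fin n × Fin n × Bool} {x : ℝ × ℝ} (hx : x ∈ TriC (gl0 n p) (gl1 n p) (gl2 n p)) :
    ((p.1 : ℕ) : ℝ) ≤ gc n x.1 ∧ gc n x.1 ≤ (p.1 : ℕ) + 1 ∧ ((p.2.1 : ℕ) : ℝ) ≤ gc n x.2 ∧ gc n x.2 ≤ (p.2.1 : ℕ) + 1 := by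
  obtain ⟨i, j, b⟩ := p
  obtain ⟨h0, h1, h2⟩ := hx
  cases b <;> simp only [gl0, gl1, gl2, cond_false, cond_true] at h0 h1 h2 <;>
    exact ⟨by dsimp; linarith, by dsimp; linarith, by dsimp; linarith, by dsimp; linarith⟩

lemma grid_boxO {n : ℕ} {p : Fin n × Fin n × Bool} {x : ℝ × ℝ} (hx : x ∈ TriO (gl0 n p) (gl1 n p) (gl2 n p)) :
    ((p.1 : ℕ) : ℝ) < gc n x.1 ∧ gc n x.1 < (p.1 : ℕ) + 1 ∧ ((p.2.1 : ℕ) : ℝ) < gc n x.2 ∧ gc n x.2 < (p.2.1 : ℕ) + 1 := by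
  obtain ⟨i, j, b⟩ := p
  obtain ⟨h0, h1, h2⟩ := hx
  cases b <;> simp only [gl0, gl1, gl2, cond_false, cond_true] at h0 h1 h2 <;>
    exact ⟨by dsimp; linarith, by dsimp; linarith, by dsimp; linarith, by dsimp; linarith⟩

lemma fin_cast_succ {n : ℕ} (i : Fin n) : ((i : ℕ) : ℝ) + 1 ≤ n := by
  exact_mod_cast i.2

lemma grid_T {n : ℕ} (hn : 0 < n) (p : Fin n × Fin n × Bool) : TriC (gl0 n p) (gl1 n p) (gl2 n p) ⊆ Isq := by
  intro x hx
  obtain ⟨h0, h1, h2, h3⟩ := grid_box hx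
  rw [mem_Isq]
  have := fin_cast_succ p.1
  have := fin_cast_succ p.2.1
  exact ⟨gc_le hn (le_trans (Nat.cast_nonneg _) h0) (by linarith), gc_le hn (le_trans (Nat.cast_nonneg _) h2) (by linarith)⟩

lemma grid_O {n : ℕ} (hn : 0 < n) (p : Fin n × Fin n × Bool) : TriO (gl0 n p) (gl1 n p) (gl2 n p) ⊆ Usq := by
  intro x hx
  obtain ⟨h0, h1, h2, h3⟩ := grid_boxO hx
  have := fin_cast_succ p.1
  have := fin_cast_succ p.2.1
  exact ⟨gc_lt hn (lt_of_le_of_lt (Nat.cast_nonneg _) h0) (by linarith), gc_lt hn (lt_of_le_of_lt (Nat.cast_nonneg _) h2) (by linarith)⟩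

lemma cell_exists {n : ℕ} (hn : 0 < n) {t : ℝ} (ht : |t| ≤ 1) : ∃ i : Fin n, ((i : ℕ) : ℝ) ≤ gc n t ∧ gc n t ≤ (i : ℕ) + 1 := by
  have hn' : (0 : ℝ) < n := by exact_mod_cast hn
  rw [abs_le] at ht
  have h0 : 0 ≤ gc n t := by unfold gc; apply mul_nonneg <;> [linarith; positivity]
  have h1 : gc n t ≤ n := by unfold gc; nlinarith
  by_cases h : ⌊gc n t⌋₊ < n
  · exact ⟨⟨_, h⟩, Nat.floor_le h0, (Nat.lt_floor_add_one _).le⟩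
  · push Not at h
    have : (n : ℝ) ≤ gc n t := (Nat.cast_le.2 h).trans (Nat.floor_le h0)
    have h2 : ((n - 1 : ℕ) : ℝ) = n - 1 := by rw [Nat.cast_sub (by omega)]; simp
    exact ⟨⟨n - 1, by omega⟩, by simp only [h2]; linarith, by simp only [h2]; linarith⟩

lemma grid_cov {n : ℕ} (hn : 0 < n) {x : ℝ × ℝ} (hx : x ∈ Isq) : ∃ p, x ∈ TriC (gl0 n p) (gl1 n p) (gl2 n p) := by
  rw [mem_Isq] at hx
  obtain ⟨i, hi, hi'⟩ := cell_exists hn hx.1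
  obtain ⟨j, hj, hj'⟩ := cell_exists hn hx.2
  rcases le_total (gc n x.2 - (j : ℕ)) (gc n x.1 - (i : ℕ)) with h | h
  · refine ⟨(i, j, true), ?_, ?_, ?_⟩ <;> simp only [gl0, gl1, gl2, cond_true] <;> linarith
  · refine ⟨(i, j, false), ?_, ?_, ?_⟩ <;> simp only [gl0, gl1, gl2, cond_false] <;> linarith

lemma grid_dis {n : ℕ} (p q : Fin n × Fin n × Bool) (h : p ≠ q) :
    Disjoint (TriO (gl0 n p) (gl1 n p) (gl2 n p)) (TriC (gl0 n q) (gl1 n q) (gl2 n q)) := by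
  rw [Set.disjoint_left]
  intro x hp hq
  apply h
  obtain ⟨a0, a1, a2, a3⟩ := grid_boxO hp
  obtain ⟨b0, b1, b2, b3⟩ := grid_box hq
  obtain ⟨i, j, b⟩ := p
  obtain ⟨k, l, c⟩ := q
  simp only at a0 a1 a2 a3 b0 b1 b2 b3
  have key : ∀ (m m' : Fin n) (t : ℝ), ((m : ℕ) : ℝ) < t → t < (m : ℕ) + 1 → ((m' : ℕ) : ℝ) ≤ t → t ≤ (m' : ℕ) + 1 → m = m' := by
    intro m m' t h0 h1 h2 h3
    have e1 : (m' : ℕ) < (m : ℕ) + 1 := by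
      have : ((m' : ℕ) : ℝ) < (m : ℕ) + 1 := by linarith
      exact_mod_cast this
    have e2 : (m : ℕ) < (m' : ℕ) + 1 := by
      have : ((m : ℕ) : ℝ) < (m' : ℕ) + 1 := by linarith
      exact_mod_cast this
    exact Fin.ext (by omega)
  have e1 := key i k _ a0 a1 b0 b1
  have e2 := key j l _ a2 a3 b2 b3
  subst e1 e2
  obtain ⟨p0, p1, p2⟩ := hp
  obtain ⟨q0, q1, q2⟩ := hq
  cases b <;> cases c <;> first | rfl | (exfalso; simp only [gl1, cond_true, cond_false] at p1 q1; linarith)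

/-- nodal values -/
def gS0 (n : ℕ) (V : ℕ → ℕ → ℝ) (p : Fin n × Fin n × Bool) : ℝ := V p.1 p.2.1
/-- nodal values -/
def gS1 (n : ℕ) (V : ℕ → ℕ → ℝ) (p : Fin n × Fin n × Bool) : ℝ := cond p.2.2 (V (p.1 + 1) p.2.1) (V p.1 (p.2.1 + 1))
/-- nodal values -/
def gS2 (n : ℕ) (V : ℕ → ℕ → ℝ) (p : Fin n × Fin n × Bool) : ℝ := V (p.1 + 1) (p.2.1 + 1)

lemma pl_tri {n : ℕ} (V : ℕ → ℕ → ℝ) (p : Fin n × Fin n × Bool) {x : ℝ × ℝ} (hx : x ∈ TriC (gl0 n p) (gl1 n p) (gl2 n p)) :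
    pl n V x = gS0 n V p * gl0 n p x + gS1 n V p * gl1 n p x + gS2 n V p * gl2 n p x := by
  obtain ⟨i, j, b⟩ := p
  obtain ⟨h0, h1, h2⟩ := hx
  unfold pl
  have e1 : gc n x.1 = (i : ℕ) + (gc n x.1 - (i : ℕ)) := by ring
  have e2 : gc n x.2 = (j : ℕ) + (gc n x.2 - (j : ℕ)) := by ring
  cases b
  · simp only [gl0, gl1, gl2, gS0, gS1, gS2, cond_false] at h0 h1 h2 ⊢
    rw [e1, e2, hsum_upper V i.2 j.2 h2 (by linarith) (by linarith)]
    ring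
  · simp only [gl0, gl1, gl2, gS0, gS1, gS2, cond_true] at h0 h1 h2 ⊢
    rw [e1, e2, hsum_lower V i.2 j.2 h2 (by linarith) (by linarith)]
    ring

lemma memR_pl {n : ℕ} (hn : 0 < n) (V : ℕ → ℕ → ℝ) (θ : ℝ) (hθ : ∀ i ≤ n, ∀ j ≤ n, V i j ≠ θ) (hpos : ∃ x ∈ Usq, θ < pl n V x) :
    ∃ R, MemR R ∧ {x | x ∈ Isq ∧ θ ≤ pl n V x} ⊆ R ∧ volume (R \ {x | x ∈ Isq ∧ θ ≤ pl n V x}) = 0 := by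
  have := memR_grid (gl0 n) (gl1 n) (gl2 n) (grid_bary hn) (grid_T hn) (grid_O hn) (fun x hx => grid_cov hn hx) grid_dis
    (s := fun x => pl n V x - θ) ((pl_cont n V).sub continuous_const) (fun p => gS0 n V p - θ) (fun p => gS1 n V p - θ) (fun p => gS2 n V p - θ)
    (fun p x hx => by
      rw [pl_tri V p hx]
      have := (grid_bary hn p).sum x
      linear_combination θ * this)
    (fun p => sub_ne_zero.2 (hθ _ p.1.2.le _ p.2.1.2.le))
    (fun p => sub_ne_zero.2 (by
      obtain ⟨i, j, b⟩ := p
      cases b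
      · exact hθ _ i.2.le _ j.2
      · exact hθ _ i.2 _ j.2.le))
    (fun p => sub_ne_zero.2 (hθ _ p.1.2 _ p.2.1.2))
    (by obtain ⟨x, hx, h⟩ := hpos; exact ⟨x, hx, sub_pos.2 h⟩)
  simpa only [sub_nonneg] using this

open MeasureTheory Set Filter ENNReal

lemma grad_aff_loc {w : ℝ × ℝ → ℝ} {x : ℝ × ℝ} {α β δ : ℝ} (h : ∀ᶠ y in nhds x, w y = α * y.1 + β * y.2 + δ) :
    DifferentiableAt ℝ w x ∧ grad w x = (α, β) := by
  have hd : HasFDerivAt (fun y : ℝ × ℝ => α * y.1 + β * y.2 + δ)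
      (α • ContinuousLinearMap.fst ℝ ℝ ℝ + β • ContinuousLinearMap.snd ℝ ℝ ℝ) x :=
    ((hasFDerivAt_fst.const_mul α).add (hasFDerivAt_snd.const_mul β)).add_const δ
  have hw : HasFDerivAt w (α • ContinuousLinearMap.fst ℝ ℝ ℝ + β • ContinuousLinearMap.snd ℝ ℝ ℝ) x :=
    hd.congr_of_eventuallyEq h
  refine ⟨hw.differentiableAt, ?_⟩
  unfold grad
  rw [hw.fderiv]
  simp

lemma pl_grad_lower {n : ℕ} (V : ℕ → ℕ → ℝ) (i j : Fin n) {x : ℝ × ℝ}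
    (hx : x ∈ interior (TriC (gl0 n (i, j, true)) (gl1 n (i, j, true)) (gl2 n (i, j, true)))) :
    DifferentiableAt ℝ (pl n V) x ∧ grad (pl n V) x =
      ((V (i+1) j - V i j) * (n / 2), (V (i+1) (j+1) - V (i+1) j) * (n / 2)) := by
  have hev : ∀ᶠ y in nhds x, pl n V y = ((V (i+1) j - V i j) * (n / 2)) * y.1 + ((V (i+1) (j+1) - V (i+1) j) * (n / 2)) * y.2 +
      (V i j * (1 - n / 2 + (i : ℕ)) + V (i+1) j * ((j : ℕ) - (i : ℕ)) + V (i+1) (j+1) * (n / 2 - (j : ℕ))) := by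
    filter_upwards [isOpen_interior.mem_nhds hx] with y hy
    rw [pl_tri V _ (interior_subset hy)]
    simp only [gS0, gS1, gS2, gl0, gl1, gl2, cond_true, gc]
    ring
  exact grad_aff_loc hev

lemma pl_grad_upper {n : ℕ} (V : ℕ → ℕ → ℝ) (i j : Fin n) {x : ℝ × ℝ}
    (hx : x ∈ interior (TriC (gl0 n (i, j, false)) (gl1 n (i, j, false)) (gl2 n (i, j, false)))) :
    DifferentiableAt ℝ (pl n V) x ∧ grad (pl n V) x =
      ((V (i+1) (j+1) - V i (j+1)) * (n / 2), (V i (j+1) - V i j) * (n / 2)) := by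
  have hev : ∀ᶠ y in nhds x, pl n V y = ((V (i+1) (j+1) - V i (j+1)) * (n / 2)) * y.1 + ((V i (j+1) - V i j) * (n / 2)) * y.2 +
      (V i j * (1 - n / 2 + (j : ℕ)) + V i (j+1) * ((i : ℕ) - (j : ℕ)) + V (i+1) (j+1) * (n / 2 - (i : ℕ))) := by
    filter_upwards [isOpen_interior.mem_nhds hx] with y hy
    rw [pl_tri V _ (interior_subset hy)]
    simp only [gS0, gS1, gS2, gl0, gl1, gl2, cond_false, gc]
    ring
  exact grad_aff_loc hev

lemma mvt_fst {v : ℝ × ℝ → ℝ} (hv : Differentiable ℝ v) {s s' : ℝ} (h : s < s') (y : ℝ) :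
    ∃ ξ ∈ Ioo s s', v (s', y) - v (s, y) = (grad v (ξ, y)).1 * (s' - s) := by
  have hd : ∀ t, HasDerivAt (fun t => v (t, y)) (fderiv ℝ v (t, y) (1, 0)) t := fun t =>
    (hv (t, y)).hasFDerivAt.comp_hasDerivAt t ((hasDerivAt_id t).prodMk (hasDerivAt_const t y))
  obtain ⟨ξ, hξ, e⟩ := exists_hasDerivAt_eq_slope (fun t => v (t, y)) _ h (fun t _ => (hd t).continuousAt.continuousWithinAt) (fun t _ => hd t)
  refine ⟨ξ, hξ, ?_⟩
  have : s' - s ≠ 0 := by linarith [sub_pos.2 h]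
  unfold grad; simp only; rw [e]; field_simp

lemma mvt_snd {v : ℝ × ℝ → ℝ} (hv : Differentiable ℝ v) {s s' : ℝ} (h : s < s') (y : ℝ) :
    ∃ ξ ∈ Ioo s s', v (y, s') - v (y, s) = (grad v (y, ξ)).2 * (s' - s) := by
  have hd : ∀ t, HasDerivAt (fun t => v (y, t)) (fderiv ℝ v (y, t) (0, 1)) t := fun t =>
    (hv (y, t)).hasFDerivAt.comp_hasDerivAt t ((hasDerivAt_const t y).prodMk (hasDerivAt_id t))
  obtain ⟨ξ, hξ, e⟩ := exists_hasDerivAt_eq_slope (fun t => v (y, t)) _ h (fun t _ => (hd t).continuousAt.continuousWithinAt) (fun t _ => hd t)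
  refine ⟨ξ, hξ, ?_⟩
  have : s' - s ≠ 0 := by linarith [sub_pos.2 h]
  unfold grad; simp only; rw [e]; field_simp

/-- grid nodes -/
noncomputable def zn (n i : ℕ) : ℝ := i * (2 / n) - 1

/-- nodal values of a function -/
noncomputable def nod (n : ℕ) (v : ℝ × ℝ → ℝ) (i j : ℕ) : ℝ := v (zn n i, zn n j)

lemma zn_succ (n i : ℕ) : zn n (i + 1) = zn n i + 2 / n := by unfold zn; push_cast; ring

lemma zn_cell {n : ℕ} (hn : 0 < n) {i : ℕ} {t : ℝ} (h0 : (i : ℝ) ≤ gc n t) (h1 : gc n t ≤ i + 1) : zn n i ≤ t ∧ t ≤ zn n i + 2 / n := by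
  have hn' : (0 : ℝ) < n := by exact_mod_cast hn
  have e : t = gc n t * (2 / n) - 1 := by unfold gc; field_simp; ring
  have h : (0 : ℝ) < 2 / n := by positivity
  unfold zn
  constructor <;> nlinarith

lemma near_aux {t s d z : ℝ} (h1 : z ≤ t) (h2 : t ≤ z + d) (h3 : z ≤ s) (h4 : s ≤ z + d) : |s - t| ≤ d := by
  rw [abs_le]; constructor <;> linarith

lemma pl_grad_close {n : ℕ} (hn : 0 < n) {v : ℝ × ℝ → ℝ} (hv : Differentiable ℝ v) {p : Fin n × Fin n × Bool} {x : ℝ × ℝ}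
    (hx : x ∈ interior (TriC (gl0 n p) (gl1 n p) (gl2 n p))) :
    DifferentiableAt ℝ (pl n (nod n v)) x ∧ ∃ y z : ℝ × ℝ, dist y x ≤ 2 / n ∧ dist z x ≤ 2 / n ∧
      grad (pl n (nod n v)) x = ((grad v y).1, (grad v z).2) := by
  have hn' : (0 : ℝ) < n := by exact_mod_cast hn
  have h2 : (0 : ℝ) < 2 / n := by positivity
  obtain ⟨b0, b1, b2, b3⟩ := grid_box (interior_subset hx)
  obtain ⟨c0, c1⟩ := zn_cell hn b0 b1
  obtain ⟨d0, d1⟩ := zn_cell hn b2 b3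
  obtain ⟨i, j, b⟩ := p
  simp only at c0 c1 d0 d1
  cases b
  · obtain ⟨hd, hg⟩ := pl_grad_upper (nod n v) i j hx
    refine ⟨hd, ?_⟩
    obtain ⟨ξ, hξ, e⟩ := mvt_fst hv (s := zn n i) (s' := zn n (i + 1)) (by rw [zn_succ]; linarith) (zn n (j + 1))
    obtain ⟨ζ, hζ, e'⟩ := mvt_snd hv (s := zn n j) (s' := zn n (j + 1)) (by rw [zn_succ]; linarith) (zn n i)
    refine ⟨(ξ, zn n (j + 1)), (zn n i, ζ), ?_, ?_, ?_⟩
    · rw [Prod.dist_eq, Real.dist_eq, Real.dist_eq]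
      rw [zn_succ] at hξ ⊢
      exact max_le (near_aux c0 c1 hξ.1.le hξ.2.le) (near_aux d0 d1 (by linarith) le_rfl)
    · rw [Prod.dist_eq, Real.dist_eq, Real.dist_eq]
      rw [zn_succ] at hζ
      exact max_le (near_aux c0 c1 le_rfl (by linarith)) (near_aux d0 d1 hζ.1.le hζ.2.le)
    · rw [hg]
      unfold nod
      rw [e, e', zn_succ, zn_succ]
      refine Prod.ext ?_ ?_ <;> simp only [add_sub_cancel_left] <;> field_simp
  · obtain ⟨hd, hg⟩ := pl_grad_lower (nod n v) i j hx
    refine ⟨hd, ?_⟩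
    obtain ⟨ξ, hξ, e⟩ := mvt_fst hv (s := zn n i) (s' := zn n (i + 1)) (by rw [zn_succ]; linarith) (zn n j)
    obtain ⟨ζ, hζ, e'⟩ := mvt_snd hv (s := zn n j) (s' := zn n (j + 1)) (by rw [zn_succ]; linarith) (zn n (i + 1))
    refine ⟨(ξ, zn n j), (zn n (i + 1), ζ), ?_, ?_, ?_⟩
    · rw [Prod.dist_eq, Real.dist_eq, Real.dist_eq]
      rw [zn_succ] at hξ
      exact max_le (near_aux c0 c1 hξ.1.le hξ.2.le) (near_aux d0 d1 le_rfl (by linarith))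
    · rw [Prod.dist_eq, Real.dist_eq, Real.dist_eq]
      rw [zn_succ] at hζ ⊢
      exact max_le (near_aux c0 c1 (by linarith) le_rfl) (near_aux d0 d1 hζ.1.le hζ.2.le)
    · rw [hg]
      unfold nod
      rw [e, e', zn_succ, zn_succ]
      refine Prod.ext ?_ ?_ <;> simp only [add_sub_cancel_left] <;> field_simp

lemma triC_convex {l0 l1 l2} (h : Bary l0 l1 l2) : Convex ℝ (TriC l0 l1 l2) :=
  h.a0.convex.inter (h.a1.convex.inter h.a2.convex)

lemma grid_ae {n : ℕ} (hn : 0 < n) : ∀ᵐ x, x ∈ Isq → ∃ p, x ∈ interior (TriC (gl0 n p) (gl1 n p) (gl2 n p)) := by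
  have : ∀ p, ∀ᵐ x, x ∉ frontier (TriC (gl0 n p) (gl1 n p) (gl2 n p)) := fun p =>
    measure_eq_zero_iff_ae_notMem.1 ((triC_convex (grid_bary hn p)).addHaar_frontier volume)
  filter_upwards [ae_all_iff.2 this] with x hx hxI
  obtain ⟨p, hp⟩ := grid_cov hn hxI
  refine ⟨p, ?_⟩
  by_contra h
  exact hx p ⟨subset_closure hp, h⟩

lemma pl_val_close {n : ℕ} (hn : 0 < n) {v : ℝ × ℝ → ℝ} {δ η : ℝ} (hu : ∀ x y, dist x y < δ → dist (v x) (v y) ≤ η) (hnd : 2 / n < δ)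
    {x : ℝ × ℝ} (hx : x ∈ Isq) : |pl n (nod n v) x - v x| ≤ η := by
  have hn' : (0 : ℝ) < n := by exact_mod_cast hn
  have h2 : (0 : ℝ) < 2 / n := by positivity
  obtain ⟨p, hp⟩ := grid_cov hn hx
  obtain ⟨b0, b1, b2, b3⟩ := grid_box hp
  obtain ⟨c0, c1⟩ := zn_cell hn b0 b1
  obtain ⟨d0, d1⟩ := zn_cell hn b2 b3
  have key : ∀ k l : ℕ, (k = p.1 ∨ k = p.1 + 1) → (l = p.2.1 ∨ l = p.2.1 + 1) → |nod n v k l - v x| ≤ η := by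
    intro k l hk hl
    unfold nod
    refine hu _ _ (lt_of_le_of_lt ?_ hnd)
    rw [Prod.dist_eq, Real.dist_eq, Real.dist_eq]
    apply max_le
    · rcases hk with rfl | rfl
      · exact near_aux c0 c1 le_rfl (by linarith)
      · rw [zn_succ]; exact near_aux c0 c1 (by linarith) le_rfl
    · rcases hl with rfl | rfl
      · exact near_aux d0 d1 le_rfl (by linarith)
      · rw [zn_succ]; exact near_aux d0 d1 (by linarith) le_rfl
  rw [pl_tri _ p hp]
  have k0 : |gS0 n (nod n v) p - v x| ≤ η := key _ _ (Or.inl rfl) (Or.inl rfl)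
  have k2 : |gS2 n (nod n v) p - v x| ≤ η := key _ _ (Or.inr rfl) (Or.inr rfl)
  have k1 : |gS1 n (nod n v) p - v x| ≤ η := by
    obtain ⟨i, j, b⟩ := p
    cases b
    · exact key _ _ (Or.inl rfl) (Or.inr rfl)
    · exact key _ _ (Or.inr rfl) (Or.inl rfl)
  obtain ⟨h0, h1, h2⟩ := hp
  have hs := (grid_bary hn p).sum x
  rw [abs_le] at k0 k1 k2 ⊢
  generalize gS0 n (nod n v) p = A at *
  generalize gS1 n (nod n v) p = B at *
  generalize gS2 n (nod n v) p = C at *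
  generalize gl0 n p x = a at *
  generalize gl1 n p x = b at *
  generalize gl2 n p x = c at *
  generalize v x = w at *
  have e : A * a + B * b + C * c - w = (A - w) * a + (B - w) * b + (C - w) * c := by linear_combination w * hs
  have e' : η = η * a + η * b + η * c := by linear_combination (-η) * hs
  rw [e]
  constructor
  · rw [e']
    nlinarith [mul_le_mul_of_nonneg_right k0.1 h0, mul_le_mul_of_nonneg_right k1.1 h1, mul_le_mul_of_nonneg_right k2.1 h2]
  · rw [e']
    nlinarith [mul_le_mul_of_nonneg_right k0.2 h0, mul_le_mul_of_nonneg_right k1.2 h1, mul_le_mul_of_nonneg_right k2.2 h2]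

lemma pl_approx {τ : ℝ × ℝ → ℝ} (hτ : IsNorm2 τ) {v : ℝ × ℝ → ℝ} (hv : ContDiff ℝ (⊤ : ℕ∞) v) (hcs : HasCompactSupport v) {η : ℝ} (hη : 0 < η) :
    ∃ n : ℕ, 0 < n ∧ (∀ x ∈ Isq, |pl n (nod n v) x - v x| ≤ η) ∧
      ∀ᵐ x, x ∈ Isq → τ (grad (pl n (nod n v)) x) ≤ τ (grad v x) + η := by
  obtain ⟨K, hK, hKb⟩ := hτ.upper
  have hgc : Continuous (grad v) := grad_continuous hv
  have hgs : HasCompactSupport (grad v) := by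
    have := hcs.fderiv (𝕜 := ℝ)
    exact this.comp_left (g := fun L : (ℝ × ℝ) →L[ℝ] ℝ => ((L (1, 0), L (0, 1)) : ℝ × ℝ)) rfl
  have u1 := hcs.uniformContinuous_of_continuous hv.continuous
  have u2 := hgs.uniformContinuous_of_continuous hgc
  obtain ⟨δ, hδ, h1⟩ := Metric.uniformContinuous_iff.1 u1 η hη
  obtain ⟨δ', hδ', h2⟩ := Metric.uniformContinuous_iff.1 u2 (η / K) (by positivity)
  obtain ⟨m, hm⟩ := exists_nat_gt (2 / min δ δ')
  have hmin : 0 < min δ δ' := lt_min hδ hδ'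
  have hm0 : (0 : ℝ) < m := lt_trans (by positivity) hm
  have hlt : 2 / (m : ℝ) < min δ δ' := by
    rw [div_lt_iff₀ hm0]
    rw [div_lt_iff₀ hmin] at hm
    linarith
  have hm0' : 0 < m := by exact_mod_cast hm0
  refine ⟨m, hm0', fun x hx => pl_val_close hm0' (fun x y h => (h1 h).le) (hlt.trans_le (min_le_left _ _)) hx, ?_⟩
  filter_upwards [grid_ae hm0'] with x hx hxI
  obtain ⟨p, hp⟩ := hx hxI
  obtain ⟨-, y, z, hy, hz, e⟩ := pl_grad_close hm0' (hv.differentiable (by simp)) hp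
  have hy' := (h2 (hy.trans_lt (hlt.trans_le (min_le_right _ _)))).le
  have hz' := (h2 (hz.trans_lt (hlt.trans_le (min_le_right _ _)))).le
  have : τ (grad (pl m (nod m v)) x - grad v x) ≤ η := by
    refine (hKb _).trans ?_
    have : ‖grad (pl m (nod m v)) x - grad v x‖ ≤ η / K := by
      rw [e, Prod.norm_def]
      rw [dist_eq_norm, Prod.norm_def] at hy' hz'
      exact max_le ((le_max_left _ _).trans hy') ((le_max_right _ _).trans hz')
    calc K * _ ≤ K * (η / K) := by gcongr
      _ = η := by field_simp
  have h3 := hτ.add_le (grad v x) (grad (pl m (nod m v)) x - grad v x)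
  rw [add_sub_cancel] at h3
  linarith

open MeasureTheory Set Filter ENNReal

lemma norming {τ : ℝ × ℝ → ℝ} (hτ : IsNorm2 τ) (q : ℝ × ℝ) : ∃ ξ, Adm τ ξ ∧ dot2 q ξ = τ q := by
  by_cases hq : q = 0
  · exact ⟨0, Adm.zero hτ, by rw [hq, hτ.zero]; simp [dot2]⟩
  let f : (ℝ × ℝ) →ₗ.[ℝ] ℝ := LinearPMap.mkSpanSingleton q (τ q) hq
  have hfv : ∀ (c : ℝ) (h : c • q ∈ f.domain), f ⟨c • q, h⟩ = c * τ q := by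
    intro c h
    exact LinearPMap.mkSpanSingleton'_apply q (τ q) _ c h
  have hdom : ∀ x ∈ f.domain, ∃ c : ℝ, c • q = x := fun x hx => Submodule.mem_span_singleton.1 hx
  obtain ⟨g, hg, hgN⟩ := exists_extension_of_le_sublinear f τ
    (fun c hc x => by rw [hτ.smul, abs_of_pos hc]) hτ.add_le (by
      rintro ⟨x, hx⟩
      obtain ⟨c, rfl⟩ := hdom x hx
      rw [hfv]
      simp only
      rw [hτ.smul]
      exact mul_le_mul_of_nonneg_right (le_abs_self c) (hτ.nonneg q))
  have hdot : ∀ v, dot2 v (g (1, 0), g (0, 1)) = g v := by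
    intro v
    have : v = v.1 • ((1 : ℝ), (0 : ℝ)) + v.2 • ((0 : ℝ), (1 : ℝ)) := by
      ext <;> simp
    conv_rhs => rw [this, map_add, map_smul, map_smul]
    simp [dot2]
  refine ⟨(g (1, 0), g (0, 1)), fun v => by rw [hdot]; exact hgN v, ?_⟩
  rw [hdot]
  have hm : (1 : ℝ) • q ∈ f.domain := Submodule.mem_span_singleton.2 ⟨1, rfl⟩
  have := hg ⟨(1 : ℝ) • q, hm⟩
  rw [hfv] at this
  simpa using this

lemma adm_sel {τ : ℝ × ℝ → ℝ} (hτ : IsNorm2 τ) {η : ℝ} (hη : 0 < η) :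
    ∃ s : ℝ × ℝ → ℝ × ℝ, Measurable s ∧ (∀ g, Adm τ (s g)) ∧ ∀ g, τ g - η ≤ dot2 g (s g) := by
  classical
  choose ξ hξ hξq using norming hτ
  have hp : ∀ g : ℝ × ℝ, ∃ n, τ g - η ≤ dot2 g (ξ (TopologicalSpace.denseSeq (ℝ × ℝ) n)) := by
    intro g
    have hopen : IsOpen {q : ℝ × ℝ | τ (g - q) < η / 2} :=
      isOpen_lt (hτ.continuous.comp (by fun_prop : Continuous fun q : ℝ × ℝ => g - q)) continuous_const
    obtain ⟨n, hq⟩ := (TopologicalSpace.denseRange_denseSeq (ℝ × ℝ)).exists_mem_open hopen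
      ⟨g, by simp only [mem_ofPred_eq]; rw [sub_self, hτ.zero]; positivity⟩
    refine ⟨n, ?_⟩
    set q := TopologicalSpace.denseSeq (ℝ × ℝ) n
    have h1 := hξ q (q - g)
    have h2 := hξq q
    have h3 := hτ.add_le q (g - q)
    have h4 : τ (q - g) = τ (g - q) := by rw [← hτ.neg, neg_sub]
    have h5 : dot2 (q - g) (ξ q) = dot2 q (ξ q) - dot2 g (ξ q) := by simp [dot2]; ring
    simp only [mem_ofPred_eq] at hq
    rw [add_sub_cancel] at h3
    linarith
  refine ⟨fun g => ξ (TopologicalSpace.denseSeq (ℝ × ℝ) (Nat.find (hp g))), ?_, fun g => hξ _, fun g => Nat.find_spec (hp g)⟩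
  have hmf : Measurable fun g => Nat.find (hp g) := by
    apply measurable_find
    intro k
    refine (isClosed_le (hτ.continuous.sub continuous_const) ?_).measurableSet
    unfold dot2; fun_prop
  exact (measurable_from_nat (f := fun n => ξ (TopologicalSpace.denseSeq (ℝ × ℝ) n))).comp hmf

lemma mind_tv {τ : ℝ × ℝ → ℝ} (h : IsNorm2 τ) {E : Set (ℝ × ℝ)} (hE : MeasurableSet E) (hI : E ⊆ Isq) {c : ℝ}
    (hp : Per τ E c) {K ε} (hK : Moll K ε) {r : ℝ} (hr : r + ε < 1) :
    ∫ x in Metric.closedBall (0 : ℝ × ℝ) r, τ (grad (mind K E) x) ≤ c := by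
  classical
  have hsm := mind_smooth hK hE hI
  have hgc := grad_continuous hsm
  have hfin : volume (Metric.closedBall (0 : ℝ × ℝ) r) ≠ ⊤ := measure_closedBall_lt_top.ne
  set W := volume.real (Metric.closedBall (0 : ℝ × ℝ) r) with hW
  have hW0 : 0 ≤ W := measureReal_nonneg
  apply _root_.le_of_forall_pos_le_add
  intro η hη
  obtain ⟨s, hsm', hsa, hsl⟩ := adm_sel h (show 0 < η / (W + 1) by positivity)
  set B := Metric.closedBall (0 : ℝ × ℝ) r with hB
  have hBm : MeasurableSet B := measurableSet_closedBall
  set f0 : ℝ × ℝ → ℝ × ℝ := B.indicator (fun x => - s (grad (mind K E) x)) with hf0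
  have hf0m : Measurable f0 := ((hsm'.comp hgc.measurable).neg).indicator hBm
  have hfa : ∀ x, Adm τ (f0 x) := by
    intro x
    by_cases hx : x ∈ B
    · rw [hf0, indicator_of_mem hx]; exact (hsa _).neg h
    · rw [hf0, indicator_of_notMem hx]; exact Adm.zero h
  have := factM h hE hI hp hK hr hf0m hfa (fun x hx => by
    have : x ∈ B := by
      by_contra hc
      exact hx (by rw [hf0, indicator_of_notMem hc])
    simpa [hB] using this)
  have e1 : - ∫ x, dot2 (f0 x) (grad (mind K E) x) = ∫ x in B, dot2 (grad (mind K E) x) (s (grad (mind K E) x)) := by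
    rw [← integral_neg, ← integral_indicator hBm]
    congr 1
    funext x
    by_cases hx : x ∈ B
    · rw [hf0, indicator_of_mem hx, indicator_of_mem hx]; simp [dot2]; ring
    · rw [hf0, indicator_of_notMem hx, indicator_of_notMem hx]; simp [dot2]
  rw [e1] at this
  have i1 : IntegrableOn (fun x => τ (grad (mind K E) x)) B :=
    (h.continuous.comp hgc).continuousOn.integrableOn_compact (isCompact_closedBall _ _)
  have i3 : IntegrableOn (fun _ : ℝ × ℝ => η / (W + 1)) B := integrableOn_const hfin
  have i2 : IntegrableOn (fun x => dot2 (grad (mind K E) x) (s (grad (mind K E) x))) B := by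
    refine (i1.add i3).mono' ?_ (Eventually.of_forall fun x => ?_)
    · apply Measurable.aestronglyMeasurable
      have m1 := hgc.measurable
      have m2 := hsm'.comp m1
      unfold dot2
      exact (m1.fst.mul m2.fst).add (m1.snd.mul m2.snd)
    · have h1 := hsa (grad (mind K E) x) (grad (mind K E) x)
      have h2 := hsl (grad (mind K E) x)
      have h3 := h.nonneg (grad (mind K E) x)
      have h4 : 0 < η / (W + 1) := by positivity
      rw [Real.norm_eq_abs, abs_le]
      simp only [Pi.add_apply]
      constructor <;> linarith
  have h5 : ∫ x in B, τ (grad (mind K E) x) - η / (W + 1) ≤ ∫ x in B, dot2 (grad (mind K E) x) (s (grad (mind K E) x)) :=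
    setIntegral_mono (i1.sub i3) i2 (fun x => hsl _)
  rw [integral_sub i1 i3, setIntegral_const, ← hW, smul_eq_mul] at h5
  have h6 : W * (η / (W + 1)) ≤ η := by
    rw [mul_div_assoc', div_le_iff₀ (by positivity)]; nlinarith
  linarith

open MeasureTheory Set Filter ENNReal

lemma mind_l1 {E : Set (ℝ × ℝ)} (hE : MeasurableSet E) (hI : E ⊆ Isq) :
    Tendsto (fun n => ∫ x, |mind (Kseq n) E x - E.indicator 1 x|) atTop (nhds 0) := by
  have hb : Integrable ((Metric.closedBall (0 : ℝ × ℝ) 2).indicator (fun _ => (1 : ℝ))) := by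
    rw [integrable_indicator_iff measurableSet_closedBall]
    exact integrableOn_const measure_closedBall_lt_top.ne
  have := tendsto_integral_of_dominated_convergence (μ := volume) (F := fun n x => |mind (Kseq n) E x - E.indicator 1 x|)
    (f := fun _ => 0) ((Metric.closedBall (0 : ℝ × ℝ) 2).indicator (fun _ => (1 : ℝ))) (fun n => by
      exact (((mind_smooth (Kseq_moll n) hE hI).continuous.aestronglyMeasurable).sub
        (integrable_ind hE hI).aestronglyMeasurable).norm) hb (fun n => Eventually.of_forall fun x => by
      have hεn : (1 : ℝ) / (n + 1) ≤ 1 := by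
        rw [div_le_one (by positivity)]; linarith [(Nat.cast_nonneg n : (0 : ℝ) ≤ n)]
      rw [Real.norm_eq_abs, abs_abs]
      by_cases hx : x ∈ Metric.closedBall (0 : ℝ × ℝ) 2
      · rw [indicator_of_mem hx]
        have h0 := mind_nonneg (Kseq_moll n) (E := E) x
        have h1 := mind_le_one (Kseq_moll n) hE hI x
        have h2 : 0 ≤ E.indicator (1 : ℝ × ℝ → ℝ) x := indicator_nonneg (by simp) _
        have h3 : E.indicator (1 : ℝ × ℝ → ℝ) x ≤ 1 := indicator_le_self' (by simp) x
        rw [abs_le]; constructor <;> linarith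
      · rw [indicator_of_notMem hx]
        have hx' : 2 < ‖x‖ := by simpa using hx
        rw [mind_zero (Kseq_moll n) hI (by linarith), indicator_of_notMem]
        · simp
        · intro hxE
          have := mem_Isq.1 (hI hxE)
          have h4 : ‖x‖ ≤ 1 := by rw [Prod.norm_def]; exact max_le this.1 this.2
          linarith)
    (by
      filter_upwards [mind_tendsto hE hI] with x hx
      have := (hx.sub_const (E.indicator 1 x)).abs
      simpa using this)
  simpa using this

lemma Isq_eq_ball : Isq = Metric.closedBall (0 : ℝ × ℝ) 1 := by
  ext x
  rw [mem_Isq, mem_closedBall_zero_iff, Prod.norm_def, max_le_iff]; rfl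

lemma stepA {τ : ℝ × ℝ → ℝ} (h : IsNorm2 τ) {E : Set (ℝ × ℝ)} (hE : MeasurableSet E) (hI : E ⊆ Isq) {c : ℝ}
    (hp : Per τ E c) {η : ℝ} (hη : 0 < η) :
    ∃ E' v, MeasurableSet E' ∧ E' ⊆ Isq ∧ |volume.real E' - volume.real E| ≤ η ∧ ContDiff ℝ (⊤ : ℕ∞) v ∧ HasCompactSupport v ∧
      ∫ x in Isq, |v x - E'.indicator 1 x| ≤ η ∧ ∫ x in Isq, τ (grad v x) ≤ c + η := by
  have hc0 : 0 ≤ c := hp.nonneg h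
  obtain ⟨r, hr0, hr1, hrc, hrv⟩ : ∃ r : ℝ, 0 < r ∧ r < 1 ∧ c * r⁻¹ < c + η ∧ 4 * ((r ^ 2)⁻¹ - 1) < η := by
    have A : ∀ᶠ r in nhds (1 : ℝ), c * r⁻¹ < c + η := by
      have : ContinuousAt (fun r : ℝ => c * r⁻¹) 1 := continuousAt_const.mul (continuousAt_inv₀ one_ne_zero)
      exact this.eventually_lt_const (by simpa using hη)
    have B : ∀ᶠ r in nhds (1 : ℝ), 4 * ((r ^ 2)⁻¹ - 1) < η := by
      have : ContinuousAt (fun r : ℝ => 4 * ((r ^ 2)⁻¹ - 1)) 1 :=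
        continuousAt_const.mul (((continuousAt_id.pow 2).inv₀ (by simp)).sub continuousAt_const)
      exact this.eventually_lt_const (by simpa using hη)
    have C : ∀ᶠ r in nhdsWithin (1 : ℝ) (Iio 1), r ∈ Ioo (0 : ℝ) 1 := Ioo_mem_nhdsLT one_pos
    obtain ⟨r, hr, hr', hr''⟩ := (((A.and B).filter_mono nhdsWithin_le_nhds).and C).exists
    exact ⟨r, hr', hr'', hr.1, hr.2⟩
  have hr2 : 0 < (r ^ 2)⁻¹ := by positivity
  obtain ⟨n, hn1, hn2⟩ : ∃ n : ℕ, (1 : ℝ) / (n + 1) < 1 - r ∧ (r ^ 2)⁻¹ * ∫ x, |mind (Kseq n) E x - E.indicator 1 x| < η := by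
    have A : ∀ᶠ n : ℕ in atTop, (1 : ℝ) / (n + 1) < 1 - r :=
      (tendsto_one_div_add_atTop_nhds_zero_nat (𝕜 := ℝ)).eventually_lt_const (by linarith)
    have B := ((mind_l1 hE hI).const_mul ((r ^ 2)⁻¹)).eventually_lt_const (show (r ^ 2)⁻¹ * 0 < η by simpa using hη)
    exact (A.and B).exists
  have hK := Kseq_moll n
  set u := mind (Kseq n) E with hu
  have husm := mind_smooth hK hE hI
  have hucs : HasCompactSupport u := mind_cs hK hI
  have huc : Continuous u := husm.continuous
  set B := Metric.closedBall (0 : ℝ × ℝ) r with hB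
  have hBm : MeasurableSet B := measurableSet_closedBall
  have hIB : Isq = {x : ℝ × ℝ | r • x + 0 ∈ B} := by
    rw [Isq_eq_ball]
    ext x
    simp only [mem_ofPred_eq, add_zero, hB, mem_closedBall_zero_iff, norm_smul, Real.norm_eq_abs, abs_of_pos hr0]
    constructor <;> intro hh <;> nlinarith
  have hEBm : MeasurableSet (E ∩ B) := hE.inter hBm
  have hgrad : ∀ x, grad (fun x => u (r • x)) x = r • grad u (r • x) := by
    intro x
    have hd : HasFDerivAt (fun x => u (r • x)) ((fderiv ℝ u (r • x)).comp (r • ContinuousLinearMap.id ℝ (ℝ × ℝ))) x :=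
      ((husm.differentiable (by simp)) (r • x)).hasFDerivAt.comp x ((hasFDerivAt_id x).const_smul r)
    unfold grad
    rw [hd.fderiv]
    simp
  refine ⟨{x : ℝ × ℝ | r • x + 0 ∈ E ∩ B}, fun x => u (r • x), affine_meas hEBm r 0, ?_, ?_, ?_, ?_, ?_, ?_⟩
  · rw [hIB]; intro x hx; exact hx.2
  · rw [vol_affine hr0 0 hEBm]
    have hV4 : volume.real Isq = 4 := by rw [measureReal_def, volume_Isq]; simp
    have hvB : (r ^ 2)⁻¹ * volume.real B = 4 := by rw [← vol_affine hr0 0 hBm, ← hIB, hV4]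
    have hrr : (r ^ 2)⁻¹ * r ^ 2 = 1 := by field_simp
    have hsplit := measureReal_inter_add_sdiff (μ := volume) (s := E) hBm (vol_fin hI)
    have hBI : B ⊆ Isq := by rw [Isq_eq_ball]; exact Metric.closedBall_subset_closedBall hr1.le
    have hd : volume.real (E \ B) ≤ volume.real (Isq \ B) := measureReal_mono (sdiff_subset_sdiff_left hI)
      (vol_fin sdiff_subset)
    have hd2 : volume.real (Isq \ B) = 4 - volume.real B := by
      rw [measureReal_sdiff hBI hBm (vol_fin subset_rfl), hV4]
    have h0 : 0 ≤ volume.real (E \ B) := measureReal_nonneg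
    have h1 : 0 ≤ volume.real (E ∩ B) := measureReal_nonneg
    have hE4 : volume.real E ≤ 4 := hV4 ▸ measureReal_mono hI (vol_fin subset_rfl)
    have hr3 : 1 ≤ (r ^ 2)⁻¹ := by
      rw [one_le_inv₀ (by positivity)]; nlinarith
    rw [abs_le]
    constructor
    · nlinarith
    · nlinarith
  · exact husm.comp (contDiff_const_smul r)
  · exact hucs.comp_smul hr0.ne'
  · have e : ∀ x, |u (r • x) - {x : ℝ × ℝ | r • x + 0 ∈ E ∩ B}.indicator 1 x| = (fun y => |u y - (E ∩ B).indicator 1 y|) (r • x + 0) := by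
      intro x
      simp only [add_zero]
      rfl
    simp only [e]
    have := setIntegral_affine hr0 0 (fun y => |u y - (E ∩ B).indicator 1 y|) hBm
    rw [hIB, this]
    refine le_trans ?_ hn2.le
    apply mul_le_mul_of_nonneg_left _ hr2.le
    have e2 : ∫ x in B, |u x - (E ∩ B).indicator 1 x| = ∫ x in B, |u x - E.indicator 1 x| := by
      apply setIntegral_congr_fun hBm
      intro x hx
      simp only
      congr 2
      by_cases hxE : x ∈ E
      · rw [indicator_of_mem hxE, indicator_of_mem (show x ∈ E ∩ B from ⟨hxE, hx⟩)]
      · rw [indicator_of_notMem hxE, indicator_of_notMem (fun hh => hxE hh.1)]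
    rw [e2]
    apply setIntegral_le_integral
    · exact ((huc.integrable_of_hasCompactSupport hucs).sub (integrable_ind hE hI)).abs
    · exact Eventually.of_forall fun x => abs_nonneg _
  · have e : ∀ x, τ (grad (fun x => u (r • x)) x) = (fun y => r * τ (grad u y)) (r • x + 0) := by
      intro x
      rw [hgrad, h.smul, abs_of_pos hr0]
      simp
    simp only [e]
    have := setIntegral_affine hr0 0 (fun y => r * τ (grad u y)) hBm
    rw [hIB, this, integral_const_mul]
    have h1 := mind_tv h hE hI hp hK (r := r) (by linarith)
    rw [← hu, ← hB] at h1
    calc (r ^ 2)⁻¹ * (r * ∫ x in B, τ (grad u x)) ≤ (r ^ 2)⁻¹ * (r * c) := by gcongr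
      _ = c * r⁻¹ := by field_simp
      _ ≤ c + η := hrc.le

open MeasureTheory Set Filter ENNReal

lemma lip_ibp1 {h g : ℝ × ℝ → ℝ} (hh : ExL h) (hg : ContDiff ℝ (⊤ : ℕ∞) g) (hcs : HasCompactSupport g) (e : ℝ × ℝ) :
    Integrable (fun x => fderiv ℝ h x e * g x) ∧ ∫ x, h x * fderiv ℝ g x e = - ∫ x, fderiv ℝ h x e * g x := by
  obtain ⟨L, hL⟩ := hh
  obtain ⟨C, hC⟩ := hg.lipschitzWith_of_hasCompactSupport hcs (by simp)
  have hae : ∀ᵐ x, lineDeriv ℝ h x e = fderiv ℝ h x e := by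
    filter_upwards [hL.ae_differentiableAt (μ := volume)] with x hx
    exact hx.lineDeriv_eq_fderiv
  have i1 : Integrable (fun x => lineDeriv ℝ h x e * g x) := by
    have := (hL.locallyIntegrable_lineDeriv (μ := volume) e).integrable_smul_left_of_hasCompactSupport hg.continuous hcs
    refine this.congr (Eventually.of_forall fun x => ?_)
    simp [mul_comm]
  have hc : (fun x => lineDeriv ℝ h x e * g x) =ᵐ[volume] fun x => fderiv ℝ h x e * g x := by
    filter_upwards [hae] with x hx; rw [hx]
  refine ⟨i1.congr hc, ?_⟩
  rw [← integral_congr_ae hc, hL.integral_lineDeriv_mul_eq hC hcs e, ← integral_neg]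
  congr 1; funext x
  rw [((hg.differentiable (by simp)) x).lineDeriv_eq_fderiv, map_neg]
  ring

lemma div2_comp {f : ℝ × ℝ → ℝ × ℝ} (hf : Differentiable ℝ f) (x : ℝ × ℝ) :
    div2 f x = fderiv ℝ (fun y => (f y).1) x (1, 0) + fderiv ℝ (fun y => (f y).2) x (0, 1) := by
  unfold div2
  rw [fderiv.fst (hf x), fderiv.snd (hf x)]
  simp

lemma lip_ibp {τ : ℝ × ℝ → ℝ} {h : ℝ × ℝ → ℝ} (hh : ExL h) {f} (hf : TF τ f) :
    Integrable (fun x => dot2 (grad h x) (f x)) ∧ ∫ x, h x * div2 f x = - ∫ x, dot2 (grad h x) (f x) := by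
  have s1 : ContDiff ℝ (⊤ : ℕ∞) (fun y => (f y).1) := hf.smooth.fst
  have s2 : ContDiff ℝ (⊤ : ℕ∞) (fun y => (f y).2) := hf.smooth.snd
  have c1 : HasCompactSupport (fun y => (f y).1) := hf.cs.comp_left (g := Prod.fst) rfl
  have c2 : HasCompactSupport (fun y => (f y).2) := hf.cs.comp_left (g := Prod.snd) rfl
  obtain ⟨i1, e1⟩ := lip_ibp1 hh s1 c1 (1, 0)
  obtain ⟨i2, e2⟩ := lip_ibp1 hh s2 c2 (0, 1)
  have hcont : Continuous h := hh.choose_spec.continuous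
  have key : ∀ {g : ℝ × ℝ → ℝ} (hg : ContDiff ℝ (⊤ : ℕ∞) g) (hcs : HasCompactSupport g) (e : ℝ × ℝ),
      Integrable (fun x => h x * fderiv ℝ g x e) := by
    intro g hg hcs e
    apply Continuous.integrable_of_hasCompactSupport
    · exact hcont.mul ((hg.continuous_fderiv (by simp)).clm_apply continuous_const)
    · exact (cs_fderiv_apply hcs e).mul_left
  refine ⟨i1.add i2, ?_⟩
  have : ∀ x, h x * div2 f x = h x * fderiv ℝ (fun y => (f y).1) x (1, 0) + h x * fderiv ℝ (fun y => (f y).2) x (0, 1) := by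
    intro x; rw [div2_comp (hf.smooth.differentiable (by simp))]; ring
  simp only [this]
  rw [integral_add (key s1 c1 _) (key s2 c2 _), e1, e2, ← neg_add, ← integral_add i1 i2]
  rfl

/-- ramp -/
noncomputable def ramp (k θ s : ℝ) : ℝ := max 0 (min 1 (k * (s - θ) + 1))

lemma ramp_exL {w : ℝ × ℝ → ℝ} (hw : ExL w) (k θ : ℝ) : ExL (fun x => ramp k θ (w x)) := by
  have : (fun x => ramp k θ (w x)) = fun x => max 0 ((-1) * max (-1) ((-1) * (k * w x + (1 - k * θ)))) := by
    funext x
    unfold ramp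
    congr 1
    rw [show (-1 : ℝ) * max (-1) (-1 * (k * w x + (1 - k * θ))) = - max (-1) (-(k * w x + (1 - k * θ))) by ring_nf, max_neg_neg, neg_neg]
    congr 1; ring
  rw [this]
  exact (ExL.const 0).max (((ExL.const _).max (((hw.mul k).add (ExL.const _)).mul _)).mul _)

lemma ramp_nonneg (k θ s : ℝ) : 0 ≤ ramp k θ s := le_max_left _ _
lemma ramp_le_one (k θ s : ℝ) : ramp k θ s ≤ 1 := max_le zero_le_one (min_le_left _ _)
lemma ramp_one {k θ s : ℝ} (hk : 0 < k) (h : θ ≤ s) : ramp k θ s = 1 := by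
  unfold ramp
  rw [min_eq_left (by nlinarith), max_eq_right zero_le_one]
lemma ramp_zero {k θ s : ℝ} (hk : 0 < k) (h : s ≤ θ - 1 / k) : ramp k θ s = 0 := by
  unfold ramp
  apply max_eq_left
  refine (min_le_right _ _).trans ?_
  have : k * (s - θ) ≤ k * (- (1 / k)) := by apply mul_le_mul_of_nonneg_left _ hk.le; linarith
  have e : k * (-(1 / k)) = -1 := by field_simp
  linarith
lemma ramp_mid {k θ s : ℝ} (hk : 0 < k) (h : θ - 1 / k < s) (h' : s < θ) : ramp k θ s = k * s + (1 - k * θ) := by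
  have : k * (- (1 / k)) < k * (s - θ) := by apply mul_lt_mul_of_pos_left _ hk; linarith
  have e : k * (-(1 / k)) = -1 := by field_simp
  have : k * (s - θ) < 0 := mul_neg_of_pos_of_neg hk (by linarith)
  unfold ramp
  rw [min_eq_right (by linarith), max_eq_right (by linarith)]
  ring

lemma ramp_grad_zero {w : ℝ × ℝ → ℝ} {k θ : ℝ} (hk : 0 < k) {x : ℝ × ℝ} (h : ¬ (θ - 1 / k < w x ∧ w x < θ)) :
    grad (fun y => ramp k θ (w y)) x = 0 := by
  have : fderiv ℝ (fun y => ramp k θ (w y)) x = 0 := by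
    by_cases h1 : θ ≤ w x
    · apply IsLocalMax.fderiv_eq_zero
      refine Eventually.of_forall fun y => ?_
      simp only
      rw [ramp_one hk h1]; exact ramp_le_one _ _ _
    · apply IsLocalMin.fderiv_eq_zero
      refine Eventually.of_forall fun y => ?_
      simp only
      push Not at h1
      have h2 : w x ≤ θ - 1 / k := by
        by_contra h3
        exact h ⟨not_le.1 h3, h1⟩
      rw [ramp_zero hk h2]; exact ramp_nonneg _ _ _
  unfold grad; rw [this]; rfl

lemma ramp_grad_mid {w : ℝ × ℝ → ℝ} (hw : Continuous w) {k θ : ℝ} (hk : 0 < k) {x : ℝ × ℝ} (h : θ - 1 / k < w x ∧ w x < θ) :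
    grad (fun y => ramp k θ (w y)) x = k • grad w x := by
  have hev : (fun y => ramp k θ (w y)) =ᶠ[nhds x] fun y => k * w y + (1 - k * θ) := by
    filter_upwards [hw.continuousAt.eventually_const_lt h.1, hw.continuousAt.eventually_lt_const h.2] with y h1 h2
    exact ramp_mid hk h1 h2
  have : fderiv ℝ (fun y => ramp k θ (w y)) x = k • fderiv ℝ w x := by
    rw [hev.fderiv_eq, fderiv_add_const]
    exact congrFun (fderiv_const_smul_field (𝕜 := ℝ) (f := w) k) x
  unfold grad
  rw [this]
  simp

/-- level strip -/
def strip (w : ℝ × ℝ → ℝ) (k θ : ℝ) : Set (ℝ × ℝ) := {x | x ∈ Isq ∧ θ - 1 / k < w x ∧ w x < θ}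

lemma strip_meas {w : ℝ × ℝ → ℝ} (hw : Continuous w) (k θ : ℝ) : MeasurableSet (strip w k θ) :=
  measurableSet_Isq.inter ((isOpen_lt continuous_const hw).inter (isOpen_lt hw continuous_const)).measurableSet

lemma ramp_bound {τ : ℝ × ℝ → ℝ} (hτ : IsNorm2 τ) {w G : ℝ × ℝ → ℝ} (hw : ExL w) (hG : Continuous G) (hG0 : ∀ x, 0 ≤ G x)
    (hgr : ∀ᵐ x, x ∈ Isq → τ (grad w x) ≤ G x) {f} (hf : TF τ f) {k θ : ℝ} (hk : 0 < k) :
    ENNReal.ofReal (∫ x, ramp k θ (w x) * div2 f x) ≤ ENNReal.ofReal k * ∫⁻ x in strip w k θ, ENNReal.ofReal (G x) := by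
  have hwc : Continuous w := hw.choose_spec.continuous
  have hsm := strip_meas hwc k θ
  obtain ⟨i1, e1⟩ := lip_ibp (ramp_exL hw k θ) hf
  have iG : IntegrableOn G (strip w k θ) :=
    (hG.continuousOn.integrableOn_compact isCompact_Isq).mono_set (fun x hx => hx.1)
  have i2 : Integrable ((strip w k θ).indicator (fun x => k * G x)) := (integrable_indicator_iff hsm).2 (iG.const_mul k)
  have hle : ∫ x, ramp k θ (w x) * div2 f x ≤ k * ∫ x in strip w k θ, G x := by
    rw [e1, ← integral_neg, ← integral_const_mul, ← integral_indicator hsm]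
    apply integral_mono_ae i1.neg i2
    filter_upwards [hgr] with x hx
    simp only [Pi.neg_apply]
    have hnn : 0 ≤ (strip w k θ).indicator (fun x => k * G x) x := indicator_nonneg (fun x _ => mul_nonneg hk.le (hG0 x)) x
    by_cases hxI : x ∈ Isq
    · by_cases hm : θ - 1 / k < w x ∧ w x < θ
      · rw [indicator_of_mem (show x ∈ strip w k θ from ⟨hxI, hm⟩), ramp_grad_mid hwc hk hm]
        have h1 := hf.adm x (-(k • grad w x))
        rw [hτ.neg, hτ.smul, abs_of_pos hk] at h1
        have h2 : dot2 (-(k • grad w x)) (f x) = - dot2 (k • grad w x) (f x) := by simp [dot2]; ring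
        rw [h2] at h1
        exact h1.trans (mul_le_mul_of_nonneg_left (hx hxI) hk.le)
      · rw [ramp_grad_zero hk hm]
        simpa [dot2] using hnn
    · have : f x = 0 := by
        by_contra h0
        exact hxI (Usq_subset_Isq (hf.supp (subset_tsupport _ h0)))
      rw [this]
      simpa [dot2] using hnn
  refine (ENNReal.ofReal_le_ofReal hle).trans ?_
  rw [ENNReal.ofReal_mul hk.le, ofReal_integral_eq_lintegral_ofReal iG (Eventually.of_forall hG0)]

open MeasureTheory Set Filter ENNReal

/-- strip energy -/
noncomputable def Dk (w G : ℝ × ℝ → ℝ) (k θ : ℝ) : ℝ≥0∞ := ENNReal.ofReal k * ∫⁻ x in strip w k θ, ENNReal.ofReal (G x)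

/-- limiting strip energy -/
noncomputable def DD (w G : ℝ × ℝ → ℝ) (θ : ℝ) : ℝ≥0∞ := liminf (fun n : ℕ => Dk w G (n + 1) θ) atTop

lemma level_per {τ : ℝ × ℝ → ℝ} (hτ : IsNorm2 τ) {w G : ℝ × ℝ → ℝ} (hw : ExL w) (hG : Continuous G) (hG0 : ∀ x, 0 ≤ G x)
    (hgr : ∀ᵐ x, x ∈ Isq → τ (grad w x) ≤ G x) {θ c : ℝ} (hc : 0 ≤ c) (hD : DD w G θ ≤ ENNReal.ofReal c) :
    Per τ {x | x ∈ Isq ∧ θ ≤ w x} c := by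
  intro f hf
  have hwc : Continuous w := hw.choose_spec.continuous
  set P : Set (ℝ × ℝ) := {x | x ∈ Isq ∧ θ ≤ w x} with hP
  have hPm : MeasurableSet P := measurableSet_Isq.inter (isClosed_le continuous_const hwc).measurableSet
  have hdi : Integrable (div2 f) := div2_integrable hf.smooth hf.cs
  have hlim : Tendsto (fun n : ℕ => ∫ x, ramp (n + 1) θ (w x) * div2 f x) atTop (nhds (∫ x in P, div2 f x)) := by
    rw [← integral_indicator hPm]
    apply tendsto_integral_of_dominated_convergence (fun x => |div2 f x|)
    · intro n
      exact ((ramp_exL hw _ θ).choose_spec.continuous.aestronglyMeasurable).mul hdi.aestronglyMeasurable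
    · exact hdi.abs
    · intro n
      refine Eventually.of_forall fun x => ?_
      rw [norm_mul, Real.norm_eq_abs, Real.norm_eq_abs, abs_of_nonneg (ramp_nonneg _ _ _)]
      exact mul_le_of_le_one_left (abs_nonneg _) (ramp_le_one _ _ _)
    · refine Eventually.of_forall fun x => ?_
      have hn0 : ∀ n : ℕ, (0 : ℝ) < n + 1 := fun n => by positivity
      by_cases hx : θ ≤ w x
      · have : ∀ n : ℕ, ramp (n + 1) θ (w x) * div2 f x = P.indicator (div2 f) x := by
          intro n
          rw [ramp_one (hn0 n) hx, one_mul]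
          by_cases hxI : x ∈ Isq
          · rw [indicator_of_mem (show x ∈ P from ⟨hxI, hx⟩)]
          · rw [indicator_of_notMem (fun h => hxI h.1), hf.div2_zero (fun h => hxI (Usq_subset_Isq h))]
        simp only [this]
        exact tendsto_const_nhds
      · rw [indicator_of_notMem (fun h : x ∈ P => hx h.2)]
        push Not at hx
        apply tendsto_const_nhds.congr'
        have := (tendsto_one_div_add_atTop_nhds_zero_nat (𝕜 := ℝ)).eventually_lt_const (show 0 < θ - w x by linarith)
        filter_upwards [this] with n hn
        rw [ramp_zero (hn0 n) (by linarith), zero_mul]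
  have h1 := (ENNReal.tendsto_ofReal hlim).liminf_eq
  have h2 : ENNReal.ofReal (∫ x in P, div2 f x) ≤ DD w G θ := by
    rw [← h1]
    refine liminf_le_liminf (Eventually.of_forall fun n => ?_)
    exact ramp_bound hτ hw hG hG0 hgr hf (by positivity)
  exact (ENNReal.ofReal_le_ofReal_iff hc).1 (h2.trans hD)

lemma Dk_eq {w G : ℝ × ℝ → ℝ} (hw : Continuous w) (k θ : ℝ) :
    Dk w G k θ = ENNReal.ofReal k * ∫⁻ x in Isq, {q : ℝ × (ℝ × ℝ) | q.1 - 1 / k < w q.2 ∧ w q.2 < q.1}.indicator (fun q => ENNReal.ofReal (G q.2)) (θ, x) := by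
  unfold Dk
  congr 1
  rw [← lintegral_indicator (strip_meas hw k θ), ← lintegral_indicator measurableSet_Isq]
  congr 1; funext x
  by_cases h1 : x ∈ Isq
  · by_cases h2 : θ - 1 / k < w x ∧ w x < θ
    · rw [indicator_of_mem (show x ∈ strip w k θ from ⟨h1, h2⟩), indicator_of_mem h1, indicator_of_mem]
      exact h2
    · rw [indicator_of_notMem (fun h : x ∈ strip w k θ => h2 h.2), indicator_of_mem h1, indicator_of_notMem]
      exact h2
  · rw [indicator_of_notMem (fun h : x ∈ strip w k θ => h1 h.1), indicator_of_notMem h1]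

lemma F_meas {w G : ℝ × ℝ → ℝ} (hw : Continuous w) (hG : Continuous G) (k : ℝ) :
    Measurable ({q : ℝ × (ℝ × ℝ) | q.1 - 1 / k < w q.2 ∧ w q.2 < q.1}.indicator (fun q => ENNReal.ofReal (G q.2))) := by
  apply Measurable.indicator
  · exact ENNReal.measurable_ofReal.comp (hG.measurable.comp measurable_snd)
  · exact ((isOpen_lt (by fun_prop : Continuous fun q : ℝ × (ℝ × ℝ) => q.1 - 1 / k) (by fun_prop)).inter
      (isOpen_lt (by fun_prop) (by fun_prop : Continuous fun q : ℝ × (ℝ × ℝ) => q.1))).measurableSet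

lemma Dk_meas {w G : ℝ × ℝ → ℝ} (hw : Continuous w) (hG : Continuous G) (k : ℝ) : Measurable (Dk w G k) := by
  have : Dk w G k = fun θ => _ := funext (Dk_eq hw k)
  rw [this]
  exact (F_meas hw hG k).lintegral_prod_right'.const_mul _

lemma Dk_int {w G : ℝ × ℝ → ℝ} (hw : Continuous w) (hG : Continuous G) {k : ℝ} (hk : 0 < k) :
    ∫⁻ θ, Dk w G k θ = ∫⁻ x in Isq, ENNReal.ofReal (G x) := by
  simp only [Dk_eq hw]
  rw [lintegral_const_mul _ (F_meas hw hG k).lintegral_prod_right']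
  rw [lintegral_lintegral_swap (f := fun θ x => {q : ℝ × (ℝ × ℝ) | q.1 - 1 / k < w q.2 ∧ w q.2 < q.1}.indicator (fun q => ENNReal.ofReal (G q.2)) (θ, x)) (F_meas hw hG k).aemeasurable, ← lintegral_const_mul _ (F_meas hw hG k).lintegral_prod_left']
  congr 1; funext x
  have e : ∀ θ, {q : ℝ × (ℝ × ℝ) | q.1 - 1 / k < w q.2 ∧ w q.2 < q.1}.indicator (fun q => ENNReal.ofReal (G q.2)) (θ, x) =
      (Ioo (w x) (w x + 1 / k)).indicator (fun _ => ENNReal.ofReal (G x)) θ := by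
    intro θ
    by_cases h : θ ∈ Ioo (w x) (w x + 1 / k)
    · rw [indicator_of_mem h, indicator_of_mem]
      exact ⟨by dsimp; linarith [h.2], h.1⟩
    · rw [indicator_of_notMem h, indicator_of_notMem]
      rintro ⟨h1, h2⟩
      exact h ⟨h2, by dsimp at h1; linarith⟩
  simp only [e]
  rw [lintegral_indicator measurableSet_Ioo, setLIntegral_const, Real.volume_Ioo, mul_comm, mul_assoc, ← ENNReal.ofReal_mul (by ring_nf; positivity)]
  rw [show (w x + 1 / k - w x) * k = 1 by field_simp; ring]
  simp

lemma DD_meas {w G : ℝ × ℝ → ℝ} (hw : Continuous w) (hG : Continuous G) : Measurable (DD w G) :=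
  Measurable.liminf fun n => Dk_meas hw hG _

lemma DD_int {w G : ℝ × ℝ → ℝ} (hw : Continuous w) (hG : Continuous G) :
    ∫⁻ θ, DD w G θ ≤ ∫⁻ x in Isq, ENNReal.ofReal (G x) := by
  refine (lintegral_liminf_le fun n => Dk_meas hw hG _).trans ?_
  have : ∀ n : ℕ, ∫⁻ θ, Dk w G (n + 1) θ = ∫⁻ x in Isq, ENNReal.ofReal (G x) := fun n => Dk_int hw hG (by positivity)
  simp only [this]
  exact (liminf_const _).le

open MeasureTheory Set Filter ENNReal

lemma good_level {D : ℝ → ℝ≥0∞} (hD : Measurable D) {M κ : ℝ} (hM : ∫⁻ θ, D θ ≤ ENNReal.ofReal M) (hκ : κ < 1/2)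
    {N : Set ℝ} (hN : volume N = 0) :
    ∃ θ ∈ Ioo κ (1 - κ), θ ∉ N ∧ D θ ≤ ENNReal.ofReal (M / (1 - 2 * κ)) := by
  have hv : volume (Ioo κ (1 - κ)) = ENNReal.ofReal (1 - 2 * κ) := by
    rw [Real.volume_Ioo]; congr 1; ring
  have hpos : 0 < 1 - 2 * κ := by linarith
  have h0 : volume.restrict (Ioo κ (1 - κ)) ≠ 0 := by
    rw [Ne, Measure.restrict_eq_zero, hv]
    simpa using hpos
  obtain ⟨θ, h1, h2⟩ := exists_notMem_null_le_laverage (μ := volume.restrict (Ioo κ (1 - κ))) (f := D)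
    (N := (Ioo κ (1 - κ))ᶜ ∪ N) h0 hD.aemeasurable (by
      refine measure_union_null ?_ ?_
      · rw [Measure.restrict_apply measurableSet_Ioo.compl]; simp
      · exact Measure.absolutelyContinuous_of_le Measure.restrict_le_self hN)
  rw [mem_union, not_or, notMem_compl_iff] at h1
  refine ⟨θ, h1.1, h1.2, h2.trans ?_⟩
  rw [setLAverage_eq, hv, ENNReal.ofReal_div_of_pos hpos]
  exact ENNReal.div_le_div_right ((setLIntegral_le_lintegral _ _).trans hM) _

lemma cheb {w : ℝ × ℝ → ℝ} (hw : Continuous w) {E : Set (ℝ × ℝ)} (hE : MeasurableSet E) (hI : E ⊆ Isq) {δ κ θ : ℝ}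
    (hκ : 0 < κ) (hδ : ∫ x in Isq, |w x - E.indicator 1 x| ≤ δ) (hθ : θ ∈ Ioo κ (1 - κ)) :
    |volume.real {x | x ∈ Isq ∧ θ ≤ w x} - volume.real E| ≤ δ / κ := by
  set f : ℝ × ℝ → ℝ := fun x => |w x - E.indicator 1 x| with hf
  have hind : IntegrableOn (E.indicator (1 : ℝ × ℝ → ℝ)) Isq :=
    (integrableOn_const (C := (1 : ℝ)) (vol_fin (le_refl Isq))).indicator hE
  have hfi : IntegrableOn f Isq := ((hw.continuousOn.integrableOn_compact isCompact_Isq).sub hind).abs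
  have h1 := mul_meas_ge_le_integral_of_nonneg (μ := volume.restrict Isq) (f := f) (ae_of_all _ fun x => abs_nonneg _) hfi κ
  rw [measureReal_restrict_apply' measurableSet_Isq] at h1
  set S := {x | κ ≤ f x} ∩ Isq with hS
  have hSv : volume.real S ≤ δ / κ := by
    rw [le_div_iff₀ hκ]; linarith
  have hSI : S ⊆ Isq := inter_subset_right
  set P := {x | x ∈ Isq ∧ θ ≤ w x} with hP
  have hPI : P ⊆ Isq := fun x hx => hx.1
  have hPE : P ⊆ E ∪ S := by
    rintro x ⟨hx, hx2⟩
    by_cases hxE : x ∈ E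
    · exact Or.inl hxE
    · refine Or.inr ⟨?_, hx⟩
      change κ ≤ |w x - E.indicator 1 x|
      rw [indicator_of_notMem hxE, sub_zero]
      exact le_trans (by linarith [hθ.1]) (le_abs_self _)
  have hEP : E ⊆ P ∪ S := by
    intro x hx
    by_cases hxP : θ ≤ w x
    · exact Or.inl ⟨hI hx, hxP⟩
    · refine Or.inr ⟨?_, hI hx⟩
      change κ ≤ |w x - E.indicator 1 x|
      rw [indicator_of_mem hx, Pi.one_apply]
      push Not at hxP
      exact le_trans (by linarith [hθ.2]) (neg_le_abs _)
  have a1 := (measureReal_mono hPE (vol_fin (union_subset hI hSI))).trans (measureReal_union_le _ _)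
  have a2 := (measureReal_mono hEP (vol_fin (union_subset hPI hSI))).trans (measureReal_union_le _ _)
  rw [abs_le]; constructor <;> linarith

lemma closure_Usq : Isq ⊆ closure Usq := by
  have : Usq = Metric.ball (0 : ℝ × ℝ) 1 := by
    ext x
    rw [mem_ball_zero_iff, Prod.norm_def, max_lt_iff]; rfl
  rw [this, closure_ball _ one_ne_zero, Isq_eq_ball]

lemma core_approx {τ : ℝ × ℝ → ℝ} (h : IsNorm2 τ) {E : Set (ℝ × ℝ)} (hE : MeasurableSet E) (hI : E ⊆ Isq) {c : ℝ}
    (hp : Per τ E c) {η κ : ℝ} (hη : 0 < η) (hκ : 0 < κ) (hκ2 : κ < 1/2) (hV : η + 5 * η / κ < volume.real E) :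
    ∃ R, MemR R ∧ |volume.real R - volume.real E| ≤ η + 5 * η / κ ∧ Per τ R ((c + 5 * η) / (1 - 2 * κ)) := by
  have hc0 : 0 ≤ c := hp.nonneg h
  obtain ⟨E', v, hE', hI', hvol, hv, hcs, hL1, hgr⟩ := stepA h hE hI hp hη
  obtain ⟨n, hn, hap, hag⟩ := pl_approx h hv hcs hη
  set w := pl n (nod n v) with hw
  have hwc : Continuous w := pl_cont _ _
  set G : ℝ × ℝ → ℝ := fun x => τ (grad v x) + η with hG
  have hGc : Continuous G := (h.continuous.comp (grad_continuous hv)).add continuous_const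
  have hG0 : ∀ x, 0 ≤ G x := fun x => add_nonneg (h.nonneg _) hη.le
  have hv4 : volume.real Isq = 4 := by simp [measureReal_def, volume_Isq]
  have hci : IntegrableOn (fun _ : ℝ × ℝ => η) Isq := integrableOn_const (vol_fin (le_refl Isq))
  have hGi : ∫ x in Isq, G x ≤ c + 5 * η := by
    have hti : IntegrableOn (fun x => τ (grad v x)) Isq :=
      (h.continuous.comp (grad_continuous hv)).continuousOn.integrableOn_compact isCompact_Isq
    change ∫ x in Isq, (τ (grad v x) + η) ≤ c + 5 * η
    rw [integral_add hti hci, setIntegral_const, hv4, smul_eq_mul]; linarith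
  have hind : IntegrableOn (E'.indicator (1 : ℝ × ℝ → ℝ)) Isq :=
    (integrableOn_const (C := (1 : ℝ)) (vol_fin (le_refl Isq))).indicator hE'
  have hfi : ∀ u : ℝ × ℝ → ℝ, Continuous u → IntegrableOn (fun x => |u x - E'.indicator 1 x|) Isq := fun u hu =>
    ((hu.continuousOn.integrableOn_compact isCompact_Isq).sub hind).abs
  have hwL : ∫ x in Isq, |w x - E'.indicator 1 x| ≤ 5 * η := by
    have : ∫ x in Isq, |w x - E'.indicator 1 x| ≤ ∫ x in Isq, (|v x - E'.indicator 1 x| + η) := by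
      refine setIntegral_mono_on (hfi w hwc) ((hfi v hv.continuous).add hci) measurableSet_Isq fun x hx => ?_
      have h1 := hap x hx
      have h2 := abs_add_le (v x - E'.indicator 1 x) (w x - v x)
      rw [show v x - E'.indicator 1 x + (w x - v x) = w x - E'.indicator 1 x by ring] at h2
      linarith
    rw [integral_add (hfi v hv.continuous) hci, setIntegral_const, hv4, smul_eq_mul] at this
    linarith
  have hDint : ∫⁻ θ, DD w G θ ≤ ENNReal.ofReal (c + 5 * η) := by
    refine (DD_int hwc hGc).trans ?_
    rw [← ofReal_integral_eq_lintegral_ofReal (hGc.continuousOn.integrableOn_compact isCompact_Isq) (ae_of_all _ hG0)]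
    exact ENNReal.ofReal_le_ofReal hGi
  set N : Set ℝ := range fun p : ℕ × ℕ => nod n v p.1 p.2 with hN
  obtain ⟨θ, hθ, hθN, hθD⟩ := good_level (DD_meas hwc hGc) hDint hκ2 (N := N) ((countable_range _).measure_zero _)
  have hpos : 0 < 1 - 2 * κ := by linarith
  have hPer := level_per h (pl_lip n (nod n v)) hGc hG0 hag (by positivity) hθD
  have key : ∀ θ' ∈ Ioo κ (1 - κ), |volume.real {x | x ∈ Isq ∧ θ' ≤ w x} - volume.real E| ≤ η + 5 * η / κ := by
    intro θ' hθ'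
    have := cheb hwc hE' hI' hκ hwL hθ'
    rw [abs_le] at this hvol ⊢
    constructor <;> linarith
  have hex : ∃ x ∈ Usq, θ < w x := by
    by_contra hcon
    push Not at hcon
    have hall : ∀ x ∈ Isq, w x ≤ θ := fun x hx =>
      closure_minimal (s := Usq) (t := {x | w x ≤ θ}) hcon (isClosed_le hwc continuous_const) (closure_Usq hx)
    have hem : {x | x ∈ Isq ∧ (θ + (1 - κ)) / 2 ≤ w x} = ∅ := by
      ext x
      simp only [Set.mem_ofPred_eq, mem_empty_iff_false, iff_false, not_and, not_le]
      intro hx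
      linarith [hall x hx, hθ.2]
    have := key ((θ + (1 - κ)) / 2) ⟨by linarith [hθ.1, hθ.2], by linarith [hθ.2]⟩
    rw [hem, abs_le, measureReal_empty] at this
    linarith
  obtain ⟨R, hR, hsub, hnull⟩ := memR_pl hn (nod n v) θ (fun i _ j _ he => hθN ⟨(i, j), he⟩) hex
  have hae : R =ᵐ[volume] {x | x ∈ Isq ∧ θ ≤ w x} := by
    refine (ae_le_set.2 hnull).antisymm (LE.le.eventuallyLE hsub)
  refine ⟨R, hR, ?_, ?_⟩
  · rw [measureReal_congr hae]; exact key θ hθ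
  · intro f hf
    rw [setIntegral_congr_set hae]; exact hPer f hf

lemma phiR_le {τ : ℝ × ℝ → ℝ} (h : IsNorm2 τ) {E : Set (ℝ × ℝ)} (hE : MeasurableSet E) (hI : E ⊆ Isq) {c a : ℝ}
    (hp : Per τ E c) (hV0 : 0 < volume.real E) (hVa : volume.real E < a) :
    phiR τ a ≤ ENNReal.ofReal (c / volume.real E) := by
  have hc0 : 0 ≤ c := hp.nonneg h
  set V := volume.real E with hV
  have step : ∀ κ : ℝ, 0 < κ → κ < 1/2 → phiR τ a ≤ ENNReal.ofReal (c / (1 - 2 * κ) / V) := by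
    intro κ hκ hκ2
    have hpos : 0 < 1 - 2 * κ := by linarith
    have ev : ∀ᶠ η in nhdsWithin (0 : ℝ) (Ioi 0), phiR τ a ≤
        ENNReal.ofReal ((c + 5 * η) / (1 - 2 * κ) / (V - (η + 5 * η / κ))) := by
      have ct : Tendsto (fun η : ℝ => η + 5 * η / κ) (nhdsWithin 0 (Ioi 0)) (nhds 0) := by
        have : Continuous fun η : ℝ => η + 5 * η / κ := by fun_prop
        simpa using (this.tendsto 0).mono_left nhdsWithin_le_nhds
      filter_upwards [ct.eventually_lt_const hV0, ct.eventually_lt_const (sub_pos.2 hVa), self_mem_nhdsWithin] with η h1 h2 h3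
      obtain ⟨R, hR, hRV, hRP⟩ := core_approx h hE hI hp h3 hκ hκ2 h1
      rw [← hV, abs_le] at hRV
      have hRpos : 0 < volume.real R := by linarith
      have hRf : volume R ≠ ⊤ := vol_fin hR.2.1
      have hR0 : volume R ≠ 0 := fun h0 => by rw [measureReal_def, h0] at hRpos; simp at hRpos
      have hRe : volume R = ENNReal.ofReal (volume.real R) := by rw [ofReal_measureReal hRf]
      have hRa : volume R ≤ ENNReal.ofReal a := by
        rw [hRe]; exact ENNReal.ofReal_le_ofReal (by linarith)
      have hle : phiR τ a ≤ conduct τ R := iInf₂_le R ⟨hR, hRa⟩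
      refine hle.trans ?_
      · rw [conduct, if_neg hR0, hRe]
        refine (ENNReal.div_le_div_right (surfE_le_of_per h hRP) _).trans ?_
        rw [← ENNReal.ofReal_div_of_pos hRpos]
        have h3' : (0 : ℝ) < η := h3
        exact ENNReal.ofReal_le_ofReal (div_le_div_of_nonneg_left (by positivity) (by linarith) (by linarith))
    have lim : Tendsto (fun η : ℝ => ENNReal.ofReal ((c + 5 * η) / (1 - 2 * κ) / (V - (η + 5 * η / κ)))) (nhdsWithin 0 (Ioi 0))
        (nhds (ENNReal.ofReal (c / (1 - 2 * κ) / V))) := by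
      refine ENNReal.tendsto_ofReal ?_
      have : ContinuousAt (fun η : ℝ => (c + 5 * η) / (1 - 2 * κ) / (V - (η + 5 * η / κ))) 0 := by
        refine ContinuousAt.div (by fun_prop) (by fun_prop) ?_
        simpa using hV0.ne'
      have := this.tendsto.mono_left (nhdsWithin_le_nhds (s := Ioi 0))
      simpa using this
    exact ge_of_tendsto lim ev
  have lim : Tendsto (fun κ : ℝ => ENNReal.ofReal (c / (1 - 2 * κ) / V)) (nhdsWithin 0 (Ioi 0))
      (nhds (ENNReal.ofReal (c / V))) := by
    refine ENNReal.tendsto_ofReal ?_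
    have : ContinuousAt (fun κ : ℝ => c / (1 - 2 * κ) / V) 0 := by
      refine ContinuousAt.div (ContinuousAt.div (by fun_prop) (by fun_prop) (by simp)) (by fun_prop) hV0.ne'
    have := this.tendsto.mono_left (nhdsWithin_le_nhds (s := Ioi 0))
    simpa using this
  refine ge_of_tendsto lim ?_
  filter_upwards [self_mem_nhdsWithin, nhdsWithin_le_nhds (Iio_mem_nhds (show (0 : ℝ) < 1/2 by norm_num))] with κ h1 h2
  exact step κ h1 h2

open MeasureTheory Set Filter ENNReal

lemma memR_facts {R : Set (ℝ × ℝ)} (hR : MemR R) : MeasurableSet R ∧ volume R ≠ 0 ∧ 0 < volume.real R ∧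
    volume R = ENNReal.ofReal (volume.real R) := by
  have hf : volume R ≠ ⊤ := vol_fin hR.2.1
  have h0 : volume R ≠ 0 := (Measure.measure_pos_of_nonempty_interior volume hR.2.2.1).ne'
  exact ⟨hR.1.measurableSet, h0, ENNReal.toReal_pos h0 hf, by rw [ofReal_measureReal hf]⟩

lemma phiR_pos {τ : ℝ × ℝ → ℝ} (h : IsNorm2 τ) {a : ℝ} (ha : a ≤ 3) : 0 < phiR τ a := by
  obtain ⟨k, hk, hiso⟩ := isoper h
  refine lt_of_lt_of_le (ENNReal.ofReal_pos.2 hk) (le_iInf₂ fun R hR => ?_)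
  obtain ⟨hR, hRa⟩ := hR
  obtain ⟨hm, h0, hp, he⟩ := memR_facts hR
  have h3 : volume.real R ≤ 3 := by
    rw [he] at hRa
    have : ENNReal.ofReal (volume.real R) ≤ ENNReal.ofReal 3 := hRa.trans (ENNReal.ofReal_le_ofReal ha)
    exact (ENNReal.ofReal_le_ofReal_iff (by norm_num)).1 this
  rw [conduct, if_neg h0, ENNReal.le_div_iff_mul_le (Or.inl h0) (Or.inl (vol_fin hR.2.1))]
  by_cases hs : surfE τ R = ⊤
  · rw [hs]; exact le_top
  have hP : Per τ R (surfE τ R).toReal := per_of_surfE h ENNReal.toReal_nonneg (by rw [ENNReal.ofReal_toReal hs])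
  have := hiso R hm hR.2.1 h3 _ hP
  rw [he, ← ENNReal.ofReal_mul hk.le, ← ENNReal.ofReal_toReal hs]
  exact ENNReal.ofReal_le_ofReal this

lemma phiR_lt_top {τ : ℝ × ℝ → ℝ} (h : IsNorm2 τ) {a : ℝ} (ha : 1 ≤ a) : phiR τ a < ⊤ := by
  obtain ⟨E, hm, hI, hv, hp⟩ := half_exists h 0 (1/2) (by norm_num) (by norm_num)
  exact (phiR_le h hm hI hp (by rw [hv]; norm_num) (by rw [hv]; linarith)).trans_lt ENNReal.ofReal_lt_top

lemma phiR_lt {τ : ℝ × ℝ → ℝ} (h : IsNorm2 τ) {a a' : ℝ} (ha : a ≤ 3) (ha' : 1 ≤ a') (haa : a' < a) :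
    phiR τ a < phiR τ a' := by
  obtain ⟨k, hk0, hk1, hk⟩ := strict_step h (by linarith : 0 < a') haa ha
  have hpos := phiR_pos h (a := a') (by linarith)
  have hfin := phiR_lt_top h ha'
  have key : phiR τ a ≤ ENNReal.ofReal k * phiR τ a' := by
    have hlow : ∀ R, MemR R → volume R ≤ ENNReal.ofReal a' → surfE τ R ≠ ⊤ →
        phiR τ a ≤ ENNReal.ofReal k * conduct τ R := by
      intro R hR hRa hs
      obtain ⟨hm, h0, hp, he⟩ := memR_facts hR
      have hP : Per τ R (surfE τ R).toReal := per_of_surfE h ENNReal.toReal_nonneg (by rw [ENNReal.ofReal_toReal hs])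
      have hRa' : volume.real R ≤ a' := by
        rw [he] at hRa
        exact (ENNReal.ofReal_le_ofReal_iff (by linarith)).1 hRa
      obtain ⟨E, c', hEm, hEI, hE0, hEa, hEP, hineq⟩ := hk R hm hR.2.1 _ hP hp hRa'
      refine (phiR_le h hEm hEI hEP hE0 hEa).trans ?_
      rw [conduct, if_neg h0, he]
      conv_rhs => rw [← ENNReal.ofReal_toReal hs]
      rw [← ENNReal.ofReal_div_of_pos hp, ← ENNReal.ofReal_mul hk0]
      refine ENNReal.ofReal_le_ofReal ?_
      rw [div_le_iff₀ hE0, mul_div_assoc', div_mul_eq_mul_div, le_div_iff₀ hp]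
      exact hineq
    refine ENNReal.le_of_forall_pos_le_add fun ε hε _ => ?_
    have hlt : phiR τ a' < phiR τ a' + ε := ENNReal.lt_add_right hfin.ne (by simpa using hε.ne')
    obtain ⟨R, hRlt⟩ := iInf_lt_iff.1 hlt
    obtain ⟨hRm, hRlt⟩ := iInf_lt_iff.1 hRlt
    obtain ⟨hR, hRa⟩ := hRm
    have hs : surfE τ R ≠ ⊤ := by
      intro hs
      rw [conduct, if_neg (memR_facts hR).2.1, hs, ENNReal.top_div_of_ne_top (vol_fin hR.2.1)] at hRlt
      exact not_top_lt hRlt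
    have hk1' : ENNReal.ofReal k ≤ 1 := by simpa using hk1.le
    calc phiR τ a ≤ ENNReal.ofReal k * conduct τ R := hlow R hR hRa hs
      _ ≤ ENNReal.ofReal k * (phiR τ a' + ε) := by gcongr
      _ = ENNReal.ofReal k * phiR τ a' + ENNReal.ofReal k * ε := mul_add _ _ _
      _ ≤ ENNReal.ofReal k * phiR τ a' + ε := by gcongr; exact mul_le_of_le_one_left' hk1'
  refine key.trans_lt ?_
  have := ENNReal.mul_lt_mul_left hpos.ne' hfin.ne (show ENNReal.ofReal k < 1 by simpa using hk1)
  simpa [mul_comm] using this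

/-- Positivity and strict monotonicity of the optimal conductance `φ_τ^(a)`, `a ∈ [1,3]`. -/
theorem phi_pos_strict_mono (τ : ℝ × ℝ → ℝ) (hτ : IsNorm2 τ) :
    (∀ a ∈ Set.Icc (1 : ℝ) 3, 0 < phiR τ a) ∧
    (∀ a ∈ Set.Icc (1 : ℝ) 3, ∀ a' ∈ Set.Icc (1 : ℝ) 3, a' < a →
      phiR τ a < phiR τ a') := by
  exact ⟨fun a ha => phiR_pos hτ ha.2, fun a ha a' ha' haa => phiR_lt hτ ha.2 ha'.1 haa⟩
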